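/- arXiv:1107.0527 — 5 statements merged into one kernel-verified Lean document; each statement's English description precedes it below -/
import Mathlib

section
/- Suppose u₁, u₂, u₃ : ℝ⁴ → ℝ are C², p : ℝ⁴ → ℝ is C¹, F₁, F₂, F₃ : ℝ⁴ → ℝ are C¹, and (u₁,u₂,u₃,p) satisfies the system (NS). Define Z : ℝ⁴ → ℝ^55 by: Z₁ = ∂u₁/∂x₂, Z₂ = ∂u₁/∂x₃, Z₃ = u₁, Z₄ = ∂u₂/∂x₁, Z₅ = ∂u₂/∂x₂, Z₆ = ∂u₂/∂x₃, Z₇ = u₂, Z₈ = ∂u₃/∂x₁, Z₉ = ∂u₃/∂x₂, Z₁₀ = ∂u₃/∂x₃, Z₁₁ = u₃, Z₁₂ = ∂p/∂t, Z₁₃ = ∂p/∂x₁, Z₁₄ = ∂p/∂x₂, Z₁₅ = ∂p/∂x₃, Z₁₆ = p; (Z₁₇,…,Z₂₆) = (∂²u₁/∂t², ∂²u₁/∂x₁², ∂²u₁/∂x₂², ∂²u₁/∂x₃², ∂²u₁/∂t∂x₁, ∂²u₁/∂t∂x₂, ∂²u₁/∂t∂x₃, ∂²u₁/∂x₁∂x₂,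 ∂²u₁/∂x₁∂x₃, ∂²u₁/∂x₂∂x₃); (Z₂₇,…,Z₃₆) the same ten second derivatives of u₂; (Z₃₇,…,Z₄₆) the same ten second derivatives of u₃; and (Z₄₇,…,Z₅₅) = (u₁∂u₁/∂x₁, u₂∂u₁/∂x₂, u₃∂u₁/∂x₃, u₁∂u₂/∂x₁, u₂∂u₂/∂x₂, u₃∂u₂/∂x₃, u₁∂u₃/∂x₁, u₂∂u₃/∂x₂, u₃∂u₃/∂x₃). Then Z satisfies the linear system (L) and the quadratic system (Q). -/
open Matrix

/-- Points of `ℝ⁴`, written `(t, x₁, x₂, x₃)`: coordinate `0` is `t`,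
coordinates `1, 2, 3` are `x₁, x₂, x₃`. -/
abbrev R4 := Fin 4 → ℝ

/-- Partial derivative in the `i`-th coordinate direction. -/
noncomputable def pd (i : Fin 4) (f : R4 → ℝ) (x : R4) : ℝ :=
  fderiv ℝ f x (Pi.single i 1)

/-- `e i` is the `i`-th standard basis vector of `ℝ^55` (`1 ≤ i ≤ 55`, one-based). -/
def e (i : ℕ) : Fin 55 → ℝ := fun j => if (j : ℕ) + 1 = i then 1 else 0

def α₁ : Fin 55 → ℝ := e 5 + e 10
def α₂ (μ τ : ℝ) : Fin 55 → ℝ := τ • e 13 - μ • (e 18 + e 19 + e 20) + e 47 + e 48 + e 49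
def α₃ (μ τ : ℝ) : Fin 55 → ℝ := τ • e 14 - μ • (e 28 + e 29 + e 30) + e 50 + e 51 + e 52
def α₄ (μ τ : ℝ) : Fin 55 → ℝ := τ • e 15 - μ • (e 38 + e 39 + e 40) + e 53 + e 54 + e 55

/-- The `16 × 55` matrix `H`. -/
def Hm (μ τ : ℝ) : Matrix (Fin 16) (Fin 55) ℝ :=
  Matrix.of ![-α₁, -α₂ μ τ, -α₃ μ τ, -α₄ μ τ, e 1, e 2, e 3, e 4, e 5, e 6, e 7, e 8,
    e 9, e 10, e 11, e 16]

/-- The `16 × 55` matrix `H₀`. -/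
def Hm0 (μ τ : ℝ) : Matrix (Fin 16) (Fin 55) ℝ :=
  Matrix.of ![e 21, e 17, e 27, e 37, e 22, e 23, -α₂ μ τ, e 31, e 32, e 33, -α₃ μ τ,
    e 41, e 42, e 43, -α₄ μ τ, e 12]

/-- The `16 × 55` matrix `H₁`. -/
def Hm1 : Matrix (Fin 16) (Fin 55) ℝ :=
  Matrix.of ![e 18, e 21, e 31, e 41, e 24, e 25, -α₁, e 28, e 34, e 35, e 4, e 38,
    e 44, e 45, e 8, e 13]

/-- The `16 × 55` matrix `H₂`. -/
def Hm2 : Matrix (Fin 16) (Fin 55) ℝ :=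
  Matrix.of ![e 24, e 22, e 32, e 42, e 19, e 26, e 1, e 34, e 29, e 36, e 5, e 44,
    e 39, e 46, e 9, e 14]

/-- The `16 × 55` matrix `H₃`. -/
def Hm3 : Matrix (Fin 16) (Fin 55) ℝ :=
  Matrix.of ![e 25, e 23, e 33, e 43, e 26, e 20, e 2, e 35, e 36, e 30, e 6, e 45,
    e 46, e 40, e 10, e 15]

/-- The three spatial matrices `H₁, H₂, H₃`. -/
def HmX : Fin 3 → Matrix (Fin 16) (Fin 55) ℝ := ![Hm1, Hm2, Hm3]

/-- `h : ℝ⁴ → ℝ¹⁶` has `F₁, F₂, F₃` in entries `2, 3, 4` and zeros elsewhere. -/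
def hv (F₁ F₂ F₃ : R4 → ℝ) (x : R4) : Fin 16 → ℝ :=
  ![0, F₁ x, F₂ x, F₃ x, 0, 0, 0, 0, 0, 0, 0, 0, 0, 0, 0, 0]

/-- `h₀ : ℝ⁴ → ℝ¹⁶` has `F₁, F₂, F₃` in entries `7, 11, 15` and zeros elsewhere. -/
def hv0 (F₁ F₂ F₃ : R4 → ℝ) (x : R4) : Fin 16 → ℝ :=
  ![0, 0, 0, 0, 0, 0, F₁ x, 0, 0, 0, F₂ x, 0, 0, 0, F₃ x, 0]

/-- The Navier–Stokes system (NS). -/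
def NS (μ τ : ℝ) (u₁ u₂ u₃ p F₁ F₂ F₃ : R4 → ℝ) : Prop :=
  (∀ x, pd 1 u₁ x + pd 2 u₂ x + pd 3 u₃ x = 0) ∧
  (∀ x, pd 0 u₁ x - μ * (pd 1 (pd 1 u₁) x + pd 2 (pd 2 u₁) x + pd 3 (pd 3 u₁) x)
      + (u₁ x * pd 1 u₁ x + u₂ x * pd 2 u₁ x + u₃ x * pd 3 u₁ x)
      + τ * pd 1 p x = F₁ x) ∧
  (∀ x, pd 0 u₂ x - μ * (pd 1 (pd 1 u₂) x + pd 2 (pd 2 u₂) x + pd 3 (pd 3 u₂) x)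
      + (u₁ x * pd 1 u₂ x + u₂ x * pd 2 u₂ x + u₃ x * pd 3 u₂ x)
      + τ * pd 2 p x = F₂ x) ∧
  (∀ x, pd 0 u₃ x - μ * (pd 1 (pd 1 u₃) x + pd 2 (pd 2 u₃) x + pd 3 (pd 3 u₃) x)
      + (u₁ x * pd 1 u₃ x + u₂ x * pd 2 u₃ x + u₃ x * pd 3 u₃ x)
      + τ * pd 3 p x = F₃ x)

/-- The linear system (L): all `16` components of `HZ + h` are differentiable on `ℝ⁴`,
`∂(HZ+h)/∂t = H₀ Z + h₀` and `∂(HZ+h)/∂x_i = H_i Z` for `i = 1, 2, 3`. -/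
def LSys (μ τ : ℝ) (F₁ F₂ F₃ : R4 → ℝ) (Z : R4 → Fin 55 → ℝ) : Prop :=
  (∀ k : Fin 16, Differentiable ℝ (fun x => (Hm μ τ).mulVec (Z x) k + hv F₁ F₂ F₃ x k)) ∧
  (∀ x, ∀ k : Fin 16,
      pd 0 (fun y => (Hm μ τ).mulVec (Z y) k + hv F₁ F₂ F₃ y k) x
        = (Hm0 μ τ).mulVec (Z x) k + hv0 F₁ F₂ F₃ x k) ∧
  (∀ i : Fin 3, ∀ x, ∀ k : Fin 16,
      pd i.succ (fun y => (Hm μ τ).mulVec (Z y) k + hv F₁ F₂ F₃ y k) x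
        = (HmX i).mulVec (Z x) k)

/-- The quadratic system (Q). -/
def QSys (Z : R4 → Fin 55 → ℝ) : Prop :=
  ∀ x : R4,
    Z x 46 = -(Z x 2) * (Z x 4 + Z x 9) ∧
    Z x 47 = Z x 6 * Z x 0 ∧
    Z x 48 = Z x 10 * Z x 1 ∧
    Z x 49 = Z x 2 * Z x 3 ∧
    Z x 50 = Z x 6 * Z x 4 ∧
    Z x 51 = Z x 10 * Z x 5 ∧
    Z x 52 = Z x 2 * Z x 7 ∧
    Z x 53 = Z x 6 * Z x 8 ∧
    Z x 54 = Z x 10 * Z x 9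

/-- The vector `Z : ℝ⁴ → ℝ^55` built from `(u₁, u₂, u₃, p)`. -/
noncomputable def Zdef (u₁ u₂ u₃ p : R4 → ℝ) (x : R4) : Fin 55 → ℝ :=
  ![pd 2 u₁ x, pd 3 u₁ x, u₁ x,
    pd 1 u₂ x, pd 2 u₂ x, pd 3 u₂ x, u₂ x,
    pd 1 u₃ x, pd 2 u₃ x, pd 3 u₃ x, u₃ x,
    pd 0 p x, pd 1 p x, pd 2 p x, pd 3 p x, p x,
    pd 0 (pd 0 u₁) x, pd 1 (pd 1 u₁) x, pd 2 (pd 2 u₁) x, pd 3 (pd 3 u₁) x,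
    pd 0 (pd 1 u₁) x, pd 0 (pd 2 u₁) x, pd 0 (pd 3 u₁) x,
    pd 1 (pd 2 u₁) x, pd 1 (pd 3 u₁) x, pd 2 (pd 3 u₁) x,
    pd 0 (pd 0 u₂) x, pd 1 (pd 1 u₂) x, pd 2 (pd 2 u₂) x, pd 3 (pd 3 u₂) x,
    pd 0 (pd 1 u₂) x, pd 0 (pd 2 u₂) x, pd 0 (pd 3 u₂) x,
    pd 1 (pd 2 u₂) x, pd 1 (pd 3 u₂) x, pd 2 (pd 3 u₂) x,
    pd 0 (pd 0 u₃) x, pd 1 (pd 1 u₃) x, pd 2 (pd 2 u₃) x, pd 3 (pd 3 u₃) x,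
    pd 0 (pd 1 u₃) x, pd 0 (pd 2 u₃) x, pd 0 (pd 3 u₃) x,
    pd 1 (pd 2 u₃) x, pd 1 (pd 3 u₃) x, pd 2 (pd 3 u₃) x,
    u₁ x * pd 1 u₁ x, u₂ x * pd 2 u₁ x, u₃ x * pd 3 u₁ x,
    u₁ x * pd 1 u₂ x, u₂ x * pd 2 u₂ x, u₃ x * pd 3 u₂ x,
    u₁ x * pd 1 u₃ x, u₂ x * pd 2 u₃ x, u₃ x * pd 3 u₃ x]

/-- Dot product with a standard basis vector picks out a coordinate. -/
lemma e_dot (n : ℕ) (h1 : 0 < n) (h2 : n - 1 < 55) (v : Fin 55 → ℝ) :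
    e n ⬝ᵥ v = v ⟨n - 1, h2⟩ := by
  have key : ∀ j : Fin 55, ((j : ℕ) + 1 = n) ↔ j = ⟨n - 1, h2⟩ := by
    intro j
    rw [Fin.ext_iff]
    simp only
    omega
  simp [dotProduct, e, key]

lemma mulVec_row (f : Fin 16 → Fin 55 → ℝ) (v : Fin 55 → ℝ) (k : Fin 16) :
    (Matrix.of f).mulVec v k = f k ⬝ᵥ v := rfl

lemma α₁_dot (v : Fin 55 → ℝ) : α₁ ⬝ᵥ v = v 4 + v 9 := by
  simp [α₁, add_dotProduct, e_dot]

lemma α₂_dot (μ τ : ℝ) (v : Fin 55 → ℝ) :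
    α₂ μ τ ⬝ᵥ v = τ * v 12 - μ * (v 17 + v 18 + v 19) + v 46 + v 47 + v 48 := by
  simp [α₂, add_dotProduct, sub_dotProduct, smul_dotProduct, e_dot, mul_add]

lemma α₃_dot (μ τ : ℝ) (v : Fin 55 → ℝ) :
    α₃ μ τ ⬝ᵥ v = τ * v 13 - μ * (v 27 + v 28 + v 29) + v 49 + v 50 + v 51 := by
  simp [α₃, add_dotProduct, sub_dotProduct, smul_dotProduct, e_dot, mul_add]

lemma α₄_dot (μ τ : ℝ) (v : Fin 55 → ℝ) :
    α₄ μ τ ⬝ᵥ v = τ * v 14 - μ * (v 37 + v 38 + v 39) + v 52 + v 53 + v 54 := by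
  simp [α₄, add_dotProduct, sub_dotProduct, smul_dotProduct, e_dot, mul_add]

lemma pd_differentiable {f : R4 → ℝ} (hf : ContDiff ℝ 2 f) (i : Fin 4) :
    Differentiable ℝ (pd i f) := by
  have h : ContDiff ℝ 1 (fderiv ℝ f) := hf.fderiv_right (by norm_num)
  have h' : Differentiable ℝ (fderiv ℝ f) := h.differentiable (by norm_num)
  intro x
  exact (h' x).clm_apply (differentiableAt_const _)

lemma pd_pd {f : R4 → ℝ} (hf : ContDiff ℝ 2 f) (i j : Fin 4) (x : R4) :
    pd i (pd j f) x = fderiv ℝ (fderiv ℝ f) x (Pi.single i 1) (Pi.single j 1) := by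
  have h : ContDiff ℝ 1 (fderiv ℝ f) := hf.fderiv_right (by norm_num)
  have h' : Differentiable ℝ (fderiv ℝ f) := h.differentiable (by norm_num)
  change fderiv ℝ (fun y => fderiv ℝ f y (Pi.single j 1)) x (Pi.single i 1) = _
  rw [fderiv_clm_apply (h' x) (differentiableAt_const _)]
  simp

/-- Symmetry of second partial derivatives. -/
lemma pd_comm {f : R4 → ℝ} (hf : ContDiff ℝ 2 f) (i j : Fin 4) (x : R4) :
    pd i (pd j f) x = pd j (pd i f) x := by
  rw [pd_pd hf, pd_pd hf]
  have hs : IsSymmSndFDerivAt ℝ f x := hf.contDiffAt.isSymmSndFDerivAt (by simp)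
  exact hs _ _

/-- The simplified components of `HZ + h`. -/
noncomputable def Gv (u₁ u₂ u₃ p : R4 → ℝ) : Fin 16 → R4 → ℝ :=
  ![pd 1 u₁, pd 0 u₁, pd 0 u₂, pd 0 u₃, pd 2 u₁, pd 3 u₁, u₁, pd 1 u₂, pd 2 u₂, pd 3 u₂, u₂,
    pd 1 u₃, pd 2 u₃, pd 3 u₃, u₃, p]

lemma HZ_eq {μ τ : ℝ} {u₁ u₂ u₃ p F₁ F₂ F₃ : R4 → ℝ}
    (hNS : NS μ τ u₁ u₂ u₃ p F₁ F₂ F₃) (k : Fin 16) :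
    (fun y => (Hm μ τ).mulVec (Zdef u₁ u₂ u₃ p y) k + hv F₁ F₂ F₃ y k) = Gv u₁ u₂ u₃ p k := by
  obtain ⟨h0, h1, h2, h3⟩ := hNS
  funext y
  have h0 := h0 y
  have h1 := h1 y
  have h2 := h2 y
  have h3 := h3 y
  fin_cases k <;>
  simp [mulVec_row, Hm, hv, Gv, α₁_dot, α₂_dot, α₃_dot, α₄_dot, e_dot] <;>
  simp [Zdef] <;> linarith

/-- If `u₁, u₂, u₃` are `C²`, `p` is `C¹`, `F₁, F₂, F₃` are `C¹`, and
`(u₁, u₂, u₃, p)` satisfies the Navier–Stokes system (NS), then the vector function `Z`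
built from the `u`'s, `p` and their derivatives and products satisfies the linear system
(L) and the quadratic system (Q). -/
theorem stmt2 (μ τ : ℝ) (hμ : 0 < μ) (hτ : 0 < τ)
    (u₁ u₂ u₃ p F₁ F₂ F₃ : R4 → ℝ)
    (hu₁ : ContDiff ℝ 2 u₁) (hu₂ : ContDiff ℝ 2 u₂) (hu₃ : ContDiff ℝ 2 u₃)
    (hp : ContDiff ℝ 1 p)
    (hF₁ : ContDiff ℝ 1 F₁) (hF₂ : ContDiff ℝ 1 F₂) (hF₃ : ContDiff ℝ 1 F₃)
    (hNS : NS μ τ u₁ u₂ u₃ p F₁ F₂ F₃) :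
    LSys μ τ F₁ F₂ F₃ (Zdef u₁ u₂ u₃ p) ∧ QSys (Zdef u₁ u₂ u₃ p) := by
  refine ⟨⟨?_, ?_, ?_⟩, ?_⟩
  · intro k
    rw [HZ_eq hNS]
    have d1 := pd_differentiable hu₁
    have d2 := pd_differentiable hu₂
    have d3 := pd_differentiable hu₃
    have e1 : Differentiable ℝ u₁ := hu₁.differentiable (by norm_num)
    have e2 : Differentiable ℝ u₂ := hu₂.differentiable (by norm_num)
    have e3 : Differentiable ℝ u₃ := hu₃.differentiable (by norm_num)
    have e4 : Differentiable ℝ p := hp.differentiable (by norm_num)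
    fin_cases k <;> simp [Gv, d1, d2, d3, e1, e2, e3, e4]
  · intro x k
    rw [HZ_eq hNS]
    obtain ⟨h0, h1, h2, h3⟩ := hNS
    have h0 := h0 x
    have h1 := h1 x
    have h2 := h2 x
    have h3 := h3 x
    fin_cases k <;>
    simp [mulVec_row, Hm0, hv0, Gv, α₁_dot, α₂_dot, α₃_dot, α₄_dot, e_dot] <;>
    simp [Zdef] <;>
    first
    | linarith
    | exact pd_comm hu₁ _ _ x
    | exact pd_comm hu₂ _ _ x
    | exact pd_comm hu₃ _ _ x
  · intro i x k
    rw [HZ_eq hNS]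
    have h0 := hNS.1 x
    fin_cases i <;> fin_cases k <;>
    simp [mulVec_row, HmX, Hm1, Hm2, Hm3, Gv, α₁_dot, e_dot] <;>
    simp [Zdef] <;>
    first
    | linarith
    | exact pd_comm hu₁ _ _ x
    | exact pd_comm hu₂ _ _ x
    | exact pd_comm hu₃ _ _ x
  · intro x
    have h0 := hNS.1 x
    have h1 : pd 1 u₁ x = -(pd 2 u₂ x + pd 3 u₃ x) := by linarith
    simp [Zdef, h1]
    try ring
end

section
/- Let F₁, F₂, F₃ : ℝ⁴ → ℝ be C¹ and let Z : ℝ⁴ → ℝ^55 be such that every component of HZ+h is continuously differentiable on ℝ⁴ and Z satisfies the linear system (L) and the quadratic system (Q). Then u₁ := Z₃, u₂ := Z₇, u₃ := Z₁₁ are C² on ℝ⁴, p := Z₁₆ is C¹ on ℝ⁴, and (u₁,u₂,u₃,p) satisfies the system (NS). -/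
open Matrix

theorem e_dot_s3 (i : ℕ) (j : Fin 55) (h : (j : ℕ) + 1 = i) (z : Fin 55 → ℝ) :
    e i ⬝ᵥ z = z j := by
  have : e i = Pi.single j 1 := by
    funext k
    subst h
    simp only [e, Pi.single_apply, Fin.ext_iff, Nat.add_right_cancel_iff]
  rw [this, single_one_dotProduct]

theorem contDiff_two_of_pd (f : R4 → ℝ) (hf : Differentiable ℝ f)
    (h : ∀ i, ContDiff ℝ 1 (pd i f)) : ContDiff ℝ 2 f := by
  have h2 : (2 : WithTop ℕ∞) = 1 + 1 := by norm_num
  rw [h2, contDiff_succ_iff_fderiv_apply]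
  refine ⟨hf, by simp, fun y => ?_⟩
  have : (fun x => fderiv ℝ f x y) = fun x => ∑ i, y i * pd i f x := by
    funext x
    conv_lhs => rw [pi_eq_sum_univ' y]
    simp [pd, map_sum, Pi.single_apply, ← Pi.single_apply]
  rw [this]
  exact ContDiff.sum fun i _ => contDiff_const.mul (h i)

/-- Let `F₁, F₂, F₃` be `C¹` and let `Z : ℝ⁴ → ℝ^55` be such that every
component of `HZ + h` is continuously differentiable on `ℝ⁴` and `Z` satisfies the linear
system (L) and the quadratic system (Q).  Then `u₁ := Z₃`, `u₂ := Z₇`, `u₃ := Z₁₁` are `C²`,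
`p := Z₁₆` is `C¹`, and `(u₁, u₂, u₃, p)` satisfies the Navier–Stokes system (NS). -/
theorem stmt3 (μ τ : ℝ) (hμ : 0 < μ) (hτ : 0 < τ)
    (F₁ F₂ F₃ : R4 → ℝ)
    (hF₁ : ContDiff ℝ 1 F₁) (hF₂ : ContDiff ℝ 1 F₂) (hF₃ : ContDiff ℝ 1 F₃)
    (Z : R4 → Fin 55 → ℝ)
    (hC1 : ∀ k : Fin 16,
      ContDiff ℝ 1 (fun x => (Hm μ τ).mulVec (Z x) k + hv F₁ F₂ F₃ x k))
    (hL : LSys μ τ F₁ F₂ F₃ Z) (hQ : QSys Z) :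
    ContDiff ℝ 2 (fun x => Z x 2) ∧ ContDiff ℝ 2 (fun x => Z x 6) ∧
    ContDiff ℝ 2 (fun x => Z x 10) ∧ ContDiff ℝ 1 (fun x => Z x 15) ∧
    NS μ τ (fun x => Z x 2) (fun x => Z x 6) (fun x => Z x 10) (fun x => Z x 15)
      F₁ F₂ F₃ := by
  obtain ⟨hD, hT, hX⟩ := hL
  set G : Fin 16 → R4 → ℝ := fun k x => (Hm μ τ).mulVec (Z x) k + hv F₁ F₂ F₃ x k with hG
  replace hC1 : ∀ k, ContDiff ℝ 1 (G k) := hC1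
  replace hD : ∀ k, Differentiable ℝ (G k) := hD
  replace hT : ∀ x k, pd 0 (G k) x = (Hm0 μ τ k) ⬝ᵥ Z x + hv0 F₁ F₂ F₃ x k := hT
  have h1 : ∀ x k, pd 1 (G k) x = Hm1 k ⬝ᵥ Z x := hX 0
  have h2 : ∀ x k, pd 2 (G k) x = Hm2 k ⬝ᵥ Z x := hX 1
  have h3 : ∀ x k, pd 3 (G k) x = Hm3 k ⬝ᵥ Z x := hX 2
  have g4 : G 4 = fun x => Z x 0 := by
    funext x
    change e 1 ⬝ᵥ Z x + 0 = _
    rw [e_dot_s3 1 0 rfl, add_zero]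
  have g5 : G 5 = fun x => Z x 1 := by
    funext x
    change e 2 ⬝ᵥ Z x + 0 = _
    rw [e_dot_s3 2 1 rfl, add_zero]
  have g6 : G 6 = fun x => Z x 2 := by
    funext x
    change e 3 ⬝ᵥ Z x + 0 = _
    rw [e_dot_s3 3 2 rfl, add_zero]
  have g7 : G 7 = fun x => Z x 3 := by
    funext x
    change e 4 ⬝ᵥ Z x + 0 = _
    rw [e_dot_s3 4 3 rfl, add_zero]
  have g8 : G 8 = fun x => Z x 4 := by
    funext x
    change e 5 ⬝ᵥ Z x + 0 = _
    rw [e_dot_s3 5 4 rfl, add_zero]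
  have g9 : G 9 = fun x => Z x 5 := by
    funext x
    change e 6 ⬝ᵥ Z x + 0 = _
    rw [e_dot_s3 6 5 rfl, add_zero]
  have g10 : G 10 = fun x => Z x 6 := by
    funext x
    change e 7 ⬝ᵥ Z x + 0 = _
    rw [e_dot_s3 7 6 rfl, add_zero]
  have g11 : G 11 = fun x => Z x 7 := by
    funext x
    change e 8 ⬝ᵥ Z x + 0 = _
    rw [e_dot_s3 8 7 rfl, add_zero]
  have g12 : G 12 = fun x => Z x 8 := by
    funext x
    change e 9 ⬝ᵥ Z x + 0 = _
    rw [e_dot_s3 9 8 rfl, add_zero]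
  have g13 : G 13 = fun x => Z x 9 := by
    funext x
    change e 10 ⬝ᵥ Z x + 0 = _
    rw [e_dot_s3 10 9 rfl, add_zero]
  have g14 : G 14 = fun x => Z x 10 := by
    funext x
    change e 11 ⬝ᵥ Z x + 0 = _
    rw [e_dot_s3 11 10 rfl, add_zero]
  have g15 : G 15 = fun x => Z x 15 := by
    funext x
    change e 16 ⬝ᵥ Z x + 0 = _
    rw [e_dot_s3 16 15 rfl, add_zero]
  have a1 : ∀ z : Fin 55 → ℝ, α₁ ⬝ᵥ z = z 4 + z 9 := fun z => by
    simp only [α₁, add_dotProduct, e_dot_s3 5 4 rfl, e_dot_s3 10 9 rfl]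
  have a2 : ∀ z : Fin 55 → ℝ, α₂ μ τ ⬝ᵥ z =
      τ * z 12 - μ * (z 17 + z 18 + z 19) + z 46 + z 47 + z 48 := fun z => by
    simp only [α₂, add_dotProduct, sub_dotProduct, smul_dotProduct, smul_eq_mul,
      e_dot_s3 13 12 rfl, e_dot_s3 18 17 rfl, e_dot_s3 19 18 rfl, e_dot_s3 20 19 rfl, e_dot_s3 47 46 rfl, e_dot_s3 48 47 rfl, e_dot_s3 49 48 rfl]
  have a3 : ∀ z : Fin 55 → ℝ, α₃ μ τ ⬝ᵥ z =
      τ * z 13 - μ * (z 27 + z 28 + z 29) + z 49 + z 50 + z 51 := fun z => by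
    simp only [α₃, add_dotProduct, sub_dotProduct, smul_dotProduct, smul_eq_mul,
      e_dot_s3 14 13 rfl, e_dot_s3 28 27 rfl, e_dot_s3 29 28 rfl, e_dot_s3 30 29 rfl, e_dot_s3 50 49 rfl, e_dot_s3 51 50 rfl, e_dot_s3 52 51 rfl]
  have a4 : ∀ z : Fin 55 → ℝ, α₄ μ τ ⬝ᵥ z =
      τ * z 14 - μ * (z 37 + z 38 + z 39) + z 52 + z 53 + z 54 := fun z => by
    simp only [α₄, add_dotProduct, sub_dotProduct, smul_dotProduct, smul_eq_mul,
      e_dot_s3 15 14 rfl, e_dot_s3 38 37 rfl, e_dot_s3 39 38 rfl, e_dot_s3 40 39 rfl, e_dot_s3 53 52 rfl, e_dot_s3 54 53 rfl, e_dot_s3 55 54 rfl]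
  have g0 : G 0 = fun x => -(Z x 4 + Z x 9) := by
    funext x
    change (-α₁) ⬝ᵥ Z x + 0 = _
    rw [neg_dotProduct, a1, add_zero]
  have d6_0 : pd 0 (G 6) = G 1 := funext fun x => hT x 6
  have d6_1 : pd 1 (G 6) = G 0 := by
    funext x
    rw [h1]
    exact (add_zero _).symm
  have d6_2 : pd 2 (G 6) = G 4 := by
    funext x
    rw [h2]
    exact (add_zero _).symm
  have d6_3 : pd 3 (G 6) = G 5 := by
    funext x
    rw [h3]
    exact (add_zero _).symm
  have c6 : ContDiff ℝ 2 (G 6) := by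
    refine contDiff_two_of_pd _ (hD 6) fun i => ?_
    fin_cases i
    · exact d6_0 ▸ hC1 1
    · exact d6_1 ▸ hC1 0
    · exact d6_2 ▸ hC1 4
    · exact d6_3 ▸ hC1 5
  have s6_1 : ∀ x, pd 1 (G 0) x = Z x 17 := fun x =>
    (h1 x 0).trans (e_dot_s3 18 17 rfl (Z x))
  have s6_2 : ∀ x, pd 2 (G 4) x = Z x 18 := fun x =>
    (h2 x 4).trans (e_dot_s3 19 18 rfl (Z x))
  have s6_3 : ∀ x, pd 3 (G 5) x = Z x 19 := fun x =>
    (h3 x 5).trans (e_dot_s3 20 19 rfl (Z x))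
  have f1 : ∀ x, G 1 x = -(α₂ μ τ ⬝ᵥ Z x) + F₁ x := fun x => by
    change (-α₂ μ τ) ⬝ᵥ Z x + F₁ x = _
    rw [neg_dotProduct]
  have d10_0 : pd 0 (G 10) = G 2 := funext fun x => hT x 10
  have d10_1 : pd 1 (G 10) = G 7 := by
    funext x
    rw [h1]
    exact (add_zero _).symm
  have d10_2 : pd 2 (G 10) = G 8 := by
    funext x
    rw [h2]
    exact (add_zero _).symm
  have d10_3 : pd 3 (G 10) = G 9 := by
    funext x
    rw [h3]
    exact (add_zero _).symm
  have c10 : ContDiff ℝ 2 (G 10) := by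
    refine contDiff_two_of_pd _ (hD 10) fun i => ?_
    fin_cases i
    · exact d10_0 ▸ hC1 2
    · exact d10_1 ▸ hC1 7
    · exact d10_2 ▸ hC1 8
    · exact d10_3 ▸ hC1 9
  have s10_1 : ∀ x, pd 1 (G 7) x = Z x 27 := fun x =>
    (h1 x 7).trans (e_dot_s3 28 27 rfl (Z x))
  have s10_2 : ∀ x, pd 2 (G 8) x = Z x 28 := fun x =>
    (h2 x 8).trans (e_dot_s3 29 28 rfl (Z x))
  have s10_3 : ∀ x, pd 3 (G 9) x = Z x 29 := fun x =>
    (h3 x 9).trans (e_dot_s3 30 29 rfl (Z x))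
  have f2 : ∀ x, G 2 x = -(α₃ μ τ ⬝ᵥ Z x) + F₂ x := fun x => by
    change (-α₃ μ τ) ⬝ᵥ Z x + F₂ x = _
    rw [neg_dotProduct]
  have d14_0 : pd 0 (G 14) = G 3 := funext fun x => hT x 14
  have d14_1 : pd 1 (G 14) = G 11 := by
    funext x
    rw [h1]
    exact (add_zero _).symm
  have d14_2 : pd 2 (G 14) = G 12 := by
    funext x
    rw [h2]
    exact (add_zero _).symm
  have d14_3 : pd 3 (G 14) = G 13 := by
    funext x
    rw [h3]
    exact (add_zero _).symm
  have c14 : ContDiff ℝ 2 (G 14) := by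
    refine contDiff_two_of_pd _ (hD 14) fun i => ?_
    fin_cases i
    · exact d14_0 ▸ hC1 3
    · exact d14_1 ▸ hC1 11
    · exact d14_2 ▸ hC1 12
    · exact d14_3 ▸ hC1 13
  have s14_1 : ∀ x, pd 1 (G 11) x = Z x 37 := fun x =>
    (h1 x 11).trans (e_dot_s3 38 37 rfl (Z x))
  have s14_2 : ∀ x, pd 2 (G 12) x = Z x 38 := fun x =>
    (h2 x 12).trans (e_dot_s3 39 38 rfl (Z x))
  have s14_3 : ∀ x, pd 3 (G 13) x = Z x 39 := fun x =>
    (h3 x 13).trans (e_dot_s3 40 39 rfl (Z x))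
  have f3 : ∀ x, G 3 x = -(α₄ μ τ ⬝ᵥ Z x) + F₃ x := fun x => by
    change (-α₄ μ τ) ⬝ᵥ Z x + F₃ x = _
    rw [neg_dotProduct]
  have p1 : ∀ x, pd 1 (G 15) x = Z x 12 := fun x =>
    (h1 x 15).trans (e_dot_s3 13 12 rfl (Z x))
  have p2 : ∀ x, pd 2 (G 15) x = Z x 13 := fun x =>
    (h2 x 15).trans (e_dot_s3 14 13 rfl (Z x))
  have p3 : ∀ x, pd 3 (G 15) x = Z x 14 := fun x =>
    (h3 x 15).trans (e_dot_s3 15 14 rfl (Z x))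
  have key : ContDiff ℝ 2 (G 6) ∧ ContDiff ℝ 2 (G 10) ∧ ContDiff ℝ 2 (G 14) ∧
      ContDiff ℝ 1 (G 15) ∧ NS μ τ (G 6) (G 10) (G 14) (G 15) F₁ F₂ F₃ := by
    refine ⟨c6, c10, c14, hC1 15, fun x => ?_, fun x => ?_, fun x => ?_, fun x => ?_⟩
    · rw [d6_1, d10_2, d14_3, g0, g8, g13]
      ring
    · obtain ⟨q1, q2, q3, q4, q5, q6, q7, q8, q9⟩ := hQ x
      rw [d6_0, d6_1, d6_2, d6_3, s6_1, s6_2, s6_3, p1, f1, a2,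
        g6, g10, g14, g0, g4, g5]
      linear_combination -q1 - q2 - q3
    · obtain ⟨q1, q2, q3, q4, q5, q6, q7, q8, q9⟩ := hQ x
      rw [d10_0, d10_1, d10_2, d10_3, s10_1, s10_2, s10_3, p2, f2, a3,
        g6, g10, g14, g7, g8, g9]
      linear_combination -q4 - q5 - q6
    · obtain ⟨q1, q2, q3, q4, q5, q6, q7, q8, q9⟩ := hQ x
      rw [d14_0, d14_1, d14_2, d14_3, s14_1, s14_2, s14_3, p3, f3, a4,
        g6, g10, g14, g11, g12, g13]
      linear_combination -q7 - q8 - q9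
  rw [g6, g10, g14, g15] at key
  exact key
end

section
/- Let K₁ ⊂ ℝ³ be compact with boundary of Lebesgue measure zero, let T > 0, μ > 0, 0 < α < 1 and C > 0, and set K₁′ = [0,T] × K₁. Let h₁ : [0,T] × ℝ³ → ℝ⁹ vanish outside K₁′, be continuous on K₁′, and satisfy the Hölder condition |h₁(z) − h₁(z′)| ≤ C·|z − z′|^α for all z, z′ ∈ K₁′ (with |·| the maximum over the nine components, respectively the Euclidean norm on ℝ⁴). Then there exists h₂ : [0,T] × ℝ³ → ℝ⁹ vanishing outside K₁′ such that each component of h₂ is continuously differentiable in t on [0,T], infinitely differentiable in the spatial variables (x₁,x₂,x₃) on the interior of K₁, and μ·Σ_{j=1}^3 Σ_{k=1}^3 ∂⁴h₂/(∂x_j² ∂x_k²) − Σ_{j=1}^3 ∂³h₂/(∂t ∂x_j²) = h₁ almost everywhere on K₁′. -/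
open MeasureTheory

/-- Points of `ℝ³`. -/
abbrev V3 := Fin 3 → ℝ

/-- Points `(t, x)` of `ℝ × ℝ³`. -/
abbrev Pt := ℝ × V3

/-- The Euclidean norm on `ℝ³`. -/
noncomputable def norm3 (x : V3) : ℝ := Real.sqrt (∑ i, (x i) ^ 2)

/-- The Euclidean distance on `ℝ⁴ = ℝ × ℝ³` between `(t, x)` and `(t', x')`. -/
noncomputable def dist4 (p q : Pt) : ℝ :=
  Real.sqrt ((p.1 - q.1) ^ 2 + ∑ i, (p.2 i - q.2 i) ^ 2)

/-- Partial derivative in the time direction `t`. -/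
noncomputable def pdt (f : Pt → ℝ) (p : Pt) : ℝ := lineDeriv ℝ f p ((1 : ℝ), (0 : V3))

/-- Partial derivative in the spatial direction `x_i`. -/
noncomputable def pdx (i : Fin 3) (f : Pt → ℝ) (p : Pt) : ℝ :=
  lineDeriv ℝ f p ((0 : ℝ), Pi.single i 1)

/-- Partial derivative on `ℝ³` in the direction `x_i`. -/
noncomputable def pdx3 (i : Fin 3) (f : V3 → ℝ) (x : V3) : ℝ :=
  lineDeriv ℝ f x (Pi.single i 1)

/-- The Newtonian potential
`N(h)(x₀) = −(1/(4π)) ∫_{K₁} h(x)/|x − x₀| dx`. -/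
noncomputable def NPot (K₁ : Set V3) (h : V3 → ℝ) (x₀ : V3) : ℝ :=
  -(1 / (4 * Real.pi)) * ∫ x in K₁, h x / norm3 (x - x₀)

/-- `M(K₁) = sup_{x₀ ∈ K₁} (1/(4π)) ∫_{K₁} 1/|x − x₀| dx` (as an extended real). -/
noncomputable def MKe (K₁ : Set V3) : ENNReal :=
  ⨆ x₀ ∈ K₁, ENNReal.ofReal (1 / (4 * Real.pi)) *
    ∫⁻ x in K₁, ENNReal.ofReal (1 / norm3 (x - x₀))

/-- The heat potential
`P(v)(t,x) = (2√(πμ))⁻³ ∫₀ᵗ ∫_{ℝ³} v(τ,y) (t−τ)^{−3/2} exp(−|x−y|²/(4μ(t−τ))) dy dτ`. -/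
noncomputable def HPot (μ : ℝ) (v : Pt → ℝ) (t : ℝ) (x : V3) : ℝ :=
  (1 / (2 * Real.sqrt (Real.pi * μ))) ^ 3 *
    ∫ s in Set.Ioc (0 : ℝ) t, ∫ y : V3,
      v (s, y) * (t - s) ^ (-(3 : ℝ) / 2) *
        Real.exp (-(∑ i, (x i - y i) ^ 2) / (4 * μ * (t - s)))

/-- The `m`-th component of `h₂`:  `h₂ = P(v)` where `v(t,·) = N(h₁(t,·))` componentwise. -/
noncomputable def NH (μ : ℝ) (K₁ : Set V3) (h₁ : Pt → Fin 9 → ℝ) (m : Fin 9) : Pt → ℝ :=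
  fun p => HPot μ (fun q => NPot K₁ (fun y => h₁ (q.1, y) m) q.2) p.1 p.2


/-- Smooth compactly supported functions on space-time. -/
def Tst (F : Pt → ℝ) : Prop := ContDiff ℝ (⊤ : ℕ∞) F ∧ HasCompactSupport F

lemma lineDeriv_smooth {F : Pt → ℝ} (hF : ContDiff ℝ (⊤ : ℕ∞) F) (v : Pt) :
    (fun p => lineDeriv ℝ F p v) = fun p => fderiv ℝ F p v := by
  funext p
  exact (hF.differentiable (by simp)).differentiableAt.lineDeriv_eq_fderiv

lemma Tst.lineDeriv' {F : Pt → ℝ} (hF : Tst F) (v : Pt) :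
    Tst (fun p => lineDeriv ℝ F p v) := by
  rw [lineDeriv_smooth hF.1]
  refine ⟨?_, ?_⟩
  · exact (hF.1.fderiv_right (m := (⊤ : ℕ∞)) (by simp)).clm_apply contDiff_const
  · exact hF.2.fderiv_apply ℝ v

lemma Tst.pdx {F : Pt → ℝ} (hF : Tst F) (j : Fin 3) : Tst (pdx j F) := hF.lineDeriv' _
lemma Tst.pdt {F : Pt → ℝ} (hF : Tst F) : Tst (pdt F) := hF.lineDeriv' _

lemma Tst.add {F G : Pt → ℝ} (hF : Tst F) (hG : Tst G) : Tst (fun p => F p + G p) :=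
  ⟨hF.1.add hG.1, hF.2.add hG.2⟩

lemma Tst.smul {F G : Pt → ℝ} (hG : ContDiff ℝ (⊤ : ℕ∞) G) (hF : Tst F) :
    Tst (fun p => G p * F p) :=
  ⟨hG.mul hF.1, hF.2.mul_left⟩

lemma Tst.sub {F G : Pt → ℝ} (hF : Tst F) (hG : Tst G) : Tst (fun p => F p - G p) := by
  have := hF.add (Tst.smul (G := fun _ => (-1 : ℝ)) contDiff_const hG)
  simpa [sub_eq_add_neg] using this

lemma Tst.zero : Tst (fun _ => (0 : ℝ)) :=
  ⟨contDiff_const, HasCompactSupport.zero⟩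

lemma Tst.sum {F : Fin 3 → Pt → ℝ} (hF : ∀ j, Tst (F j)) : Tst (fun p => ∑ j, F j p) := by
  have := ((hF 0).add (hF 1)).add (hF 2)
  simpa [Fin.sum_univ_three] using this

lemma Tst.bdd {F : Pt → ℝ} (hF : Tst F) : ∃ W, 0 ≤ W ∧ ∀ p, |F p| ≤ W := by
  obtain ⟨W, hW⟩ := hF.2.exists_bound_of_continuous hF.1.continuous
  exact ⟨W, (norm_nonneg _).trans (hW 0), hW⟩

lemma Tst.hasDerivAt_t {F : Pt → ℝ} (hF : ContDiff ℝ (⊤ : ℕ∞) F) (t : ℝ) (x : V3) :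
    HasDerivAt (fun s => F (s, x)) (_root_.pdt F (t, x)) t := by
  have h := (hF.differentiable (by simp)).differentiableAt (x := (t, x))
  have h1 : HasDerivAt (fun s : ℝ => ((s, x) : Pt)) ((1 : ℝ), (0 : V3)) t :=
    (hasDerivAt_id t).prodMk (hasDerivAt_const t x)
  have := h.hasFDerivAt.comp_hasDerivAt t h1
  rw [_root_.pdt, h.lineDeriv_eq_fderiv]
  exact this

/-- The constant coefficient operator. -/
noncomputable def Lop (μ : ℝ) (F : Pt → ℝ) (p : Pt) : ℝ :=
  μ * ∑ j : Fin 3, ∑ k : Fin 3, pdx j (pdx j (pdx k (pdx k F))) p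
          - ∑ j : Fin 3, pdt (pdx j (pdx j F)) p

lemma Tst.Lop {F : Pt → ℝ} (hF : Tst F) (μ : ℝ) : Tst (Lop μ F) := by
  have h1 := Tst.sum (fun j => Tst.sum (fun k => (((hF.pdx k).pdx k).pdx j).pdx j))
  have h2 := Tst.sum (fun j => ((hF.pdx j).pdx j).pdt)
  exact (Tst.smul (G := fun _ => μ) contDiff_const h1).sub h2

lemma pdx_mul {F G : Pt → ℝ} (hF : ContDiff ℝ (⊤ : ℕ∞) F) (hG : ContDiff ℝ (⊤ : ℕ∞) G)
    (j : Fin 3) : pdx j (fun p => F p * G p) = fun p => pdx j F p * G p + F p * pdx j G p := by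
  funext p
  have hf := (hF.differentiable (by simp)).differentiableAt (x := p)
  have hg := (hG.differentiable (by simp)).differentiableAt (x := p)
  simp only [pdx]
  rw [hf.lineDeriv_eq_fderiv, hg.lineDeriv_eq_fderiv, (hf.fun_mul hg).lineDeriv_eq_fderiv,
    fderiv_fun_mul hf hg]
  simp
  ring

lemma pdt_mul {F G : Pt → ℝ} (hF : ContDiff ℝ (⊤ : ℕ∞) F) (hG : ContDiff ℝ (⊤ : ℕ∞) G) :
    pdt (fun p => F p * G p) = fun p => pdt F p * G p + F p * pdt G p := by
  funext p
  have hf := (hF.differentiable (by simp)).differentiableAt (x := p)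
  have hg := (hG.differentiable (by simp)).differentiableAt (x := p)
  simp only [pdt]
  rw [hf.lineDeriv_eq_fderiv, hg.lineDeriv_eq_fderiv, (hf.fun_mul hg).lineDeriv_eq_fderiv,
    fderiv_fun_mul hf hg]
  simp
  ring

lemma pdx_add {F G : Pt → ℝ} (hF : ContDiff ℝ (⊤ : ℕ∞) F) (hG : ContDiff ℝ (⊤ : ℕ∞) G)
    (j : Fin 3) : pdx j (fun p => F p + G p) = fun p => pdx j F p + pdx j G p := by
  funext p
  have hf := (hF.differentiable (by simp)).differentiableAt (x := p)
  have hg := (hG.differentiable (by simp)).differentiableAt (x := p)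
  simp only [pdx]
  rw [hf.lineDeriv_eq_fderiv, hg.lineDeriv_eq_fderiv, (hf.fun_add hg).lineDeriv_eq_fderiv,
    fderiv_fun_add hf hg]
  simp

lemma pdx_time (a : ℝ → ℝ) (j : Fin 3) : pdx j (fun p => a p.1) = fun _ => 0 := by
  funext p
  simp [pdx, lineDeriv]

lemma pdt_time {a : ℝ → ℝ} : pdt (fun p => a p.1) = fun p => deriv a p.1 := by
  funext p
  simp only [pdt, lineDeriv]
  simp only [Prod.fst_add, Prod.smul_fst, smul_eq_mul, mul_one]
  rw [deriv_comp_const_add]; simp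

lemma pdx_space (a : ℝ → ℝ) (j : Fin 3) :
    pdx j (fun p => a (p.2 0)) = fun p => if j = 0 then deriv a (p.2 0) else 0 := by
  funext p
  simp only [pdx, lineDeriv]
  split_ifs with h
  · subst h
    simp only [Prod.snd_add, Prod.smul_snd, Pi.add_apply, Pi.smul_apply, Pi.single_eq_same,
      smul_eq_mul, mul_one]
    rw [deriv_comp_const_add]; simp
  · have : (Pi.single j (1 : ℝ) : V3) 0 = 0 := by
      rw [Pi.single_eq_of_ne]; exact fun h' => h h'.symm
    simp [this]

/-- The periodic profile. -/
lemma exists_profile (δ : ℝ) (hδ : 0 < δ) (hδ2 : δ ≤ 1 / 2) :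
    ∃ (M : ℝ) (P : ℝ → ℝ), 1 ≤ M ∧ ContDiff ℝ (⊤ : ℕ∞) P ∧ (∀ s, |P s| ≤ M) ∧
      (∀ s, |deriv P s| ≤ M) ∧ (∀ s, |deriv (deriv P) s| ≤ M) ∧
      (∀ s : ℝ, δ ≤ |s - round s| → deriv (deriv P) s = 1) := by
  -- periodic primitives
  have prim : ∀ f : ℝ → ℝ, ContDiff ℝ (⊤ : ℕ∞) f → Function.Periodic f 1 →
      ∫ s in (0 : ℝ)..1, f s = 0 → ∃ g : ℝ → ℝ, ContDiff ℝ (⊤ : ℕ∞) g ∧ Function.Periodic g 1 ∧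
        (∫ s in (0 : ℝ)..1, g s = 0) ∧ deriv g = f := by
    intro f hf hp h0
    have hd : ∀ s, HasDerivAt (fun s => ∫ r in (0 : ℝ)..s, f r) (f s) s := fun s =>
      intervalIntegral.integral_hasDerivAt_right (hf.continuous.intervalIntegrable _ _)
        (hf.continuous.stronglyMeasurableAtFilter _ _) hf.continuous.continuousAt
    set c := ∫ s in (0 : ℝ)..1, (∫ r in (0 : ℝ)..s, f r) with hc
    have hd' : ∀ s, HasDerivAt (fun s => (∫ r in (0 : ℝ)..s, f r) - c) (f s) s := fun s =>
      (hd s).sub_const c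
    have hcont : Continuous (fun s => ∫ r in (0 : ℝ)..s, f r) :=
      continuous_iff_continuousAt.2 fun s => (hd s).continuousAt
    have hder : deriv (fun s => (∫ r in (0 : ℝ)..s, f r) - c) = f := funext fun s => (hd' s).deriv
    refine ⟨fun s => (∫ r in (0 : ℝ)..s, f r) - c, ?_, ?_, ?_, hder⟩
    · rw [contDiff_infty_iff_deriv]
      refine ⟨fun s => (hd' s).differentiableAt, ?_⟩
      rw [hder]; exact hf
    · intro s
      have h1 := hp.intervalIntegral_add_eq s 0
      have h2 := intervalIntegral.integral_add_adjacent_intervals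
        (hf.continuous.intervalIntegrable (μ := volume) 0 s)
        (hf.continuous.intervalIntegrable (μ := volume) s (s + 1))
      simp only [zero_add, h0] at h1
      simp only [← h2, h1, add_zero]
    · rw [intervalIntegral.integral_sub (hcont.intervalIntegrable _ _) (by simp)]
      simp [← hc]
  set b : ℝ → ℝ := fun s => Real.smoothTransition (Real.cos (2 * Real.pi * s)
    - Real.cos (2 * Real.pi * δ)) with hb
  have hbs : ContDiff ℝ (⊤ : ℕ∞) b := by
    apply Real.smoothTransition.contDiff.comp
    fun_prop
  have hbp : Function.Periodic b 1 := by
    intro s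
    simp only [hb, mul_add, mul_one, Real.cos_add_two_pi]
  have hbpos : 0 < ∫ s in (0 : ℝ)..1, b s := by
    apply intervalIntegral.integral_pos (by norm_num) hbs.continuous.continuousOn
    · intro s _
      exact Real.smoothTransition.nonneg _
    · refine ⟨0, by simp, ?_⟩
      apply Real.smoothTransition.pos_of_pos
      have : Real.cos (2 * Real.pi * δ) < Real.cos (2 * Real.pi * 0) := by
        apply Real.cos_lt_cos_of_nonneg_of_le_pi
        · simp
        · nlinarith [Real.pi_pos]
        · nlinarith [Real.pi_pos]
      linarith
  set B := ∫ s in (0 : ℝ)..1, b s with hB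
  have hψs : ContDiff ℝ (⊤ : ℕ∞) (fun s => 1 - b s / B) :=
    contDiff_const.sub (hbs.div_const _)
  have hψp : Function.Periodic (fun s => 1 - b s / B) 1 := by
    intro s
    simp only [hbp s]
  obtain ⟨g, hg, hgp, hg0, hgd⟩ := prim (fun s => 1 - b s / B) hψs hψp (by
    rw [intervalIntegral.integral_sub (by simp)
      ((hbs.continuous.div_const _).intervalIntegrable _ _), intervalIntegral.integral_div, ← hB]
    simp [hbpos.ne'])
  obtain ⟨P, hP, hPp, -, hPd⟩ := prim g hg hgp hg0
  have bd : ∀ f : ℝ → ℝ, Continuous f → Function.Periodic f 1 → ∃ W, ∀ s, |f s| ≤ W := by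
    intro f hf hp
    obtain ⟨W, hW⟩ := (hp.isBounded_of_continuous one_ne_zero hf).exists_norm_le
    exact ⟨W, fun s => hW _ ⟨s, rfl⟩⟩
  obtain ⟨W0, hW0⟩ := bd P hP.continuous hPp
  obtain ⟨W1, hW1⟩ := bd g hg.continuous hgp
  obtain ⟨W2, hW2⟩ := bd _ hψs.continuous hψp
  refine ⟨max 1 (max W0 (max W1 W2)), P, le_max_left _ _, hP, fun s => (hW0 s).trans (by simp),
    fun s => ?_, fun s => ?_, fun s hs => ?_⟩
  · rw [hPd]; exact (hW1 s).trans (by simp)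
  · rw [hPd, hgd]; exact (hW2 s).trans (by simp)
  · rw [hPd, hgd]
    have : b s = 0 := by
      apply Real.smoothTransition.zero_of_nonpos
      have h1 : Real.cos (2 * Real.pi * s) = Real.cos (2 * Real.pi * |s - round s|) := by
        have h2 : Real.cos (2 * Real.pi * |s - round s|) = Real.cos (2 * Real.pi * (s - round s)) := by
          rcases abs_choice (s - round s) with h | h <;> rw [h]
          rw [mul_neg, Real.cos_neg]
        rw [h2, show 2 * Real.pi * (s - round s) = 2 * Real.pi * s - (round s : ℤ) * (2 * Real.pi) by
          ring, Real.cos_sub_int_mul_two_pi]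
      have h3 : Real.cos (2 * Real.pi * |s - round s|) ≤ Real.cos (2 * Real.pi * δ) := by
        apply Real.cos_le_cos_of_nonneg_of_le_pi
        · positivity
        · nlinarith [Real.pi_pos, abs_sub_round s]
        · nlinarith [Real.pi_pos]
      linarith
    simp [this]

/-- Measure of the bad set of the rescaled profile. -/
lemma volume_bad (δ R ε : ℝ) (hδ : 0 < δ) (hR : 0 < R) (hε : 0 < ε) (hε1 : ε ≤ 1) :
    volume ({s : ℝ | |s / ε - round (s / ε)| < δ} ∩ Set.Icc (-R) R)
      ≤ ENNReal.ofReal ((4 * R + 6) * δ) := by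
  set N : ℤ := ⌈R / ε⌉ with hN
  have hsub : {s : ℝ | |s / ε - round (s / ε)| < δ} ∩ Set.Icc (-R) R ⊆
      ⋃ k ∈ Finset.Icc (-N) N, Set.Icc (k * ε - δ * ε) (k * ε + δ * ε) := by
    rintro s ⟨hs, hs1, hs2⟩
    simp only [Set.mem_iUnion, Finset.mem_Icc]
    have hRN : R / ε ≤ N := Int.le_ceil _
    have h1 : s / ε ≤ R / ε := by gcongr
    have h2 : -(R / ε) ≤ s / ε := by rw [← neg_div]; gcongr
    refine ⟨round (s / ε), ⟨?_, ?_⟩, ?_⟩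
    · rw [round_eq]
      apply Int.le_floor.2
      push_cast; linarith
    · rw [round_eq, ← Int.lt_add_one_iff]
      apply Int.floor_lt.2
      push_cast; linarith
    · rw [Set.mem_ofPred_eq, abs_lt] at hs
      have h3 : s = (s / ε) * ε := by field_simp
      constructor <;> nlinarith
  refine (measure_mono hsub).trans ((measure_biUnion_finset_le _ _).trans ?_)
  have hlen : ∀ k : ℤ, (k : ℝ) * ε + δ * ε - (k * ε - δ * ε) = 2 * δ * ε := fun k => by ring
  simp only [Real.volume_Icc, hlen, Finset.sum_const, Int.card_Icc, nsmul_eq_mul]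
  have hN0 : 0 ≤ N := by positivity
  have hcard : (((N + 1 - -N).toNat : ℕ) : ENNReal) = ENNReal.ofReal (2 * N + 1) := by
    rw [← ENNReal.ofReal_natCast]
    congr 1
    have : (((N + 1 - -N).toNat : ℤ) : ℝ) = ((N + 1 - -N : ℤ) : ℝ) := by
      rw [Int.toNat_of_nonneg (by omega)]
    push_cast at this
    rw [this]; ring
  rw [hcard, ← ENNReal.ofReal_mul (by positivity)]
  apply ENNReal.ofReal_le_ofReal
  have hNle : (N : ℝ) < R / ε + 1 := Int.ceil_lt_add_one _
  have : (N : ℝ) * ε ≤ R + ε := by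
    have := mul_le_mul_of_nonneg_right hNle.le hε.le
    rw [add_mul, div_mul_cancel₀ _ hε.ne'] at this
    linarith
  nlinarith


lemma exists_approx (K : Set Pt) (hK : IsCompact K) (h : Pt → ℝ) (hc : ContinuousOn h K)
    (τ : ℝ) (hτ : 0 < τ) : ∃ f, Tst f ∧ ∀ p ∈ K, |f p - h p| ≤ τ := by
  obtain ⟨g, hg⟩ := ContinuousMap.exists_restrict_eq hK.isClosed
    (⟨K.domRestrict h, hc.domRestrict⟩ : C(K, ℝ))
  have hgK : ∀ p ∈ K, g p = h p := fun p hp => by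
    exact congrArg (fun F : C(K, ℝ) => F ⟨p, hp⟩) hg
  obtain ⟨r, hr⟩ := hK.isBounded.subset_closedBall (0 : Pt)
  let χ : ContDiffBump (0 : Pt) := ⟨max r 1, max r 1 + 1, by positivity, by simp⟩
  have hcont : Continuous (fun p => χ p * g p) := χ.continuous.mul g.continuous
  obtain ⟨f, hf, hfd, hfs⟩ := hcont.exists_contDiff_approx (⊤ : ℕ∞)
    (continuous_const (y := τ)) (fun _ => hτ)
  refine ⟨f, ⟨hf, ?_⟩, fun p hp => ?_⟩
  · have h1 : HasCompactSupport (fun p => χ p * g p) := χ.hasCompactSupport.mul_right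
    exact h1.mono hfs
  · have h1 : χ p = 1 := χ.one_of_mem_closedBall
      (Metric.closedBall_subset_closedBall (le_max_left _ _) (hr hp))
    have h2 := (hfd p).le
    rw [h1, one_mul, hgK p hp] at h2
    exact h2

lemma slice_bound {w : Pt → ℝ} (hw : Tst w) (N : ℕ) : ∃ W, 0 ≤ W ∧ ∀ k ≤ N, ∀ (t : ℝ) (x : V3),
    ‖iteratedFDeriv ℝ k (fun y => w (t, y)) x‖ ≤ W := by
  have key : ∀ k : ℕ, ∃ W, 0 ≤ W ∧ ∀ (t : ℝ) (x : V3),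
      ‖iteratedFDeriv ℝ k (fun y => w (t, y)) x‖ ≤ W := by
    intro k
    obtain ⟨W, hW⟩ := (hw.2.iteratedFDeriv (𝕜 := ℝ) k).exists_bound_of_continuous
      (hw.1.continuous_iteratedFDeriv (m := k) (by exact_mod_cast le_top))
    have hW0 : 0 ≤ W := (norm_nonneg _).trans (hW 0)
    set A : V3 →L[ℝ] Pt := ContinuousLinearMap.inr ℝ ℝ V3 with hA
    refine ⟨W * ‖A‖ ^ k, by positivity, fun t x => ?_⟩
    have h1 : (fun y => w (t, y)) = (fun q => w ((t, 0) + q)) ∘ A := by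
      funext y
      simp [hA]
    have h2 : ContDiff ℝ (⊤ : ℕ∞) (fun q => w ((t, 0) + q)) :=
      hw.1.comp (contDiff_const.add contDiff_id)
    rw [h1, A.iteratedFDeriv_comp_right h2 x (i := k) (by exact_mod_cast le_top),
      iteratedFDeriv_comp_add_left]
    refine (ContinuousMultilinearMap.norm_compContinuousLinearMap_le _ _).trans ?_
    simp only [Finset.prod_const, Finset.card_univ, Fintype.card_fin]
    gcongr
    exact hW _
  choose W hW0 hW using key
  refine ⟨∑ k ∈ Finset.range (N + 1), W k, Finset.sum_nonneg fun k _ => hW0 k,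
    fun k hk t x => (hW k t x).trans ?_⟩
  exact Finset.single_le_sum (f := W) (fun k _ => hW0 k) (Finset.mem_range.2 (by omega))

lemma exists_small (W τ : ℝ) (hW : 0 ≤ W) (hτ : 0 < τ) : ∃ ε, 0 < ε ∧ ε ≤ 1 ∧ ε * W ≤ τ := by
  refine ⟨min 1 (τ / (W + 1)), by positivity, min_le_left _ _, ?_⟩
  calc min 1 (τ / (W + 1)) * W ≤ τ / (W + 1) * (W + 1) := by
        gcongr
        · exact min_le_right _ _
        · linarith
    _ = τ := by field_simp

lemma scaled {M : ℝ} {P : ℝ → ℝ} (hP : ContDiff ℝ (⊤ : ℕ∞) P) (h0 : ∀ s, |P s| ≤ M)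
    (h1 : ∀ s, |deriv P s| ≤ M) {ε : ℝ} (hε : 0 < ε) (hε1 : ε ≤ 1) :
    ∃ p : ℝ → ℝ, ContDiff ℝ (⊤ : ℕ∞) p ∧ (∀ s, |p s| ≤ ε * M) ∧ (∀ s, |deriv p s| ≤ ε * M) ∧
      ∀ s, deriv (deriv p) s = deriv (deriv P) (s / ε) := by
  have hP' : ContDiff ℝ (⊤ : ℕ∞) (deriv P) := (contDiff_infty_iff_deriv.1 hP).2
  have d1 : ∀ s, HasDerivAt (fun s => ε ^ 2 * P (s / ε)) (ε * deriv P (s / ε)) s := by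
    intro s
    have := ((hP.differentiable (by simp)).differentiableAt (x := s / ε)).hasDerivAt.comp s
      ((hasDerivAt_id s).div_const ε)
    refine (this.const_mul (ε ^ 2)).congr_deriv ?_
    field_simp
  have d2 : ∀ s, HasDerivAt (fun s => ε * deriv P (s / ε)) (deriv (deriv P) (s / ε)) s := by
    intro s
    have := ((hP'.differentiable (by simp)).differentiableAt (x := s / ε)).hasDerivAt.comp s
      ((hasDerivAt_id s).div_const ε)
    refine (this.const_mul ε).congr_deriv ?_
    field_simp
  have e1 : deriv (fun s => ε ^ 2 * P (s / ε)) = fun s => ε * deriv P (s / ε) :=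
    funext fun s => (d1 s).deriv
  refine ⟨fun s => ε ^ 2 * P (s / ε), ?_, fun s => ?_, fun s => ?_, fun s => ?_⟩
  · exact contDiff_const.mul (hP.comp (contDiff_id.div_const ε))
  · rw [abs_mul, abs_of_pos (by positivity)]
    have hM : 0 ≤ M := (abs_nonneg _).trans (h0 0)
    calc ε ^ 2 * |P (s / ε)| ≤ ε ^ 2 * M := by gcongr; exact h0 _
      _ ≤ ε * M := by gcongr; nlinarith
  · rw [e1, abs_mul, abs_of_pos hε]
    gcongr; exact h1 _
  · rw [e1]; exact (d2 s).deriv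

lemma pdx_time_mul {F : Pt → ℝ} (hF : ContDiff ℝ (⊤ : ℕ∞) F) {b : ℝ → ℝ}
    (hb : ContDiff ℝ (⊤ : ℕ∞) b) (j : Fin 3) :
    pdx j (fun q => b q.1 * F q) = fun q => b q.1 * pdx j F q := by
  rw [pdx_mul (F := fun q => b q.1) (hb.comp contDiff_fst) hF, pdx_time]
  simp

lemma pdt_time_mul {F : Pt → ℝ} (hF : ContDiff ℝ (⊤ : ℕ∞) F) {b : ℝ → ℝ}
    (hb : ContDiff ℝ (⊤ : ℕ∞) b) :
    pdt (fun q => b q.1 * F q) = fun q => deriv b q.1 * F q + b q.1 * pdt F q := by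
  rw [pdt_mul (F := fun q => b q.1) (hb.comp contDiff_fst) hF, pdt_time]

lemma contDiff_space {p : ℝ → ℝ} (hp : ContDiff ℝ (⊤ : ℕ∞) p) :
    ContDiff ℝ (⊤ : ℕ∞) (fun q : Pt => p (q.2 0)) :=
  hp.comp (contDiff_apply_apply_snd)
where
  contDiff_apply_apply_snd : ContDiff ℝ (⊤ : ℕ∞) (fun q : Pt => q.2 0) :=
    (contDiff_apply ℝ ℝ (0 : Fin 3)).comp contDiff_snd

lemma Q_space_mul {S : Pt → ℝ} (hS : Tst S) {p : ℝ → ℝ} (hp : ContDiff ℝ (⊤ : ℕ∞) p)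
    (j : Fin 3) : pdx j (pdx j (fun q => p (q.2 0) * S q)) = fun q =>
      (if j = 0 then deriv (deriv p) (q.2 0) * S q + 2 * (deriv p (q.2 0) * pdx 0 S q) else 0)
        + p (q.2 0) * pdx j (pdx j S) q := by
  have hp' : ContDiff ℝ (⊤ : ℕ∞) (deriv p) := (contDiff_infty_iff_deriv.1 hp).2
  have e := pdx_mul (contDiff_space hp) hS.1 j
  rw [e, pdx_space]
  by_cases hj : j = 0
  · subst hj
    simp only [if_true]
    rw [pdx_add ((contDiff_space hp').mul hS.1) ((contDiff_space hp).mul (hS.pdx 0).1),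
      pdx_mul (contDiff_space hp') hS.1, pdx_mul (contDiff_space hp) (hS.pdx 0).1,
      pdx_space, pdx_space]
    funext q
    simp only [if_true]
    ring
  · simp only [hj, if_false, zero_mul, zero_add]
    rw [pdx_mul (contDiff_space hp) (hS.pdx j).1, pdx_space]
    simp [hj]

lemma Tst.bdd2 {F : Fin 3 → Fin 3 → Pt → ℝ} (hF : ∀ j k, Tst (F j k)) :
    ∃ W, 0 ≤ W ∧ ∀ j k p, |F j k p| ≤ W := by
  choose W hW0 hW using fun j k => (hF j k).bdd
  refine ⟨∑ j, ∑ k, W j k, Finset.sum_nonneg fun j _ => Finset.sum_nonneg fun k _ => hW0 j k,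
    fun j k p => (hW j k p).trans ?_⟩
  calc W j k ≤ ∑ k, W j k := Finset.single_le_sum (f := fun k => W j k)
        (fun k _ => hW0 j k) (Finset.mem_univ k)
    _ ≤ ∑ j, ∑ k, W j k := Finset.single_le_sum (f := fun j => ∑ k, W j k)
        (fun j _ => Finset.sum_nonneg fun k _ => hW0 j k) (Finset.mem_univ j)

/-- One correction step. -/
lemma step (μ : ℝ) (hμ : 0 < μ) (δ : ℝ) (hδ : 0 < δ) (hδ2 : δ ≤ 1 / 2) :
    ∃ M : ℝ, 1 ≤ M ∧ ∀ S, Tst S → ∀ τ : ℝ, 0 < τ → ∀ N : ℕ,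
      ∃ (u : Pt → ℝ) (ε η : ℝ), Tst u ∧ 0 < ε ∧ ε ≤ 1 ∧ 0 < η ∧ η ≤ 1 ∧
      (∀ k ≤ N, ∀ t x, ‖iteratedFDeriv ℝ k (fun y => u (t, y)) x‖ ≤ τ) ∧
      (∀ p, |u p| ≤ τ) ∧ (∀ p, |pdt u p| ≤ τ) ∧ (∀ j p, |pdx j u p| ≤ τ) ∧
      (∀ j p, |pdx j (pdx j u) p| ≤ τ) ∧ (∀ j k p, |pdx j (pdx k (pdx k u)) p| ≤ τ) ∧
      (∀ j k p, |pdx j (pdx j (pdx k (pdx k u))) p| ≤ τ) ∧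
      (∀ j p, |pdt (pdx j (pdx j u)) p| ≤ M * |S p| + τ) ∧
      (∀ p : Pt, δ ≤ |p.1 / η - round (p.1 / η)| → δ ≤ |p.2 0 / ε - round (p.2 0 / ε)| →
        |S p - Lop μ u p| ≤ τ) := by
  obtain ⟨M, P, hM, hP, hP0, hP1, hP2, hPg⟩ := exists_profile δ hδ hδ2
  refine ⟨M * M, by nlinarith, fun S hS τ hτ N => ?_⟩
  have hM0 : 0 < M := by linarith
  obtain ⟨σ, hσ, hσ1, hστ⟩ := exists_small (2 * M + 9 * μ + 6) τ (by positivity) hτ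
  have hs : ∃ s, 0 < s ∧ s * M ≤ τ / 2 ∧ s ≤ τ / 2 ∧ s * (9 * μ + 6) ≤ τ :=
    ⟨σ * (1 / 2), by positivity, by nlinarith, by nlinarith, by nlinarith⟩
  clear hσ hσ1 hστ σ
  obtain ⟨σ, hσ, hσM, hσ2, hσμ⟩ := hs
  -- the spatial oscillation
  obtain ⟨W, hW0, hW⟩ := hS.bdd
  obtain ⟨W1, hW10, hW1⟩ := (hS.pdx 0).bdd
  obtain ⟨W2, hW20, hW2⟩ := Tst.bdd2 (fun j (_ : Fin 3) => (hS.pdx j).pdx j)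
  obtain ⟨ε, hε, hε1, hεW⟩ := exists_small (M * (W + 2 * W1 + W2)) σ (by positivity) hσ
  obtain ⟨p, hp, hp0, hp1, hp2⟩ := scaled hP hP0 hP1 hε hε1
  set w : Pt → ℝ := fun q => p (q.2 0) * S q with hw
  have hwT : Tst w := Tst.smul (contDiff_space hp) hS
  have hwS : ∀ q, |w q| ≤ σ := by
    intro q
    rw [hw, abs_mul]
    calc |p (q.2 0)| * |S q| ≤ (ε * M) * W := mul_le_mul (hp0 _) (hW _) (abs_nonneg _) (by positivity)
      _ ≤ ε * (M * (W + 2 * W1 + W2)) := by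
        have : 0 ≤ ε * M * (2 * W1 + W2) := by positivity
        nlinarith
      _ ≤ σ := hεW
  have hQw : ∀ j q, |pdx j (pdx j w) q -
      (if j = 0 then deriv (deriv P) (q.2 0 / ε) * S q else 0)| ≤ σ := by
    intro j q
    rw [hw, Q_space_mul hS hp, ← hp2]
    have b1 : |p (q.2 0) * pdx j (pdx j S) q| ≤ (ε * M) * W2 := by
      rw [abs_mul]
      exact mul_le_mul (hp0 _) (hW2 j 0 _) (abs_nonneg _) (by positivity)
    have b2 : |deriv p (q.2 0) * pdx 0 S q| ≤ (ε * M) * W1 := by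
      rw [abs_mul]
      exact mul_le_mul (hp1 _) (hW1 _) (abs_nonneg _) (by positivity)
    have b3 : 0 ≤ ε * M * W := by positivity
    have b4 : 0 ≤ ε * M * W1 := by positivity
    rw [abs_le] at b1 b2 ⊢
    split_ifs with hj
    · constructor <;> nlinarith
    · constructor <;> nlinarith
  -- bounds for `w`
  obtain ⟨A0, hA00, hA0⟩ := slice_bound hwT N
  obtain ⟨A1, hA10, hA1⟩ := hwT.bdd
  obtain ⟨A2, hA20, hA2⟩ := hwT.pdt.bdd
  obtain ⟨A3, hA30, hA3⟩ := Tst.bdd2 (fun j (_ : Fin 3) => hwT.pdx j)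
  obtain ⟨A4, hA40, hA4⟩ := Tst.bdd2 (fun j (_ : Fin 3) => (hwT.pdx j).pdx j)
  obtain ⟨A5, hA50, hA5⟩ := Tst.bdd2 (fun j k : Fin 3 => ((hwT.pdx k).pdx k).pdx j)
  obtain ⟨A6, hA60, hA6⟩ := Tst.bdd2 (fun j k : Fin 3 => (((hwT.pdx k).pdx k).pdx j).pdx j)
  obtain ⟨A7, hA70, hA7⟩ := Tst.bdd2 (fun j (_ : Fin 3) => ((hwT.pdx j).pdx j).pdt)
  obtain ⟨η, hη, hη1, hηA⟩ := exists_small (M * (A0 + A1 + A2 + A3 + A4 + A5 + A6 + A7)) σ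
    (by positivity) hσ
  obtain ⟨a, ha, -, ha1, ha2⟩ := scaled hP hP0 hP1 hη hη1
  have ha' : ContDiff ℝ (⊤ : ℕ∞) (deriv a) := (contDiff_infty_iff_deriv.1 ha).2
  set b : ℝ → ℝ := fun s => - deriv a s with hb
  have hbs : ContDiff ℝ (⊤ : ℕ∞) b := ha'.neg
  have hb0 : ∀ s, |b s| ≤ η * M := fun s => by rw [hb, abs_neg]; exact ha1 s
  have hb1 : ∀ s, deriv b s = - deriv (deriv P) (s / η) := fun s => by
    rw [hb, deriv.fun_neg, ha2]
  have hb1' : ∀ s, |deriv b s| ≤ M := fun s => by rw [hb1, abs_neg]; exact hP2 _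
  have small : ∀ (s A c : ℝ), |c| ≤ A → A ≤ A0 + A1 + A2 + A3 + A4 + A5 + A6 + A7 →
      |b s * c| ≤ σ := by
    intro s A c hc hA
    rw [abs_mul]
    calc |b s| * |c| ≤ (η * M) * (A0 + A1 + A2 + A3 + A4 + A5 + A6 + A7) :=
          mul_le_mul (hb0 s) (hc.trans hA) (abs_nonneg _) (by positivity)
      _ ≤ σ := by rw [mul_assoc]; exact hηA
  have hστ : σ ≤ τ := by linarith
  set u : Pt → ℝ := fun q => b q.1 * w q with hu
  have ux : ∀ j, pdx j u = fun q => b q.1 * pdx j w q := fun j => pdx_time_mul hwT.1 hbs j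
  have uxx : ∀ j, pdx j (pdx j u) = fun q => b q.1 * pdx j (pdx j w) q := fun j => by
    rw [ux, pdx_time_mul (hwT.pdx j).1 hbs]
  have uxxx : ∀ j k, pdx j (pdx k (pdx k u)) = fun q => b q.1 * pdx j (pdx k (pdx k w)) q :=
    fun j k => by rw [uxx, pdx_time_mul ((hwT.pdx k).pdx k).1 hbs]
  have uxxxx : ∀ j k, pdx j (pdx j (pdx k (pdx k u))) =
      fun q => b q.1 * pdx j (pdx j (pdx k (pdx k w))) q :=
    fun j k => by rw [uxxx, pdx_time_mul (((hwT.pdx k).pdx k).pdx j).1 hbs]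
  have ut : pdt u = fun q => deriv b q.1 * w q + b q.1 * pdt w q := pdt_time_mul hwT.1 hbs
  have utxx : ∀ j, pdt (pdx j (pdx j u)) = fun q => deriv b q.1 * pdx j (pdx j w) q
      + b q.1 * pdt (pdx j (pdx j w)) q := fun j => by
    rw [uxx, pdt_time_mul ((hwT.pdx j).pdx j).1 hbs]
  refine ⟨u, ε, η, Tst.smul (hbs.comp contDiff_fst) hwT, hε, hε1, hη, hη1, ?_, ?_, ?_, ?_, ?_, ?_,
    ?_, ?_, ?_⟩
  · intro k hk t x
    have hc : ContDiffAt ℝ (k : WithTop ℕ∞) (fun y => w (t, y)) x := by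
      have : ContDiff ℝ (⊤ : ℕ∞) (fun y => w (t, y)) := hwT.1.comp (by fun_prop)
      exact (this.of_le (by exact_mod_cast le_top)).contDiffAt
    have e : (fun y => u (t, y)) = fun y => b t • w (t, y) := rfl
    rw [e, iteratedFDeriv_const_smul_apply' hc, norm_smul, Real.norm_eq_abs,
      ← abs_of_nonneg (norm_nonneg (iteratedFDeriv ℝ k (fun y => w (t, y)) x)), ← abs_mul]
    refine (small t A0 _ ?_ (by linarith)).trans hστ
    rw [abs_of_nonneg (norm_nonneg _)]
    exact hA0 k hk t x
  · exact fun q => (small _ A1 _ (hA1 q) (by linarith)).trans hστ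
  · intro q
    rw [ut]
    have h1 := small q.1 A2 _ (hA2 q) (by linarith)
    have h2 : |deriv b q.1 * w q| ≤ M * σ := by
      rw [abs_mul]; exact mul_le_mul (hb1' _) (hwS q) (abs_nonneg _) hM0.le
    refine (abs_add_le _ _).trans ?_
    linarith
  · intro j q
    rw [ux]; exact (small _ A3 _ (hA3 j 0 q) (by linarith)).trans hστ
  · intro j q
    rw [uxx]; exact (small _ A4 _ (hA4 j 0 q) (by linarith)).trans hστ
  · intro j k q
    rw [uxxx]; exact (small _ A5 _ (hA5 j k q) (by linarith)).trans hστ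
  · intro j k q
    rw [uxxxx]; exact (small _ A6 _ (hA6 j k q) (by linarith)).trans hστ
  · intro j q
    rw [utxx]
    have h1 := small q.1 A7 _ (hA7 j 0 q) (by linarith)
    have h3 : |pdx j (pdx j w) q| ≤ M * |S q| + σ := by
      have h4 := hQw j q
      have h5 : |(if j = 0 then deriv (deriv P) (q.2 0 / ε) * S q else 0)| ≤ M * |S q| := by
        split_ifs
        · rw [abs_mul]; gcongr; exact hP2 _
        · simp only [abs_zero]; positivity
      have := abs_sub_abs_le_abs_sub (pdx j (pdx j w) q)
        (if j = 0 then deriv (deriv P) (q.2 0 / ε) * S q else 0)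
      linarith
    have h2 : |deriv b q.1 * pdx j (pdx j w) q| ≤ M * (M * |S q| + σ) := by
      rw [abs_mul]; exact mul_le_mul (hb1' _) h3 (abs_nonneg _) hM0.le
    refine (abs_add_le _ _).trans ?_
    nlinarith
  · intro q hq1 hq2
    have e1 : deriv b q.1 = -1 := by rw [hb1, hPg _ hq1]
    have h0 := hQw 0 q
    have h1 := hQw 1 q
    have h2 := hQw 2 q
    rw [if_pos rfl, hPg _ hq2] at h0
    rw [if_neg (by decide)] at h1 h2
    have h3 : ∀ j k, |b q.1 * pdx j (pdx j (pdx k (pdx k w))) q| ≤ σ := fun j k =>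
      small _ A6 _ (hA6 j k q) (by linarith)
    have h4 : ∀ j, |b q.1 * pdt (pdx j (pdx j w)) q| ≤ σ := fun j =>
      small _ A7 _ (hA7 j 0 q) (by linarith)
    have h5 : |∑ j : Fin 3, ∑ k : Fin 3, b q.1 * pdx j (pdx j (pdx k (pdx k w))) q| ≤ 9 * σ := by
      refine (Finset.abs_sum_le_sum_abs _ _).trans ?_
      calc ∑ j : Fin 3, |∑ k : Fin 3, b q.1 * pdx j (pdx j (pdx k (pdx k w))) q|
          ≤ ∑ j : Fin 3, (3 * σ) := by
            refine Finset.sum_le_sum fun j _ => ?_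
            refine (Finset.abs_sum_le_sum_abs _ _).trans ?_
            refine (Finset.sum_le_sum fun k _ => h3 j k).trans ?_
            simp
        _ = 9 * σ := by simp; ring
    have h6 : |μ * ∑ j : Fin 3, ∑ k : Fin 3, b q.1 * pdx j (pdx j (pdx k (pdx k w))) q|
        ≤ μ * (9 * σ) := by
      rw [abs_mul, abs_of_pos hμ]; gcongr
    have h40 := h4 0
    have h41 := h4 1
    have h42 := h4 2
    simp only [Lop, uxxxx, utxx, e1]
    set X := μ * ∑ j : Fin 3, ∑ k : Fin 3, b q.1 * pdx j (pdx j (pdx k (pdx k w))) q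
    rw [Fin.sum_univ_three]
    have h7 : μ * (9 * σ) + 6 * σ ≤ τ := by linarith
    have k0 := abs_le.1 h0
    have k1 := abs_le.1 h1
    have k2 := abs_le.1 h2
    have k3 := abs_le.1 h40
    have k4 := abs_le.1 h41
    have k5 := abs_le.1 h42
    have k6 := abs_le.1 h6
    rw [abs_le]
    constructor
    · linarith [k0.1, k1.1, k2.1, k3.1, k4.1, k5.1, k6.2]
    · linarith [k0.2, k1.2, k2.2, k3.2, k4.2, k5.2, k6.1]


lemma mvt_t {F : Pt → ℝ} (hF : ContDiff ℝ (⊤ : ℕ∞) F) (x : V3) (t d B : ℝ)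
    (hB : ∀ s, |s - t| < d → |pdt F (s, x)| ≤ B) (s : ℝ) (hs : |s - t| < d) :
    |F (s, x) - F (t, x)| ≤ B * |s - t| := by
  have hd : 0 < d := (abs_nonneg _).trans_lt hs
  have := (convex_ball t d).norm_image_sub_le_of_norm_hasDerivWithin_le
    (f := fun s => F (s, x)) (f' := fun s => pdt F (s, x)) (C := B)
    (fun r _ => (Tst.hasDerivAt_t hF r x).hasDerivWithinAt)
    (fun r hr => hB r (by simpa [Real.dist_eq] using hr))
    (Metric.mem_ball_self hd) (by simpa [Real.dist_eq] using hs)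
  simpa using this

lemma exists_modulus {S : Pt → ℝ} (hS : Tst S) (σ : ℝ) (hσ : 0 < σ) :
    ∃ d, 0 < d ∧ ∀ (t s : ℝ) (x : V3), |s - t| < d → |S (s, x) - S (t, x)| ≤ σ := by
  obtain ⟨W, hW0, hW⟩ := hS.pdt.bdd
  obtain ⟨d, hd, -, hdW⟩ := exists_small W σ hW0 hσ
  refine ⟨d, hd, fun t s x hs => ?_⟩
  refine (mvt_t hS.1 x t d W (fun r _ => hW _) s hs).trans ?_
  nlinarith

/-- The data of the inductive construction. -/
structure CorrSeq (μ : ℝ) (Kp : Set Pt) (h : Pt → ℝ) (u S f : ℕ → Pt → ℝ)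
    (ε η d M σ : ℕ → ℝ) : Prop where
  tu : ∀ n, Tst (u n)
  tS : ∀ n, Tst (S n)
  hσ : ∀ n, 0 < σ n
  hσ2 : ∀ n, σ n ≤ (1 / 2) ^ n
  hM : ∀ n, 1 ≤ M n
  hMσ : ∀ n, M n * σ n ≤ (1 / 2) ^ n
  hε : ∀ n, 0 < ε n
  hε1 : ∀ n, ε n ≤ 1
  hη : ∀ n, 0 < η n
  hη1 : ∀ n, η n ≤ 1
  hd : ∀ n, 0 < d n
  hdS : ∀ n (t s : ℝ) (x : V3), |s - t| < d n → |S n (s, x) - S n (t, x)| ≤ σ n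
  hf : ∀ n, ∀ p ∈ Kp, |f n p - h p| ≤ σ n
  hf' : ∀ n, ∀ p ∈ Kp, |f n p - h p| ≤ σ (n + 1)
  sum : ∀ n p, ∑ k ∈ Finset.range n, Lop μ (u k) p = f n p - S n p
  biter : ∀ n, ∀ k ≤ n, ∀ t x, ‖iteratedFDeriv ℝ k (fun y => u n (t, y)) x‖ ≤ (1 / 2) ^ n
  b0 : ∀ n p, |u n p| ≤ (1 / 2) ^ n
  bt : ∀ n p, |pdt (u n) p| ≤ (1 / 2) ^ n
  bx : ∀ n j p, |pdx j (u n) p| ≤ (1 / 2) ^ n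
  bxx : ∀ n j p, |pdx j (pdx j (u n)) p| ≤ (1 / 2) ^ n
  bxx' : ∀ n j p, |pdx j (pdx j (u n)) p| ≤ d n * (1 / 2) ^ n
  bxxx : ∀ n j k p, |pdx j (pdx k (pdx k (u n))) p| ≤ (1 / 2) ^ n
  bxxxx : ∀ n j k p, |pdx j (pdx j (pdx k (pdx k (u n)))) p| ≤ (1 / 2) ^ n
  btxx : ∀ n j p, |pdt (pdx j (pdx j (u n))) p| ≤ M n * |S n p| + (1 / 2) ^ n
  good : ∀ n, ∀ p : Pt, (1 / 2) ^ (n + 1) ≤ |p.1 / η n - round (p.1 / η n)| →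
    (1 / 2) ^ (n + 1) ≤ |p.2 0 / ε n - round (p.2 0 / ε n)| →
    |S n p - Lop μ (u n) p| ≤ σ (n + 1)

lemma exists_corrSeq (μ : ℝ) (hμ : 0 < μ) (Kp : Set Pt) (hK : IsCompact Kp) (h : Pt → ℝ)
    (hc : ContinuousOn h Kp) : ∃ u S f ε η d M σ, CorrSeq μ Kp h u S f ε η d M σ := by
  have hδ : ∀ n : ℕ, (0 : ℝ) < (1 / 2) ^ (n + 1) := fun n => by positivity
  have hδ2 : ∀ n : ℕ, ((1 : ℝ) / 2) ^ (n + 1) ≤ 1 / 2 := fun n => by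
    rw [pow_succ]
    have : ((1 : ℝ) / 2) ^ n ≤ 1 := pow_le_one₀ (by norm_num) (by norm_num)
    linarith
  choose M hM hstep using fun n : ℕ => step μ hμ ((1 / 2) ^ (n + 1)) (hδ n) (hδ2 n)
  have hM0 : ∀ n, 0 < M n := fun n => by linarith [hM n]
  obtain ⟨σ, hσdef⟩ : ∃ σ : ℕ → ℝ, ∀ n, σ n = (1 / 2) ^ n / M n := ⟨_, fun _ => rfl⟩
  have hσ : ∀ n, 0 < σ n := fun n => by
    rw [hσdef]; have := hM0 n; positivity
  choose f hfT hf using fun n : ℕ => exists_approx Kp hK h hc (min (σ n) (σ (n + 1)))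
    (lt_min (hσ _) (hσ _))
  have one : ∀ (n : ℕ) (S : {S : Pt → ℝ // Tst S}), ∃ (u : {u : Pt → ℝ // Tst u}) (d τ ε η : ℝ),
      0 < d ∧ (∀ (t s : ℝ) (x : V3), |s - t| < d → |S.1 (s, x) - S.1 (t, x)| ≤ σ n) ∧
      τ ≤ (1 / 2) ^ n ∧ τ ≤ σ (n + 1) ∧ τ ≤ d * (1 / 2) ^ n ∧
      0 < ε ∧ ε ≤ 1 ∧ 0 < η ∧ η ≤ 1 ∧
      (∀ k ≤ n, ∀ t x, ‖iteratedFDeriv ℝ k (fun y => u.1 (t, y)) x‖ ≤ τ) ∧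
      (∀ p, |u.1 p| ≤ τ) ∧ (∀ p, |pdt u.1 p| ≤ τ) ∧ (∀ j p, |pdx j u.1 p| ≤ τ) ∧
      (∀ j p, |pdx j (pdx j u.1) p| ≤ τ) ∧ (∀ j k p, |pdx j (pdx k (pdx k u.1)) p| ≤ τ) ∧
      (∀ j k p, |pdx j (pdx j (pdx k (pdx k u.1))) p| ≤ τ) ∧
      (∀ j p, |pdt (pdx j (pdx j u.1)) p| ≤ M n * |S.1 p| + τ) ∧
      (∀ p : Pt, (1 / 2) ^ (n + 1) ≤ |p.1 / η - round (p.1 / η)| →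
        (1 / 2) ^ (n + 1) ≤ |p.2 0 / ε - round (p.2 0 / ε)| →
        |S.1 p - Lop μ u.1 p| ≤ τ) := by
    rintro n ⟨S, hS⟩
    obtain ⟨d, hd, hdS⟩ := exists_modulus hS (σ n) (hσ n)
    have hτ : 0 < min ((1 / 2) ^ n) (min (σ (n + 1)) (d * (1 / 2) ^ n)) := by
      have := hσ (n + 1)
      positivity
    obtain ⟨u, ε, η, hu, hrest⟩ := hstep n S hS _ hτ n
    exact ⟨⟨u, hu⟩, d, _, ε, η, hd, hdS, min_le_left _ _,
      (min_le_right _ _).trans (min_le_left _ _), (min_le_right _ _).trans (min_le_right _ _), hrest⟩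
  choose u d τ ε η h1 h2 h3 h4 h5 h6 h7 h8 h9 h10 h11 h12 h13 h14 h15 h16 h17 h18 using one
  let V : ℕ → {V : Pt → ℝ // Tst V} := fun n => Nat.rec ⟨fun _ => 0, Tst.zero⟩
    (fun n V => ⟨fun p => V.1 p + Lop μ (u n ⟨fun p => f n p - V.1 p, (hfT n).sub V.2⟩).1 p,
      V.2.add ((u n ⟨fun p => f n p - V.1 p, (hfT n).sub V.2⟩).2.Lop μ)⟩) n
  let S : ℕ → {S : Pt → ℝ // Tst S} := fun n => ⟨fun p => f n p - (V n).1 p, (hfT n).sub (V n).2⟩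
  have hV : ∀ n p, (V (n + 1)).1 p = (V n).1 p + Lop μ (u n (S n)).1 p := fun n p => rfl
  refine ⟨fun n => (u n (S n)).1, fun n => (S n).1, f, fun n => ε n (S n), fun n => η n (S n),
    fun n => d n (S n), M, σ, ?_⟩
  refine
   {tu := fun n => (u n (S n)).2
    tS := fun n => (S n).2
    hσ := hσ
    hσ2 := fun n => ?_
    hM := hM
    hMσ := fun n => ?_
    hε := fun n => h6 n _
    hε1 := fun n => h7 n _
    hη := fun n => h8 n _
    hη1 := fun n => h9 n _
    hd := fun n => h1 n _
    hdS := fun n => h2 n _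
    hf := fun n p hp => (hf n p hp).trans (min_le_left _ _)
    hf' := fun n p hp => (hf n p hp).trans (min_le_right _ _)
    sum := fun n p => ?_
    biter := fun n k hk t x => (h10 n _ k hk t x).trans (h3 n _)
    b0 := fun n p => (h11 n _ p).trans (h3 n _)
    bt := fun n p => (h12 n _ p).trans (h3 n _)
    bx := fun n j p => (h13 n _ j p).trans (h3 n _)
    bxx := fun n j p => (h14 n _ j p).trans (h3 n _)
    bxx' := fun n j p => (h14 n _ j p).trans (h5 n _)
    bxxx := fun n j k p => (h15 n _ j k p).trans (h3 n _)
    bxxxx := fun n j k p => (h16 n _ j k p).trans (h3 n _)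
    btxx := fun n j p => (h17 n _ j p).trans (by gcongr; exact h3 n _)
    good := fun n p hp1 hp2 => (h18 n _ p hp1 hp2).trans (h4 n _)}
  · rw [hσdef]
    exact div_le_self (by positivity) (hM n)
  · rw [hσdef, mul_div_cancel₀ _ (hM0 n).ne']
  · have : ∀ n, ∑ k ∈ Finset.range n, Lop μ (u k (S k)).1 p = (V n).1 p := by
      intro n
      induction n with
      | zero => rfl
      | succ n ih => rw [Finset.sum_range_succ, ih, hV]
    rw [this]
    change _ = f n p - (f n p - (V n).1 p)
    ring

lemma summ_half : Summable (fun n : ℕ => ((1 : ℝ) / 2) ^ n) := summable_geometric_two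

lemma hasDerivAt_line {F : Pt → ℝ} (hF : ContDiff ℝ (⊤ : ℕ∞) F) (p e : Pt) (s : ℝ) :
    HasDerivAt (fun r : ℝ => F (p + r • e)) (lineDeriv ℝ F (p + s • e) e) s := by
  have h := (hF.differentiable (by simp)).differentiableAt (x := p + s • e)
  have h1 : HasDerivAt (fun r : ℝ => p + r • e) e s := by
    simpa using ((hasDerivAt_id s).smul_const e).const_add p
  rw [h.lineDeriv_eq_fderiv]
  exact h.hasFDerivAt.comp_hasDerivAt s h1

lemma pdx_tsum {v : ℕ → Pt → ℝ} (hv : ∀ n, ContDiff ℝ (⊤ : ℕ∞) (v n)) (j : Fin 3)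
    (b0 : ∀ n p, |v n p| ≤ (1 / 2) ^ n) (b1 : ∀ n p, |pdx j (v n) p| ≤ (1 / 2) ^ n) :
    pdx j (fun p => ∑' n, v n p) = fun p => ∑' n, pdx j (v n) p := by
  funext p
  have := hasDerivAt_tsum (𝕜 := ℝ) (g := fun n s => v n (p + s • ((0 : ℝ), Pi.single j 1)))
    (g' := fun n s => pdx j (v n) (p + s • ((0 : ℝ), Pi.single j 1))) (y₀ := 0) summ_half
    (fun n s => hasDerivAt_line (hv n) p _ s) (fun n s => b1 n _)
    (Summable.of_norm_bounded summ_half (fun n => b0 n _)) 0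
  have h2 := this.deriv
  simp only [zero_smul, add_zero] at h2
  exact h2

lemma pdt_of_hasDerivAt {F : Pt → ℝ} {t c : ℝ} {x : V3}
    (hF : HasDerivAt (fun s => F (s, x)) c t) : pdt F (t, x) = c := by
  have : pdt F (t, x) = deriv (fun s => F (t + s, x)) 0 := by
    simp [pdt, lineDeriv]
  rw [this, deriv_comp_const_add (f := fun s => F (s, x)), add_zero, hF.deriv]

lemma hasDerivAt_tsum_dom {g : ℕ → ℝ → ℝ} {g' : ℕ → ℝ} {t : ℝ} {B : ℕ → ℝ} (hB : Summable B)
    (hg : ∀ n, HasDerivAt (g n) (g' n) t) (hb : ∀ n s, |g n s - g n t| ≤ B n * |s - t|)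
    (hs : ∀ s, Summable (fun n => g n s)) :
    HasDerivAt (fun s => ∑' n, g n s) (∑' n, g' n) t := by
  rw [hasDerivAt_iff_tendsto_slope]
  have h1 : Filter.Tendsto (fun s => ∑' n, slope (g n) t s) (nhdsWithin t {t}ᶜ)
      (nhds (∑' n, g' n)) := by
    refine tendsto_tsum_of_dominated_convergence hB
      (fun n => (hasDerivAt_iff_tendsto_slope.1 (hg n))) ?_
    filter_upwards [self_mem_nhdsWithin] with s hst n
    have hpos : 0 < |s - t| := abs_pos.2 (sub_ne_zero.2 hst)
    rw [slope_def_field, Real.norm_eq_abs, abs_div, div_le_iff₀ hpos]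
    exact hb n s
  refine h1.congr fun s => ?_
  simp only [slope_def_field]
  rw [tsum_div_const, (hs s).tsum_sub (hs t)]

lemma CorrSeq.regular {μ : ℝ} {Kp : Set Pt} {h : Pt → ℝ} {u S f : ℕ → Pt → ℝ}
    {ε η d M σ : ℕ → ℝ} (H : CorrSeq μ Kp h u S f ε η d M σ) :
    (∀ x, ContDiff ℝ 1 (fun t => ∑' n, u n (t, x))) ∧
    (∀ t, ContDiff ℝ (⊤ : ℕ∞) (fun x => ∑' n, u n (t, x))) := by
  constructor
  · intro x
    have hd : ∀ t, HasDerivAt (fun t => ∑' n, u n (t, x)) (∑' n, pdt (u n) (t, x)) t :=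
      hasDerivAt_tsum (𝕜 := ℝ) (g := fun n t => u n (t, x)) (g' := fun n t => pdt (u n) (t, x))
        (y₀ := 0) summ_half (fun n t => Tst.hasDerivAt_t (H.tu n).1 t x) (fun n t => H.bt n _)
        (Summable.of_norm_bounded summ_half (fun n => H.b0 n _))
    rw [contDiff_one_iff_deriv]
    refine ⟨fun t => (hd t).differentiableAt, ?_⟩
    rw [funext fun t => (hd t).deriv]
    exact continuous_tsum (fun n => (H.tu n).pdt.1.continuous.comp (by fun_prop)) summ_half
      (fun n t => H.bt n _)
  · intro t
    refine contDiff_tsum_of_eventually (𝕜 := ℝ) (N := (⊤ : ℕ∞)) (f := fun n x => u n (t, x))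
      (v := fun _ n => (1 / 2) ^ n)
      (fun n => (H.tu n).1.comp (by fun_prop)) (fun k _ => summ_half) (fun k _ => ?_)
    rw [Nat.cofinite_eq_atTop]
    filter_upwards [Filter.eventually_ge_atTop k] with n hn x
    exact H.biter n k hn t x

lemma CorrSeq.pointwise {μ : ℝ} {Kp : Set Pt} {h : Pt → ℝ} {u S f : ℕ → Pt → ℝ}
    {ε η d M σ : ℕ → ℝ} (H : CorrSeq μ Kp h u S f ε η d M σ) (p : Pt) (hp : p ∈ Kp)
    (h1 : ∀ᶠ n in Filter.atTop, (1 / 2) ^ (n + 1) ≤ |p.1 / η n - round (p.1 / η n)|)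
    (h2 : ∀ᶠ n in Filter.atTop, (1 / 2) ^ (n + 1) ≤ |p.2 0 / ε n - round (p.2 0 / ε n)|) :
    Lop μ (fun q => ∑' n, u n q) p = h p := by
  obtain ⟨t, x⟩ := p
  obtain ⟨N, hN⟩ := Filter.eventually_atTop.1 (h1.and h2)
  have hS : ∀ n, N ≤ n → |S (n + 1) (t, x)| ≤ 3 * σ (n + 1) := by
    intro n hn
    have g := H.good n (t, x) (hN n hn).1 (hN n hn).2
    have s1 := H.sum (n + 1) (t, x)
    rw [Finset.sum_range_succ, H.sum n] at s1
    have f1 := H.hf (n + 1) _ hp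
    have f2 := H.hf' n _ hp
    rw [abs_le] at *
    constructor <;> linarith
  -- spatial derivatives of the series
  have ex : ∀ j, pdx j (fun q => ∑' n, u n q) = fun q => ∑' n, pdx j (u n) q := fun j =>
    pdx_tsum (fun n => (H.tu n).1) j H.b0 (fun n => H.bx n j)
  have exx : ∀ j, pdx j (pdx j (fun q => ∑' n, u n q)) = fun q => ∑' n, pdx j (pdx j (u n)) q :=
    fun j => by
    rw [ex, pdx_tsum (fun n => ((H.tu n).pdx j).1) j (fun n => H.bx n j) (fun n => H.bxx n j)]
  have exxx : ∀ j k, pdx j (pdx k (pdx k (fun q => ∑' n, u n q))) =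
      fun q => ∑' n, pdx j (pdx k (pdx k (u n))) q := fun j k => by
    rw [exx, pdx_tsum (fun n => (((H.tu n).pdx k).pdx k).1) j (fun n => H.bxx n k)
      (fun n => H.bxxx n j k)]
  have exxxx : ∀ j k, pdx j (pdx j (pdx k (pdx k (fun q => ∑' n, u n q)))) =
      fun q => ∑' n, pdx j (pdx j (pdx k (pdx k (u n)))) q := fun j k => by
    rw [exxx, pdx_tsum (fun n => ((((H.tu n).pdx k).pdx k).pdx j).1) j (fun n => H.bxxx n j k)
      (fun n => H.bxxxx n j k)]
  -- time derivative
  have et : ∀ j, HasSum (fun n => pdt (pdx j (pdx j (u n))) (t, x))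
      (pdt (pdx j (pdx j (fun q => ∑' n, u n q))) (t, x)) := by
    intro j
    choose L hL0 hL using fun n => (((H.tu n).pdx j).pdx j).pdt.bdd
    set B : ℕ → ℝ := fun n => if n ≤ N then L n else 5 * (1 / 2) ^ n with hB
    have hBs : Summable B := by
      refine (summable_congr_atTop ?_).2 (summ_half.mul_left 5)
      filter_upwards [Filter.eventually_gt_atTop N] with n hn
      simp [hB, not_le.2 hn]
    have near : ∀ n, N < n → ∀ s, |s - t| < d n → |pdt (pdx j (pdx j (u n))) (s, x)|
        ≤ 5 * (1 / 2) ^ n := by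
      intro n hn s hs
      obtain ⟨m, rfl⟩ : ∃ m, n = m + 1 := ⟨n - 1, by omega⟩
      have a1 := hS m (by omega)
      have a2 := H.hdS (m + 1) t s x hs
      have a3 : |S (m + 1) (s, x)| ≤ 4 * σ (m + 1) := by
        rw [abs_le] at *
        constructor <;> linarith
      have a4 := H.btxx (m + 1) j (s, x)
      have a5 := H.hMσ (m + 1)
      have a6 := mul_le_mul_of_nonneg_left a3 (zero_le_one.trans (H.hM (m + 1)))
      linarith
    have lip : ∀ n s, |pdx j (pdx j (u n)) (s, x) - pdx j (pdx j (u n)) (t, x)|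
        ≤ B n * |s - t| := by
      intro n s
      by_cases hn : n ≤ N
      · simp only [hB, hn, if_true]
        exact mvt_t (((H.tu n).pdx j).pdx j).1 x t (|s - t| + 1) (L n) (fun r _ => hL n _) s
          (by linarith)
      · simp only [hB, hn, if_false]
        by_cases hs : |s - t| < d n
        · exact mvt_t (((H.tu n).pdx j).pdx j).1 x t (d n) _ (near n (not_le.1 hn)) s hs
        · have a1 := H.bxx' n j (s, x)
          have a2 := H.bxx' n j (t, x)
          have a3 : d n * (1 / 2) ^ n ≤ |s - t| * (1 / 2) ^ n := by
            gcongr; exact not_lt.1 hs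
          have a4 : 0 ≤ |s - t| * (1 / 2) ^ n := by positivity
          refine (abs_sub _ _).trans ?_
          linarith
    have hder := hasDerivAt_tsum_dom (t := t) hBs
      (fun n => Tst.hasDerivAt_t (((H.tu n).pdx j).pdx j).1 t x) lip
      (fun s => Summable.of_norm_bounded summ_half (fun n => H.bxx n j _))
    rw [exx, pdt_of_hasDerivAt (F := fun q => ∑' n, pdx j (pdx j (u n)) q) hder]
    refine (Summable.of_norm_bounded hBs fun n => ?_).hasSum
    by_cases hn : n ≤ N
    · simp only [hB, hn, if_true]; exact hL n _
    · simp only [hB, hn, if_false]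
      exact near n (not_le.1 hn) t (by simpa using H.hd n)
  have eL : HasSum (fun n => Lop μ (u n) (t, x)) (Lop μ (fun q => ∑' n, u n q) (t, x)) := by
    refine HasSum.sub (HasSum.mul_left μ (hasSum_sum fun j _ => hasSum_sum fun k _ => ?_))
      (hasSum_sum fun j _ => et j)
    rw [exxxx]
    exact (Summable.of_norm_bounded summ_half (fun n => H.bxxxx n j k _)).hasSum
  refine tendsto_nhds_unique eL.tendsto_sum_nat ?_
  simp only [H.sum]
  have z : Filter.Tendsto (fun n : ℕ => ((1 : ℝ) / 2) ^ n) Filter.atTop (nhds 0) :=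
    summ_half.tendsto_atTop_zero
  have l1 : Filter.Tendsto (fun n => f n (t, x) - h (t, x)) Filter.atTop (nhds 0) :=
    squeeze_zero_norm (fun n => (H.hf n _ hp).trans (H.hσ2 n)) z
  have l2 : Filter.Tendsto (fun n => S n (t, x)) Filter.atTop (nhds 0) := by
    have z3 : Filter.Tendsto (fun n : ℕ => 3 * ((1 : ℝ) / 2) ^ n) Filter.atTop (nhds 0) := by
      simpa using z.const_mul 3
    refine squeeze_zero_norm' ?_ z3
    filter_upwards [Filter.eventually_gt_atTop N] with n hn
    obtain ⟨m, rfl⟩ : ∃ m, n = m + 1 := ⟨n - 1, by omega⟩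
    have a1 := hS m (by omega)
    have a2 := H.hσ2 (m + 1)
    rw [Real.norm_eq_abs]
    linarith
  have := (l1.sub l2).add_const (h (t, x))
  simp only [sub_zero, zero_add] at this
  refine this.congr fun n => by ring

lemma ae_good (R : ℝ) (hR : 0 < R) (ε : ℕ → ℝ) (hε : ∀ n, 0 < ε n) (hε1 : ∀ n, ε n ≤ 1) :
    ∀ᵐ s : ℝ, s ∈ Set.Icc (-R) R →
      ∀ᶠ n in Filter.atTop, (1 / 2) ^ (n + 1) ≤ |s / ε n - round (s / ε n)| := by
  have hsum : ∑' n : ℕ, volume ({s : ℝ | |s / ε n - round (s / ε n)| < (1 / 2) ^ (n + 1)} ∩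
      Set.Icc (-R) R) ≠ ⊤ := by
    have hs : Summable (fun n : ℕ => (4 * R + 6) * ((1 : ℝ) / 2) ^ (n + 1)) :=
      ((summable_nat_add_iff 1).2 summ_half).mul_left _
    refine ne_top_of_le_ne_top hs.tsum_ofReal_ne_top (ENNReal.tsum_le_tsum fun n => ?_)
    exact volume_bad _ R _ (by positivity) hR (hε n) (hε1 n)
  filter_upwards [ae_eventually_notMem hsum] with s hs hsR
  filter_upwards [hs] with n hn
  by_contra hlt
  exact hn ⟨not_le.1 hlt, hsR⟩

lemma scalar_solution (μ : ℝ) (hμ : 0 < μ) (Kp : Set Pt) (hK : IsCompact Kp) (h : Pt → ℝ)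
    (hc : ContinuousOn h Kp) : ∃ U : Pt → ℝ, (∀ x, ContDiff ℝ 1 (fun t => U (t, x))) ∧
      (∀ t, ContDiff ℝ (⊤ : ℕ∞) (fun x => U (t, x))) ∧
      ∀ᵐ p : Pt, p ∈ Kp → Lop μ U p = h p := by
  obtain ⟨u, S, f, ε, η, d, M, σ, H⟩ := exists_corrSeq μ hμ Kp hK h hc
  refine ⟨fun q => ∑' n, u n q, H.regular.1, H.regular.2, ?_⟩
  obtain ⟨r, hr⟩ := hK.isBounded.subset_closedBall (0 : Pt)
  set R := max r 1 with hRdef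
  have hR : 0 < R := by positivity
  have q1 : ∀ᵐ p : Pt, p.1 ∈ Set.Icc (-R) R → ∀ᶠ n in Filter.atTop,
      (1 / 2) ^ (n + 1) ≤ |p.1 / η n - round (p.1 / η n)| :=
    Measure.quasiMeasurePreserving_fst.ae (ae_good R hR η H.hη H.hη1)
  have q2' : ∀ᵐ y : V3, y 0 ∈ Set.Icc (-R) R → ∀ᶠ n in Filter.atTop,
      (1 / 2) ^ (n + 1) ≤ |y 0 / ε n - round (y 0 / ε n)| :=
    (Measure.quasiMeasurePreserving_eval (fun _ : Fin 3 => (volume : Measure ℝ)) 0).ae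
      (ae_good R hR ε H.hε H.hε1)
  have q2 : ∀ᵐ p : Pt, p.2 0 ∈ Set.Icc (-R) R → ∀ᶠ n in Filter.atTop,
      (1 / 2) ^ (n + 1) ≤ |p.2 0 / ε n - round (p.2 0 / ε n)| :=
    Measure.quasiMeasurePreserving_snd.ae q2'
  filter_upwards [q1, q2] with p hp1 hp2 hp
  have hpn : ‖p‖ ≤ R := by
    have := hr hp
    rw [mem_closedBall_zero_iff] at this
    exact this.trans (le_max_left _ _)
  have n1 : |p.1| ≤ R := (norm_fst_le p).trans hpn
  have n2 : |p.2 0| ≤ R := ((norm_le_pi_norm p.2 0).trans (norm_snd_le p)).trans hpn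
  exact H.pointwise p hp (hp1 (abs_le.1 n1)) (hp2 (abs_le.1 n2))

lemma pdx_congr {F G : Pt → ℝ} {p : Pt} (j : Fin 3) (h : F =ᶠ[nhds p] G) :
    pdx j F =ᶠ[nhds p] pdx j G := by
  filter_upwards [eventually_eventually_nhds.2 h] with q hq
  exact Filter.EventuallyEq.lineDeriv_eq hq

lemma pdt_congr {F G : Pt → ℝ} {p : Pt} (h : F =ᶠ[nhds p] G) :
    pdt F =ᶠ[nhds p] pdt G := by
  filter_upwards [eventually_eventually_nhds.2 h] with q hq
  exact Filter.EventuallyEq.lineDeriv_eq hq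

lemma Lop_congr {F G : Pt → ℝ} {p : Pt} (μ : ℝ) (h : F =ᶠ[nhds p] G) : Lop μ F p = Lop μ G p := by
  have e1 : ∀ j k, pdx j (pdx j (pdx k (pdx k F))) p = pdx j (pdx j (pdx k (pdx k G))) p :=
    fun j k => (pdx_congr j (pdx_congr j (pdx_congr k (pdx_congr k h)))).eq_of_nhds
  have e2 : ∀ j, pdt (pdx j (pdx j F)) p = pdt (pdx j (pdx j G)) p :=
    fun j => (pdt_congr (pdx_congr j (pdx_congr j h))).eq_of_nhds
  simp only [Lop, e1, e2]


/-- Let `K₁ ⊂ ℝ³` be compact with boundary of Lebesgue measure zero,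
`T > 0`, `μ > 0`, `0 < α < 1`, `C > 0`, and `K₁′ = [0,T] × K₁`.  Let
`h₁ : ℝ × ℝ³ → ℝ⁹` vanish outside `K₁′`, be continuous on `K₁′`, and satisfy the Hölder
condition there.  Then there exists `h₂` vanishing outside `K₁′`, with each component
continuously differentiable in `t` on `[0,T]` and smooth in the spatial variables on the
interior of `K₁`, such that
`μ Σⱼ Σₖ ∂⁴h₂/(∂xⱼ²∂xₖ²) − Σⱼ ∂³h₂/(∂t∂xⱼ²) = h₁` almost everywhere on `K₁′`. -/
theorem stmt8 (K₁ : Set V3) (hK : IsCompact K₁)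
    (hfr : volume (frontier K₁) = 0)
    (T μ α C : ℝ) (hT : 0 < T) (hμ : 0 < μ) (hα0 : 0 < α) (hα1 : α < 1) (hC : 0 < C)
    (h₁ : Pt → Fin 9 → ℝ)
    (hvan : ∀ p ∉ Set.Icc (0 : ℝ) T ×ˢ K₁, h₁ p = 0)
    (hcont : ContinuousOn h₁ (Set.Icc (0 : ℝ) T ×ˢ K₁))
    (hHold : ∀ z ∈ Set.Icc (0 : ℝ) T ×ˢ K₁, ∀ z' ∈ Set.Icc (0 : ℝ) T ×ˢ K₁,
      ∀ m : Fin 9, |h₁ z m - h₁ z' m| ≤ C * dist4 z z' ^ α) :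
    ∃ h₂ : Pt → Fin 9 → ℝ,
      (∀ p ∉ Set.Icc (0 : ℝ) T ×ˢ K₁, h₂ p = 0) ∧
      (∀ m : Fin 9, ∀ x : V3, ContDiffOn ℝ 1 (fun t => h₂ (t, x) m) (Set.Icc 0 T)) ∧
      (∀ m : Fin 9, ∀ t ∈ Set.Icc (0 : ℝ) T,
        ContDiffOn ℝ (⊤ : ℕ∞) (fun x => h₂ (t, x) m) (interior K₁)) ∧
      (∀ᵐ p ∂(volume.restrict (Set.Icc (0 : ℝ) T ×ˢ K₁)), ∀ m : Fin 9,
        μ * ∑ j : Fin 3, ∑ k : Fin 3,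
            pdx j (pdx j (pdx k (pdx k (fun q => h₂ q m)))) p
          - ∑ j : Fin 3, pdt (pdx j (pdx j (fun q => h₂ q m))) p = h₁ p m) := by
  classical
  have hKp : IsCompact (Set.Icc (0 : ℝ) T ×ˢ K₁) := isCompact_Icc.prod hK
  choose U hUt hUx hU using fun m : Fin 9 =>
    scalar_solution μ hμ (Set.Icc (0 : ℝ) T ×ˢ K₁) hKp (fun p => h₁ p m)
      (continuousOn_pi.1 hcont m)
  refine ⟨fun p m => if p.1 ∈ Set.Icc (0 : ℝ) T ∧ p.2 ∈ interior K₁ then U m p else 0,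
    ?_, ?_, ?_, ?_⟩
  · intro p hp
    funext m
    exact if_neg (fun h => hp ⟨h.1, interior_subset h.2⟩)
  · intro m x
    by_cases hx : x ∈ interior K₁
    · exact (hUt m x).contDiffOn.congr (fun t ht => if_pos ⟨ht, hx⟩)
    · exact (contDiffOn_const (c := (0 : ℝ))).congr (fun t _ => if_neg (fun h => hx h.2))
  · intro m t ht
    exact (hUx m t).contDiffOn.congr (fun x hx => if_pos ⟨ht, hx⟩)
  · rw [ae_restrict_iff' hKp.measurableSet]
    have e0 : ∀ᵐ p : Pt, p.1 ∉ ({0, T} : Set ℝ) :=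
      Measure.quasiMeasurePreserving_fst.ae
        (measure_eq_zero_iff_ae_notMem.1 ((Set.toFinite ({0, T} : Set ℝ)).measure_zero volume))
    have e1 : ∀ᵐ p : Pt, p.2 ∉ frontier K₁ :=
      Measure.quasiMeasurePreserving_snd.ae (measure_eq_zero_iff_ae_notMem.1 hfr)
    filter_upwards [e0, e1, ae_all_iff.2 hU] with p h0 h1 h2 hp m
    change Lop μ (fun q : Pt => if q.1 ∈ Set.Icc (0 : ℝ) T ∧ q.2 ∈ interior K₁
      then U m q else 0) p = h₁ p m
    rw [← h2 m hp]
    apply Lop_congr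
    have h3 : p.1 ∈ Set.Ioo (0 : ℝ) T := by
      simp only [Set.mem_insert_iff, Set.mem_singleton_iff, not_or] at h0
      exact ⟨lt_of_le_of_ne hp.1.1 (Ne.symm h0.1), lt_of_le_of_ne hp.1.2 h0.2⟩
    have h4 : p.2 ∈ interior K₁ := by
      by_contra h
      exact h1 ⟨subset_closure hp.2, h⟩
    have h5 : Set.Ioo (0 : ℝ) T ×ˢ interior K₁ ∈ nhds p :=
      (isOpen_Ioo.prod isOpen_interior).mem_nhds ⟨h3, h4⟩
    filter_upwards [h5] with q hq
    exact if_pos ⟨Set.Ioo_subset_Icc_self hq.1, hq.2⟩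
end

section
/- Let K₁ ⊂ ℝ³ be compact and let h : ℝ³ → ℝ vanish outside K₁, be bounded, and be Hölder continuous on K₁ with some exponent α ∈ (0,1) and constant C > 0. Then the Newtonian potential v = N(h) is twice continuously differentiable on the interior of K₁ and satisfies Poisson's equation Δv(x₀) = h(x₀), i.e. ∂²v/∂x₁² + ∂²v/∂x₂² + ∂²v/∂x₃² = h, at every interior point x₀ of K₁. -/
open MeasureTheory

open Filter Topology Set Metric

noncomputable section

namespace NP

/-- squared Euclidean norm -/
def sq (z : V3) : ℝ := ∑ i, (z i) ^ 2

/-- the bilinear inner product -/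
def ell : V3 →L[ℝ] V3 →L[ℝ] ℝ :=
  ∑ i : Fin 3, (ContinuousLinearMap.proj (R := ℝ) (φ := fun _ : Fin 3 => ℝ) i).smulRight
    (ContinuousLinearMap.proj (R := ℝ) (φ := fun _ : Fin 3 => ℝ) i)

lemma ell_apply (z w : V3) : ell z w = ∑ i, z i * w i := by
  simp [ell]

/-- regularised powers -/
def P (a e : ℝ) (z : V3) : ℝ := (sq z + e ^ 2) ^ (-a)

lemma sq_nonneg' (z : V3) : 0 ≤ sq z := Finset.sum_nonneg fun i _ => sq_nonneg _

lemma norm_sq_le (z : V3) : ‖z‖ ^ 2 ≤ sq z := by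
  have h : ‖z‖ ≤ Real.sqrt (sq z) := by
    rw [pi_norm_le_iff_of_nonneg (Real.sqrt_nonneg _)]
    intro i
    apply Real.le_sqrt_of_sq_le
    rw [Real.norm_eq_abs, sq_abs]
    exact Finset.single_le_sum (f := fun i => (z i) ^ 2) (fun _ _ => sq_nonneg _) (Finset.mem_univ i)
  calc ‖z‖ ^ 2 ≤ (Real.sqrt (sq z)) ^ 2 := by gcongr
    _ = sq z := Real.sq_sqrt (sq_nonneg' z)

lemma sq_le (z : V3) : sq z ≤ 3 * ‖z‖ ^ 2 := by
  calc sq z ≤ ∑ i : Fin 3, ‖z‖ ^ 2 := by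
        apply Finset.sum_le_sum
        intro i _
        rw [← sq_abs, ← Real.norm_eq_abs]
        gcongr
        exact norm_le_pi_norm z i
    _ = 3 * ‖z‖ ^ 2 := by simp

lemma P_nonneg (a e : ℝ) (z : V3) : 0 ≤ P a e z := by
  have := sq_nonneg' z
  unfold P; positivity

lemma P_le {a : ℝ} (ha : 0 ≤ a) (e : ℝ) {z : V3} (hz : z ≠ 0) :
    P a e z ≤ ‖z‖ ^ (-(2 * a)) := by
  have h0 : 0 < ‖z‖ := norm_pos_iff.2 hz
  have h1 := norm_sq_le z
  calc P a e z ≤ (‖z‖ ^ 2) ^ (-a) := by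
        apply Real.rpow_le_rpow_of_nonpos (by positivity) _ (by linarith)
        nlinarith [sq_nonneg e]
    _ = ‖z‖ ^ (-(2 * a)) := by
        rw [← Real.rpow_natCast, ← Real.rpow_mul h0.le]; congr 1; push_cast; ring

lemma hasFDerivAt_sq (z : V3) : HasFDerivAt sq ((2 : ℝ) • ell z) z := by
  have : ∀ i ∈ (Finset.univ : Finset (Fin 3)), HasFDerivAt (fun z : V3 => (z i) ^ 2)
    ((2 * z i) • (ContinuousLinearMap.proj (R := ℝ) (φ := fun _ : Fin 3 => ℝ) i)) z := by
    intro i _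
    have := ((ContinuousLinearMap.proj (R := ℝ) (φ := fun _ : Fin 3 => ℝ) i).hasFDerivAt
      (x := z)).pow 2
    simpa using this
  have h := HasFDerivAt.fun_sum this
  refine HasFDerivAt.congr_fderiv (f := sq) h ?_
  ext w
  simp [ell, Finset.mul_sum, mul_assoc]

lemma contDiff_sq : ContDiff ℝ ⊤ sq := by unfold sq; fun_prop

lemma contDiff_P (a : ℝ) {e : ℝ} (he : 0 < e) : ContDiff ℝ ⊤ (P a e) := by
  unfold P
  apply ContDiff.rpow_const_of_ne
  · exact contDiff_sq.add contDiff_const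
  · intro x; have := sq_nonneg' x; positivity

lemma hasFDerivAt_P (a : ℝ) {e : ℝ} (he : 0 < e) (z : V3) :
    HasFDerivAt (P a e) ((-(2 * a) * P (a + 1) e z) • ell z) z := by
  have h0 : sq z + e ^ 2 ≠ 0 := by have := sq_nonneg' z; positivity
  have := ((hasFDerivAt_sq z).add_const (e ^ 2)).rpow_const (p := -a) (Or.inl h0)
  refine HasFDerivAt.congr_fderiv (f := P a e) this ?_
  rw [smul_smul, P]
  congr 1
  rw [show -(a + 1) = -a - 1 by ring]; ring

lemma measurable_P (a e : ℝ) : Measurable (P a e) := by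
  unfold P
  have := contDiff_sq.continuous.measurable
  fun_prop

lemma tendsto_P (a : ℝ) {z : V3} (hz : z ≠ 0) :
    Tendsto (fun e => P a e z) (𝓝 0) (𝓝 (P a 0 z)) := by
  have h0 : 0 < ‖z‖ := norm_pos_iff.2 hz
  have h1 := norm_sq_le z
  have h2 : 0 < sq z := lt_of_lt_of_le (by positivity) h1
  have : ContinuousAt (fun e : ℝ => P a e z) 0 := by
    unfold P
    apply ContinuousAt.rpow_const
    · fun_prop
    · left; simp; exact h2.ne'
  exact this

variable {E : Type*} [NormedAddCommGroup E] [NormedSpace ℝ E]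

lemma hasFDerivAt_P_smul (a : ℝ) {e : ℝ} (he : 0 < e) {Ψ : V3 → E} {Ψ' : V3 →L[ℝ] E} {z : V3}
    (h : HasFDerivAt Ψ Ψ' z) :
    HasFDerivAt (fun z => P a e z • Ψ z)
      (P a e z • Ψ' + (-(2 * a)) • P (a + 1) e z • (ell z).smulRight (Ψ z)) z := by
  have := (hasFDerivAt_P a he z).smul h
  refine HasFDerivAt.congr_fderiv this ?_
  ext w
  simp [smul_smul, mul_assoc]

/-- families of kernels with controlled singularity -/
structure Good (R γ : ℝ) (k : ℝ → V3 → E) : Prop where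
  meas : ∀ e, AEStronglyMeasurable (k e) volume
  bound : ∃ c, 0 ≤ c ∧ ∀ e z, z ≠ 0 → ‖k e z‖ ≤ c * ‖z‖ ^ (-γ)
  supp : ∀ e z, R ≤ ‖z‖ → k e z = 0
  lim : ∀ z, z ≠ 0 → Tendsto (fun e => k e z) (𝓝 0) (𝓝 (k 0 z))

lemma Good.add {R γ : ℝ} {k l : ℝ → V3 → E} (hk : Good R γ k) (hl : Good R γ l) :
    Good R γ (fun e z => k e z + l e z) where
  meas e := (hk.meas e).add (hl.meas e)
  bound := by
    obtain ⟨c, hc, h⟩ := hk.bound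
    obtain ⟨d, hd, h'⟩ := hl.bound
    refine ⟨c + d, by positivity, fun e z hz => ?_⟩
    rw [add_mul]
    exact (norm_add_le _ _).trans (add_le_add (h e z hz) (h' e z hz))
  supp e z hz := by simp [hk.supp e z hz, hl.supp e z hz]
  lim z hz := (hk.lim z hz).add (hl.lim z hz)

lemma Good.smul {R γ : ℝ} {k : ℝ → V3 → E} (hk : Good R γ k) (r : ℝ) :
    Good R γ (fun e z => r • k e z) where
  meas e := (hk.meas e).const_smul r
  bound := by
    obtain ⟨c, hc, h⟩ := hk.bound
    refine ⟨|r| * c, by positivity, fun e z hz => ?_⟩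
    rw [norm_smul, mul_assoc, Real.norm_eq_abs]
    gcongr
    exact h e z hz
  supp e z hz := by simp [hk.supp e z hz]
  lim z hz := (hk.lim z hz).const_smul r

lemma good_P {R γ a c : ℝ} (m : ℕ) (ha : 0 ≤ a) (hR : 0 < R) {Θ : V3 → E} (hΘ : Continuous Θ)
    (hc : ∀ z, ‖Θ z‖ ≤ c * ‖z‖ ^ m) (hs : ∀ z, R ≤ ‖z‖ → Θ z = 0) (hγ : 2 * a - m ≤ γ) :
    Good R γ (fun e z => P a e z • Θ z) where
  meas e := (measurable_P a e).aestronglyMeasurable.smul hΘ.aestronglyMeasurable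
  bound := by
    refine ⟨|c| * R ^ (γ - (2 * a - m)), by positivity, fun e z hz => ?_⟩
    have h0 : 0 < ‖z‖ := norm_pos_iff.2 hz
    by_cases hzR : R ≤ ‖z‖
    · rw [hs z hzR]; simp; positivity
    push Not at hzR
    rw [norm_smul, Real.norm_of_nonneg (P_nonneg _ _ _)]
    calc P a e z * ‖Θ z‖ ≤ ‖z‖ ^ (-(2 * a)) * (|c| * ‖z‖ ^ m) := by
          gcongr
          · exact P_le ha e hz
          · exact (hc z).trans (by gcongr; exact le_abs_self c)
      _ = |c| * ‖z‖ ^ (γ - (2 * a - m)) * ‖z‖ ^ (-γ) := by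
          rw [← Real.rpow_natCast, mul_left_comm, ← Real.rpow_add h0, mul_assoc, ← Real.rpow_add h0]
          congr 2; ring
      _ ≤ _ := by gcongr
  supp e z hz := by simp [hs z hz]
  lim z hz := (tendsto_P a hz).smul_const _

lemma integrable_pow {δ R : ℝ} (hδ : δ < 3) (hR : 0 < R) :
    Integrable (fun z : V3 => (ball (0 : V3) R).indicator (fun z => ‖z‖ ^ (-δ)) z) := by
  rw [integrable_indicator_iff measurableSet_ball]
  rw [integrableOn_fun_norm_addHaar (μ := volume) (f := fun y => y ^ (-δ))]
  have : IntegrableOn (fun y : ℝ => y ^ (2 - δ)) (Ioo 0 R) := by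
    rw [intervalIntegral.integrableOn_Ioo_rpow_iff hR]; linarith
  refine this.congr_fun ?_ measurableSet_Ioo
  intro y hy
  simp only [Module.finrank_fin_fun, smul_eq_mul]
  rw [← Real.rpow_natCast, ← Real.rpow_add hy.1]
  congr 1

lemma uniform_lemma {R γ β B : ℝ} (hR : 0 < R) {k : ℝ → V3 → E} (hk : Good R γ k)
    (hβ : γ - β < 3) (hB : 0 ≤ B) {U : Set V3} {a : V3 → V3 → ℝ}
    (hm : ∀ x, AEStronglyMeasurable (a x) volume)
    (ha : ∀ x ∈ U, ∀ y, |a x y| ≤ B * ‖x - y‖ ^ β) :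
    TendstoUniformlyOn (fun (n : ℕ) x => ∫ y, a x y • k (1 / ((n : ℝ) + 1)) (x - y))
      (fun x => ∫ y, a x y • k 0 (x - y)) atTop U := by
  obtain ⟨c, hc, hb⟩ := hk.bound
  have hne : ∀ᵐ z : V3, z ≠ 0 := by simp [ae_iff]
  -- integrability of the dominating function
  have hdom := (integrable_pow (δ := γ - β) hβ hR).const_mul c
  have hbd : ∀ e (z : V3), z ≠ 0 → ‖z‖ ^ β * ‖k e z‖ ≤
      c * (ball (0 : V3) R).indicator (fun z => ‖z‖ ^ (-(γ - β))) z := by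
    intro e z hz
    have h0 : 0 < ‖z‖ := norm_pos_iff.2 hz
    by_cases hzR : R ≤ ‖z‖
    · rw [hk.supp e z hzR]; simp [hzR]
    push Not at hzR
    rw [indicator_of_mem (by simpa using hzR)]
    calc ‖z‖ ^ β * ‖k e z‖ ≤ ‖z‖ ^ β * (c * ‖z‖ ^ (-γ)) := by gcongr; exact hb e z hz
      _ = _ := by rw [mul_left_comm, ← Real.rpow_add h0]; congr 2; ring
  have hmk : ∀ _ : ℝ, AEStronglyMeasurable (fun z : V3 => ‖z‖ ^ β) volume := fun _ =>
    (measurable_norm.pow_const β).aestronglyMeasurable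
  have hIntg : ∀ e, Integrable (fun z : V3 => ‖z‖ ^ β * ‖k e z‖) := fun e => by
    refine hdom.mono' ((hmk e).mul (hk.meas e).norm) ?_
    filter_upwards [hne] with z hz
    rw [Real.norm_of_nonneg (by positivity)]
    exact hbd e z hz
  have hia : ∀ x ∈ U, ∀ e, Integrable (fun y => a x y • k e (x - y)) := fun x hx e => by
    refine (((hIntg e).comp_sub_left x).const_mul B).mono' ((hm x).smul ?_) ?_
    · exact (hk.meas e).comp_quasiMeasurePreserving
        (quasiMeasurePreserving_sub_left volume x)
    · filter_upwards with y
      rw [norm_smul, Real.norm_eq_abs, ← mul_assoc]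
      gcongr
      exact ha x hx y
  have hintd : ∀ e, Integrable (fun z : V3 => ‖z‖ ^ β * ‖k e z - k 0 z‖) := fun e => by
    refine ((hIntg e).add (hIntg 0)).mono' ((hmk e).mul ((hk.meas e).sub (hk.meas 0)).norm) ?_
    filter_upwards with z
    rw [Real.norm_of_nonneg (by positivity), Pi.add_apply, ← mul_add]
    gcongr
    exact norm_sub_le _ _
  have hen : Tendsto (fun n : ℕ => 1 / ((n : ℝ) + 1)) atTop (𝓝 0) :=
    tendsto_one_div_add_atTop_nhds_zero_nat
  have hlim : Tendsto (fun n : ℕ => ∫ z : V3, ‖z‖ ^ β * ‖k (1 / ((n : ℝ) + 1)) z - k 0 z‖) atTop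
      (𝓝 0) := by
    have := tendsto_integral_of_dominated_convergence
      (F := fun (n : ℕ) (z : V3) => ‖z‖ ^ β * ‖k (1 / ((n : ℝ) + 1)) z - k 0 z‖)
      (f := fun _ => 0) (μ := volume) _ (fun n => (hintd _).aestronglyMeasurable)
      (hdom.add hdom) ?_ ?_
    · simpa using this
    · intro n
      filter_upwards [hne] with z hz
      rw [Real.norm_of_nonneg (by positivity), Pi.add_apply]
      refine le_trans ?_ (add_le_add (hbd (1 / ((n : ℝ) + 1)) z hz) (hbd 0 z hz))
      rw [← mul_add]
      gcongr
      exact norm_sub_le _ _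
    · filter_upwards [hne] with z hz
      have h1 := (((hk.lim z hz).comp hen).sub_const (k 0 z)).norm.const_mul (‖z‖ ^ β)
      simpa using h1
  rw [Metric.tendstoUniformlyOn_iff]
  intro η hη
  have h2 : Tendsto (fun n : ℕ => B * ∫ z : V3, ‖z‖ ^ β * ‖k (1 / ((n : ℝ) + 1)) z - k 0 z‖) atTop
      (𝓝 0) := by simpa using hlim.const_mul B
  filter_upwards [h2.eventually (gt_mem_nhds hη)] with n hn x hx
  refine lt_of_le_of_lt ?_ hn
  rw [dist_comm, dist_eq_norm, ← integral_sub (hia x hx _) (hia x hx _)]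
  have e1 : ∀ y, a x y • k (1 / ((n : ℝ) + 1)) (x - y) - a x y • k 0 (x - y) =
    a x y • (k (1 / ((n : ℝ) + 1)) (x - y) - k 0 (x - y)) := fun y => (smul_sub _ _ _).symm
  simp_rw [e1]
  rw [← integral_const_mul]
  rw [← integral_sub_left_eq_self (fun z : V3 => B * (‖z‖ ^ β *
    ‖k (1 / ((n : ℝ) + 1)) z - k 0 z‖)) volume x]
  refine norm_integral_le_of_norm_le (((hintd _).comp_sub_left x).const_mul B) ?_
  filter_upwards with y
  rw [norm_smul, Real.norm_eq_abs, ← mul_assoc]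
  gcongr
  exact ha x hx y

lemma conv_deriv [CompleteSpace E] {h : V3 → ℝ} (hh : LocallyIntegrable h volume) {F : V3 → E}
    (hF : ContDiff ℝ 1 F) (hc : HasCompactSupport F) (x : V3) :
    HasFDerivAt (fun x => ∫ y, h y • F (x - y)) (∫ y, h y • fderiv ℝ F (x - y)) x := by
  have := hc.hasFDerivAt_convolution_right (ContinuousLinearMap.lsmul ℝ ℝ) hh hF x
  exact this

lemma integral_fderiv_zero [CompleteSpace E] {F : V3 → E}
    (hF : ContDiff ℝ 1 F) (hc : HasCompactSupport F) (x : V3) :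
    ∫ y, fderiv ℝ F (x - y) = 0 := by
  have h1 := conv_deriv (h := fun _ => 1) (locallyIntegrable_const _) hF hc x
  have h2 : (fun x => ∫ y, (1 : ℝ) • F (x - y)) = fun _ => ∫ y, F y := by
    funext x
    simp [integral_sub_left_eq_self F volume x]
  rw [h2] at h1
  have := h1.unique (hasFDerivAt_const _ _)
  simpa using this

end NP

namespace NP

lemma radial_integral :
    ∫ y in Ioi (0 : ℝ), y ^ 2 * (y ^ 2 + 1) ^ (-(5 / 2) : ℝ) = 1 / 3 := by
  have hd : ∀ y ∈ Ici (0 : ℝ), HasDerivAt (fun y : ℝ => (1 / 3) * (y ^ 3 * (y ^ 2 + 1) ^ (-(3 / 2) : ℝ)))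
      (y ^ 2 * (y ^ 2 + 1) ^ (-(5 / 2) : ℝ)) y := by
    intro y _
    have hp : 0 < y ^ 2 + 1 := by positivity
    have h1 : HasDerivAt (fun y : ℝ => y ^ 2 + 1) (2 * y) y := by
      simpa using (hasDerivAt_pow 2 y).add_const 1
    have h2 := h1.rpow_const (p := (-(3 / 2) : ℝ)) (Or.inl hp.ne')
    have h3 := ((hasDerivAt_pow 3 y).mul h2).const_mul (1 / 3)
    refine HasDerivAt.congr_deriv h3 ?_
    have e1 : (y ^ 2 + 1) ^ (-(3 / 2) : ℝ) = (y ^ 2 + 1) * (y ^ 2 + 1) ^ (-(5 / 2) : ℝ) := by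
      rw [← Real.rpow_one_add' hp.le (by norm_num)]; norm_num
    have e2 : (-(3 / 2) - 1 : ℝ) = -(5 / 2) := by norm_num
    rw [e1, e2]
    push_cast
    ring
  have hl : Tendsto (fun y : ℝ => (1 / 3) * (y ^ 3 * (y ^ 2 + 1) ^ (-(3 / 2) : ℝ))) atTop
      (𝓝 (1 / 3)) := by
    have h1 : Tendsto (fun y : ℝ => (1 / 3) * (1 + (y ^ 2)⁻¹) ^ (-(3 / 2) : ℝ)) atTop
        (𝓝 ((1 / 3) * (1 + 0) ^ (-(3 / 2) : ℝ))) := by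
      apply Tendsto.const_mul
      apply Tendsto.rpow_const
      · exact tendsto_const_nhds.add (tendsto_inv_atTop_zero.comp (tendsto_pow_atTop (by norm_num)))
      · left; norm_num
    have h2 : ((1 / 3) * (1 + 0) ^ (-(3 / 2) : ℝ) : ℝ) = 1 / 3 := by norm_num
    rw [h2] at h1
    refine h1.congr' ?_
    filter_upwards [eventually_gt_atTop 0] with y hy
    have e1 : 1 + (y ^ 2)⁻¹ = (y ^ 2 + 1) * (y ^ 2)⁻¹ := by field_simp
    rw [e1, Real.mul_rpow (by positivity) (by positivity), Real.inv_rpow (by positivity),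
      ← Real.rpow_neg (by positivity), ← Real.rpow_natCast y 2, ← Real.rpow_mul hy.le]
    have e2 : (y : ℝ) ^ (((2 : ℕ) : ℝ) * (- -(3 / 2))) = y ^ 3 := by
      rw [← Real.rpow_natCast]; norm_num
    rw [e2]; ring
  have := integral_Ioi_of_hasDerivAt_of_nonneg' (a := 0) hd (fun y _ => by positivity) hl
  simpa using this

lemma mass : ∫ z : V3, P (5 / 2) 1 z = 4 * Real.pi / 3 := by
  have h1 := (PiLp.volume_preserving_ofLp (Fin 3)).integral_comp
    (MeasurableEquiv.toLp 2 (Fin 3 → ℝ)).symm.measurableEmbedding (P (5 / 2) 1)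
  rw [← h1]
  have h2 : ∀ x : EuclideanSpace ℝ (Fin 3), P (5 / 2) 1 (WithLp.ofLp x) =
      (fun y : ℝ => (y ^ 2 + 1) ^ (-(5 / 2) : ℝ)) ‖x‖ := by
    intro x
    simp only [P, sq]
    rw [EuclideanSpace.norm_sq_eq]
    simp
  simp_rw [h2]
  rw [integral_fun_norm_addHaar volume (fun y : ℝ => (y ^ 2 + 1) ^ (-(5 / 2) : ℝ))]
  simp only [finrank_euclideanSpace, Fintype.card_fin, smul_eq_mul]
  rw [show (3 - 1 : ℕ) = 2 from rfl, radial_integral]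
  rw [Measure.real, EuclideanSpace.volume_ball_fin_three]
  simp
  rw [ENNReal.toReal_ofReal (by positivity)]
  ring

lemma approx_id {h : V3 → ℝ} (hh : Integrable h volume) {x : V3} (hx : ContinuousAt h x) :
    Tendsto (fun n : ℕ => ∫ y, h y * (-3 * (1 / ((n : ℝ) + 1)) ^ 2 *
      P (5 / 2) (1 / ((n : ℝ) + 1)) (x - y))) atTop (𝓝 (-(4 * Real.pi) * h x)) := by
  have key := tendsto_integral_comp_smul_smul_of_integrable' (μ := (volume : Measure V3))
    (φ := fun z => 3 / (4 * Real.pi) * P (5 / 2) 1 z) (fun z => by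
      have := P_nonneg (5 / 2) 1 z
      positivity) (by
      rw [integral_const_mul, mass]
      field_simp) (by
      have h1 : Tendsto (fun x : V3 => 3 / (4 * Real.pi) * ‖x‖ ^ (-2 : ℝ)) (Bornology.cobounded V3)
          (𝓝 (3 / (4 * Real.pi) * 0)) := by
        apply Tendsto.const_mul
        exact (tendsto_rpow_neg_atTop (by norm_num : (0 : ℝ) < 2)).comp tendsto_norm_cobounded_atTop
      rw [mul_zero] at h1
      refine squeeze_zero' (Eventually.of_forall fun z => ?_) ?_ h1
      · have := P_nonneg (5 / 2) 1 z
        positivity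
      · have : ∀ᶠ z : V3 in Bornology.cobounded V3, 0 < ‖z‖ :=
          tendsto_norm_cobounded_atTop.eventually (eventually_gt_atTop 0)
        filter_upwards [this] with z hz
        have h2 := P_le (a := 5 / 2) (by norm_num) 1 (norm_pos_iff.1 hz)
        rw [Module.finrank_fin_fun]
        calc ‖z‖ ^ 3 * (3 / (4 * Real.pi) * P (5 / 2) 1 z)
            ≤ ‖z‖ ^ 3 * (3 / (4 * Real.pi) * ‖z‖ ^ (-(2 * (5 / 2)) : ℝ)) := by gcongr
          _ = 3 / (4 * Real.pi) * (‖z‖ ^ ((3 : ℕ) : ℝ) * ‖z‖ ^ (-(2 * (5 / 2)) : ℝ)) := by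
            rw [Real.rpow_natCast]; ring
          _ = 3 / (4 * Real.pi) * ‖z‖ ^ (-2 : ℝ) := by
            rw [← Real.rpow_add hz]; norm_num)
    hh hx
  have hc : Tendsto (fun n : ℕ => (n : ℝ) + 1) atTop atTop :=
    tendsto_atTop_add_const_right _ _ tendsto_natCast_atTop_atTop
  have k2 := (key.comp hc).const_mul (-(4 * Real.pi))
  refine k2.congr fun n => ?_
  simp only [Function.comp]
  rw [← integral_const_mul]
  congr 1
  ext y
  rw [Module.finrank_fin_fun]
  set z := x - y
  set c : ℝ := (n : ℝ) + 1
  have hc0 : 0 < c := by positivity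
  have e1 : P (5 / 2) (1 / c) z = c ^ 5 * P (5 / 2) 1 (c • z) := by
    have : sq z + (1 / c) ^ 2 = (sq (c • z) + 1 ^ 2) * (c ^ 2)⁻¹ := by
      have : sq (c • z) = c ^ 2 * sq z := by simp [sq, mul_pow, Finset.mul_sum]
      rw [this]; field_simp
    have hs := sq_nonneg' (c • z)
    rw [P, this, Real.mul_rpow (by positivity) (by positivity), Real.inv_rpow (by positivity),
      ← Real.rpow_neg (by positivity), ← Real.rpow_natCast c 2, ← Real.rpow_mul hc0.le, P]
    have e2 : c ^ (((2 : ℕ) : ℝ) * (- -(5 / 2))) = c ^ 5 := by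
      rw [← Real.rpow_natCast]; norm_num
    rw [e2]; ring
  rw [e1]
  simp only [smul_eq_mul]
  have := Real.pi_pos
  field_simp

end NP

namespace NP

open scoped ContDiff

/-- cutoff times inner product -/
def Psi (χ : V3 → ℝ) (z : V3) : V3 →L[ℝ] ℝ := χ z • ell z

def G (χ : V3 → ℝ) (e : ℝ) (z : V3) : ℝ := P (1 / 2) e z • χ z

def D1 (χ : V3 → ℝ) (e : ℝ) (z : V3) : V3 →L[ℝ] ℝ :=
  P (1 / 2) e z • fderiv ℝ χ z + (-1 : ℝ) • P (3 / 2) e z • Psi χ z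

def D2 (χ : V3 → ℝ) (e : ℝ) (z : V3) : V3 →L[ℝ] V3 →L[ℝ] ℝ :=
  (P (1 / 2) e z • fderiv ℝ (fderiv ℝ χ) z +
    (-1 : ℝ) • P (3 / 2) e z • (ell z).smulRight (fderiv ℝ χ z)) +
  (-1 : ℝ) • (P (3 / 2) e z • fderiv ℝ (Psi χ) z +
    (-3 : ℝ) • P (5 / 2) e z • (ell z).smulRight (Psi χ z))

section
variable {χ : V3 → ℝ}


lemma contDiff_fd
    (hχ : ContDiff ℝ ∞ χ) : ContDiff ℝ ∞ (fderiv ℝ χ) := hχ.fderiv_right (by simp)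

lemma contDiff_Psi
    (hχ : ContDiff ℝ ∞ χ) : ContDiff ℝ ∞ (Psi χ) := hχ.smul ell.contDiff

lemma hasFDerivAt_G
    (hχ : ContDiff ℝ ∞ χ) {e : ℝ} (he : 0 < e) (z : V3) : HasFDerivAt (G χ e) (D1 χ e z) z := by
  have h := hasFDerivAt_P_smul (1 / 2) he ((hχ.differentiable (by simp)) z).hasFDerivAt
  refine HasFDerivAt.congr_fderiv (f := G χ e) h ?_
  ext w
  have e1 : (1 / 2 + 1 : ℝ) = 3 / 2 := by norm_num
  rw [e1]
  simp [D1, Psi]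
  left; ring

lemma hasFDerivAt_D1
    (hχ : ContDiff ℝ ∞ χ) {e : ℝ} (he : 0 < e) (z : V3) : HasFDerivAt (D1 χ e) (D2 χ e z) z := by
  have h1 := hasFDerivAt_P_smul (1 / 2) he
    (((contDiff_fd hχ).differentiable (by simp)) z).hasFDerivAt
  have h2 := hasFDerivAt_P_smul (3 / 2) he
    (((contDiff_Psi hχ).differentiable (by simp)) z).hasFDerivAt
  have h := h1.add (h2.const_smul (-1 : ℝ))
  refine HasFDerivAt.congr_fderiv (f := D1 χ e) h ?_
  have e1 : (1 / 2 + 1 : ℝ) = 3 / 2 := by norm_num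
  have e2 : (3 / 2 + 1 : ℝ) = 5 / 2 := by norm_num
  have e3 : (-(2 * (1 / 2)) : ℝ) = -1 := by norm_num
  have e4 : (-(2 * (3 / 2)) : ℝ) = -3 := by norm_num
  rw [D2, e1, e2, e3, e4]

lemma fderiv_G
    (hχ : ContDiff ℝ ∞ χ) {e : ℝ} (he : 0 < e) : fderiv ℝ (G χ e) = D1 χ e :=
  funext fun z => (hasFDerivAt_G hχ he z).fderiv

lemma fderiv_D1
    (hχ : ContDiff ℝ ∞ χ) {e : ℝ} (he : 0 < e) : fderiv ℝ (D1 χ e) = D2 χ e :=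
  funext fun z => (hasFDerivAt_D1 hχ he z).fderiv

lemma contDiff_G
    (hχ : ContDiff ℝ ∞ χ) {e : ℝ} (he : 0 < e) : ContDiff ℝ ∞ (G χ e) :=
  ((contDiff_P _ he).of_le le_top).smul hχ

lemma contDiff_D1
    (hχ : ContDiff ℝ ∞ χ) {e : ℝ} (he : 0 < e) : ContDiff ℝ ∞ (D1 χ e) := by
  rw [← fderiv_G hχ he]; exact contDiff_fd (contDiff_G hχ he)

lemma contDiff_D2
    (hχ : ContDiff ℝ ∞ χ) {e : ℝ} (he : 0 < e) : ContDiff ℝ ∞ (D2 χ e) := by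
  rw [← fderiv_D1 hχ he]; exact (contDiff_D1 hχ he).fderiv_right (by simp)

variable {R r : ℝ}

lemma vanish
    (hs : tsupport χ ⊆ ball 0 R) {z : V3} (hz : R ≤ ‖z‖) : χ =ᶠ[𝓝 z] 0 := by
  rw [← notMem_tsupport_iff_eventuallyEq]
  intro h
  have := hs h
  simp at this
  linarith

lemma bounded_of {E : Type*} [NormedAddCommGroup E] {f : V3 → E} (hf : Continuous f)
    (h : ∀ z, R ≤ ‖z‖ → f z = 0) : ∃ c, 0 ≤ c ∧ ∀ z, ‖f z‖ ≤ c := by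
  have hc : HasCompactSupport f := by
    apply HasCompactSupport.intro (isCompact_closedBall (0 : V3) R)
    intro z hz
    simp at hz
    exact h z hz.le
  obtain ⟨c, hc⟩ := hf.bounded_above_of_compact_support hc
  exact ⟨c, (norm_nonneg _).trans (hc 0), hc⟩


lemma fd_zero
    (hs : tsupport χ ⊆ ball 0 R) {z : V3} (hz : R ≤ ‖z‖) : fderiv ℝ χ z = 0 := by
  rw [(vanish hs hz).fderiv_eq]; simp

lemma fd2_zero
    (hs : tsupport χ ⊆ ball 0 R) {z : V3} (hz : R ≤ ‖z‖) : fderiv ℝ (fderiv ℝ χ) z = 0 := by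
  have : fderiv ℝ χ =ᶠ[𝓝 z] 0 := (vanish hs hz).fderiv.trans (by simp)
  rw [this.fderiv_eq]; simp

lemma Psi_zero
    (hs : tsupport χ ⊆ ball 0 R) {z : V3} (hz : R ≤ ‖z‖) : Psi χ z = 0 := by
  rw [Psi, (vanish hs hz).eq_of_nhds]; simp

lemma fdPsi_zero
    (hs : tsupport χ ⊆ ball 0 R) {z : V3} (hz : R ≤ ‖z‖) : fderiv ℝ (Psi χ) z = 0 := by
  have : Psi χ =ᶠ[𝓝 z] 0 := by
    filter_upwards [vanish hs hz] with w hw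
    simp [Psi, hw]
  rw [this.fderiv_eq]; simp

lemma compact_of
    (hs : tsupport χ ⊆ ball 0 R) {E : Type*} [NormedAddCommGroup E] {f : V3 → E}
    (h : ∀ z, R ≤ ‖z‖ → f z = 0) : HasCompactSupport f := by
  apply HasCompactSupport.intro (isCompact_closedBall (0 : V3) R)
  intro z hz
  simp at hz
  exact h z hz.le

lemma good_G
    (hχ : ContDiff ℝ ∞ χ) (hs : tsupport χ ⊆ ball 0 R) (hR : 0 < R) : Good R 1 (G χ) := by
  have hv : ∀ z, R ≤ ‖z‖ → χ z = 0 := fun z hz => (vanish hs hz).eq_of_nhds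
  obtain ⟨c, -, hc⟩ := bounded_of hχ.continuous hv
  exact good_P (c := c) 0 (by norm_num) hR hχ.continuous (by simpa using hc) hv (by norm_num)

lemma Psi_bound
    (hχ : ContDiff ℝ ∞ χ) (hs : tsupport χ ⊆ ball 0 R) : ∃ c, 0 ≤ c ∧ ∀ z, ‖Psi χ z‖ ≤ c * ‖z‖ := by
  have hv : ∀ z, R ≤ ‖z‖ → χ z = 0 := fun z hz => (vanish hs hz).eq_of_nhds
  obtain ⟨c, hc0, hc⟩ := bounded_of hχ.continuous hv
  refine ⟨c * ‖ell‖, by positivity, fun z => ?_⟩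
  rw [Psi, norm_smul, mul_assoc]
  exact mul_le_mul (hc z) (ell.le_opNorm z) (norm_nonneg _) hc0

lemma good_D1
    (hχ : ContDiff ℝ ∞ χ) (hs : tsupport χ ⊆ ball 0 R) (hR : 0 < R) : Good R 2 (D1 χ) := by
  obtain ⟨c, -, hc⟩ := bounded_of (contDiff_fd hχ).continuous (fun z hz => fd_zero hs hz)
  obtain ⟨d, -, hd⟩ := Psi_bound hχ hs
  exact (good_P (c := c) 0 (by norm_num) hR (contDiff_fd hχ).continuous (by simpa using hc)
    (fun z hz => fd_zero hs hz) (by norm_num)).add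
    ((good_P (c := d) 1 (by norm_num) hR (contDiff_Psi hχ).continuous (by simpa using hd)
    (fun z hz => Psi_zero hs hz) (by norm_num)).smul (-1))

lemma good_D2
    (hχ : ContDiff ℝ ∞ χ) (hs : tsupport χ ⊆ ball 0 R) (hR : 0 < R) : Good R 3 (D2 χ) := by
  have hc2 : Continuous (fderiv ℝ (fderiv ℝ χ)) := (contDiff_fd hχ).continuous_fderiv (by simp)
  have hc3 : Continuous (fderiv ℝ (Psi χ)) := (contDiff_Psi hχ).continuous_fderiv (by simp)
  obtain ⟨c, c0, hc⟩ := bounded_of (contDiff_fd hχ).continuous (fun z hz => fd_zero hs hz)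
  obtain ⟨c2b, -, hc2b⟩ := bounded_of (f := fderiv ℝ (fderiv ℝ χ)) hc2 (fun z hz => fd2_zero hs hz)
  obtain ⟨c3b, -, hc3b⟩ := bounded_of (f := fderiv ℝ (Psi χ)) hc3 (fun z hz => fdPsi_zero hs hz)
  obtain ⟨d, d0, hd⟩ := Psi_bound hχ hs
  have hs1 : Continuous (fun z => (ell z).smulRight (fderiv ℝ χ z)) :=
    (ContinuousLinearMap.smulRightL ℝ V3 (V3 →L[ℝ] ℝ)).continuous₂.comp
      (ell.continuous.prodMk (contDiff_fd hχ).continuous)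
  have hs2 : Continuous (fun z => (ell z).smulRight (Psi χ z)) :=
    (ContinuousLinearMap.smulRightL ℝ V3 (V3 →L[ℝ] ℝ)).continuous₂.comp
      (ell.continuous.prodMk (contDiff_Psi hχ).continuous)
  have b1 : ∀ z, ‖(ell z).smulRight (fderiv ℝ χ z)‖ ≤ ‖ell‖ * c * ‖z‖ ^ 1 := by
    intro z
    rw [ContinuousLinearMap.norm_smulRight_apply, pow_one]
    calc _ ≤ (‖ell‖ * ‖z‖) * c := mul_le_mul (ell.le_opNorm z) (hc z) (norm_nonneg _) (by positivity)
      _ = _ := by ring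
  have b2 : ∀ z, ‖(ell z).smulRight (Psi χ z)‖ ≤ ‖ell‖ * d * ‖z‖ ^ 2 := by
    intro z
    rw [ContinuousLinearMap.norm_smulRight_apply]
    calc _ ≤ (‖ell‖ * ‖z‖) * (d * ‖z‖) :=
          mul_le_mul (ell.le_opNorm z) (hd z) (norm_nonneg _) (by positivity)
      _ = _ := by ring
  have b3 : ∀ z, ‖fderiv ℝ (fderiv ℝ χ) z‖ ≤ c2b * ‖z‖ ^ 0 := by simpa using hc2b
  have b4 : ∀ z, ‖fderiv ℝ (Psi χ) z‖ ≤ c3b * ‖z‖ ^ 0 := by simpa using hc3b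
  have z1 : ∀ z, R ≤ ‖z‖ → (ell z).smulRight (fderiv ℝ χ z) = 0 := fun z hz => by
    rw [fd_zero hs hz]; ext; simp
  have z2 : ∀ z, R ≤ ‖z‖ → (ell z).smulRight (Psi χ z) = 0 := fun z hz => by
    rw [Psi_zero hs hz]; ext; simp
  have g1 : Good R 3 (fun e z => P (1 / 2) e z • fderiv ℝ (fderiv ℝ χ) z) :=
    good_P (E := V3 →L[ℝ] V3 →L[ℝ] ℝ) (R := R) (γ := 3) (a := 1 / 2) (c := c2b)
      (Θ := fun z => fderiv ℝ (fderiv ℝ χ) z) 0 (by norm_num) hR hc2 b3 (fun z hz => fd2_zero hs hz) (by norm_num)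
  have g2 : Good R 3 (fun e z => P (3 / 2) e z • (ell z).smulRight (fderiv ℝ χ z)) :=
    good_P (E := V3 →L[ℝ] V3 →L[ℝ] ℝ) (R := R) (γ := 3) (a := 3 / 2) (c := ‖ell‖ * c)
      (Θ := fun z => (ell z).smulRight (fderiv ℝ χ z)) 1 (by norm_num) hR hs1 b1 z1 (by norm_num)
  have g3 : Good R 3 (fun e z => P (3 / 2) e z • fderiv ℝ (Psi χ) z) :=
    good_P (E := V3 →L[ℝ] V3 →L[ℝ] ℝ) (R := R) (γ := 3) (a := 3 / 2) (c := c3b)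
      (Θ := fun z => fderiv ℝ (Psi χ) z) 0 (by norm_num) hR hc3 b4 (fun z hz => fdPsi_zero hs hz) (by norm_num)
  have g4 : Good R 3 (fun e z => P (5 / 2) e z • (ell z).smulRight (Psi χ z)) :=
    good_P (E := V3 →L[ℝ] V3 →L[ℝ] ℝ) (R := R) (γ := 3) (a := 5 / 2) (c := ‖ell‖ * d)
      (Θ := fun z => (ell z).smulRight (Psi χ z)) 2 (by norm_num) hR hs2 b2 z2 (by norm_num)
  exact (g1.add (g2.smul (-1))).add ((g3.add (g4.smul (-3))).smul (-1))

lemma trace_D2 (hone : ∀ z ∈ ball (0 : V3) r, χ z = 1) {e : ℝ} (he : 0 < e) {z : V3}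
    (hz : ‖z‖ < r) :
    ∑ i : Fin 3, D2 χ e z (Pi.single i 1) (Pi.single i 1) = -3 * e ^ 2 * P (5 / 2) e z := by
  have h0 : χ =ᶠ[𝓝 z] fun _ => 1 := by
    filter_upwards [isOpen_ball.mem_nhds (show z ∈ ball (0 : V3) r by simpa using hz)] with w hw
    exact hone w hw
  have h1 : fderiv ℝ χ =ᶠ[𝓝 z] 0 := h0.fderiv.trans (by simp)
  have h2 : fderiv ℝ χ z = 0 := h1.eq_of_nhds
  have h3 : fderiv ℝ (fderiv ℝ χ) z = 0 := by rw [h1.fderiv_eq]; simp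
  have h4 : Psi χ =ᶠ[𝓝 z] ell := by
    filter_upwards [h0] with w hw
    simp [Psi, hw]
  have h5 : fderiv ℝ (Psi χ) z = ell := by rw [h4.fderiv_eq]; exact ell.fderiv
  have h6 : Psi χ z = ell z := h4.eq_of_nhds
  have hp : 0 < sq z + e ^ 2 := by have := sq_nonneg' z; positivity
  have e1 : P (3 / 2) e z = (sq z + e ^ 2) * P (5 / 2) e z := by
    rw [P, P, ← Real.rpow_one_add' hp.le (by norm_num)]; norm_num
  simp only [D2, h2, h3, h5, h6, e1]
  simp [ell_apply, Fin.sum_univ_three, sq]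
  ring

end

end NP

namespace NP

open scoped ContDiff

lemma norm3_eq (z : V3) : norm3 z = Real.sqrt (sq z) := rfl

lemma norm3_le (z : V3) : norm3 z ≤ 2 * ‖z‖ := by
  rw [norm3_eq]
  apply Real.sqrt_le_iff.2
  refine ⟨by positivity, ?_⟩
  have := sq_le z
  nlinarith [sq_nonneg ‖z‖]

lemma norm3_nonneg (z : V3) : 0 ≤ norm3 z := Real.sqrt_nonneg _

lemma inv_norm3 (x y : V3) : (norm3 (y - x))⁻¹ = P (1 / 2) 0 (x - y) := by
  have : sq (y - x) = sq (x - y) := by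
    simp only [sq]
    congr 1
    ext i
    simp only [Pi.sub_apply]
    ring
  rw [norm3_eq, this, P, Real.rpow_neg (by have := sq_nonneg' (x - y); positivity),
    Real.sqrt_eq_rpow]
  simp

/-- trace functional -/
def T : (V3 →L[ℝ] V3 →L[ℝ] ℝ) →L[ℝ] ℝ :=
  ∑ i : Fin 3, (ContinuousLinearMap.apply ℝ ℝ (Pi.single i 1 : V3)).comp
    (ContinuousLinearMap.apply ℝ (V3 →L[ℝ] ℝ) (Pi.single i 1 : V3))

lemma T_apply (L : V3 →L[ℝ] V3 →L[ℝ] ℝ) :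
    T L = ∑ i : Fin 3, L (Pi.single i 1) (Pi.single i 1) := by
  simp [T]

set_option maxSynthPendingDepth 4 in
lemma main_local (K : Set V3) (hK : IsCompact K) (h : V3 → ℝ)
    (hvan : ∀ x ∉ K, h x = 0) (M : ℝ) (hM : ∀ x, |h x| ≤ M)
    (C α : ℝ) (hC : 0 < C) (hα0 : 0 < α)
    (hHold : ∀ x ∈ K, ∀ x' ∈ K, |h x - h x'| ≤ C * norm3 (x - x') ^ α)
    (x₀ : V3) (hx₀ : x₀ ∈ interior K) :
    ∃ ρ > 0, ∃ (g1 : V3 → V3 →L[ℝ] ℝ) (g2 : V3 → V3 →L[ℝ] V3 →L[ℝ] ℝ),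
      (∀ x ∈ ball x₀ ρ, HasFDerivAt (fun x => ∫ y in K, h y / norm3 (y - x)) (g1 x) x) ∧
      (∀ x ∈ ball x₀ ρ, HasFDerivAt g1 (g2 x) x) ∧ ContinuousOn g2 (ball x₀ ρ) ∧
      ∀ x ∈ ball x₀ ρ, T (g2 x) = -(4 * Real.pi) * h x := by
  have hM0 : 0 ≤ M := (abs_nonneg _).trans (hM 0)
  obtain ⟨δ, hδ, hδK⟩ := Metric.mem_nhds_iff.1 (mem_interior_iff_mem_nhds.1 hx₀)
  set ρ := δ / 2 with hρ
  have hρ0 : 0 < ρ := by positivity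
  have hBK : ∀ x ∈ ball x₀ ρ, ∀ y, ‖x - y‖ < ρ → y ∈ K := by
    intro x hx y hy
    apply hδK
    rw [mem_ball] at hx ⊢
    have h1 : dist y x < ρ := by rw [dist_comm, dist_eq_norm]; exact hy
    linarith [dist_triangle y x x₀]
  have hxK : ∀ x ∈ ball x₀ ρ, x ∈ K := fun x hx => hBK x hx x (by simpa using hρ0)
  -- the global Hoelder bound
  set B := C * 2 ^ α + 2 * M / ρ ^ α with hB
  have hB0 : 0 ≤ B := by positivity
  have hHb : ∀ x ∈ ball x₀ ρ, ∀ y, |h y - h x| ≤ B * ‖x - y‖ ^ α := by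
    intro x hx y
    rw [hB, add_mul]
    by_cases hy : ‖x - y‖ < ρ
    · have h1 := hHold y (hBK x hx y hy) x (hxK x hx)
      have h2 : norm3 (y - x) ^ α ≤ (2 * ‖x - y‖) ^ α := by
        apply Real.rpow_le_rpow (norm3_nonneg _) _ hα0.le
        rw [norm_sub_rev]; exact norm3_le _
      rw [Real.mul_rpow (by norm_num) (norm_nonneg _)] at h2
      have h3 : 0 ≤ 2 * M / ρ ^ α * ‖x - y‖ ^ α := by positivity
      have h4 := mul_le_mul_of_nonneg_left h2 hC.le
      linarith
    · push Not at hy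
      have h1 : |h y - h x| ≤ 2 * M := by
        have := abs_sub (h y) (h x)
        linarith [hM x, hM y]
      have h2 : 2 * M ≤ 2 * M / ρ ^ α * ‖x - y‖ ^ α := by
        rw [div_mul_eq_mul_div, le_div_iff₀ (by positivity)]
        gcongr
      have h3 : 0 ≤ C * 2 ^ α * ‖x - y‖ ^ α := by positivity
      linarith
  -- continuity and measurability of h
  have hcont : ContinuousOn h K := by
    intro x hx
    rw [ContinuousWithinAt, tendsto_iff_norm_sub_tendsto_zero]
    have h1 : Tendsto (fun y : V3 => C * norm3 (y - x) ^ α) (𝓝[K] x) (𝓝 0) := by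
      have : Continuous (fun y : V3 => C * norm3 (y - x) ^ α) := by
        have h2 : Continuous norm3 := contDiff_sq.continuous.sqrt
        exact continuous_const.mul ((h2.comp (continuous_id.sub continuous_const)).rpow_const
          (fun _ => Or.inr hα0.le))
      have h3 := (this.tendsto x).mono_left (nhdsWithin_le_nhds (s := K))
      have h4 : C * norm3 (x - x) ^ α = 0 := by
        simp [norm3, Real.zero_rpow hα0.ne']
      rwa [h4] at h3
    refine squeeze_zero' (Eventually.of_forall fun _ => norm_nonneg _) ?_ h1
    filter_upwards [self_mem_nhdsWithin] with y hy
    exact hHold y hy x hx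
  have hind : K.indicator h = h := by
    rw [indicator_eq_self]
    intro x hx
    by_contra hxK
    exact hx (hvan x hxK)
  have hIntg : Integrable h := by
    rw [← hind, integrable_indicator_iff hK.measurableSet]
    exact hcont.integrableOn_compact hK
  have hmeas : AEStronglyMeasurable h volume := hIntg.aestronglyMeasurable
  -- cutoff
  obtain ⟨r, hr0, hr⟩ : ∃ r > 0, ∀ x ∈ ball x₀ ρ, ∀ y ∈ K, ‖x - y‖ < r := by
    obtain ⟨s, hs⟩ := hK.isBounded.subset_ball x₀
    refine ⟨ρ + |s|, by positivity, fun x hx y hy => ?_⟩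
    have h1 := hs hy
    rw [mem_ball] at h1 hx
    rw [← dist_eq_norm]
    have := dist_triangle_right x y x₀
    linarith [le_abs_self s]
  let f : ContDiffBump (0 : V3) := ⟨r, r + 1, hr0, by linarith⟩
  obtain ⟨χ, hχdef⟩ : ∃ χ : V3 → ℝ, χ = fun z => f z := ⟨_, rfl⟩
  have hχ : ContDiff ℝ ∞ χ := by rw [hχdef]; exact f.contDiff
  set R := r + 2
  have hR : 0 < R := by positivity
  have hs : tsupport χ ⊆ ball 0 R := by
    have ht : tsupport χ = closedBall 0 (r + 1) := by rw [hχdef]; exact f.tsupport_eq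
    rw [ht]
    apply closedBall_subset_ball
    change r + 1 < r + 2
    linarith
  have hone : ∀ z ∈ ball (0 : V3) r, χ z = 1 := fun z hz => by
    rw [hχdef]
    exact f.one_of_mem_closedBall (ball_subset_closedBall hz)
  have gG := good_G hχ hs hR
  have gD1 := good_D1 hχ hs hR
  have gD2 := good_D2 hχ hs hR
  have he : ∀ n : ℕ, 0 < 1 / ((n : ℝ) + 1) := fun n => by positivity
  have u0 := uniform_lemma (β := 0) (B := M) (U := ball x₀ ρ) (a := fun _ y => h y) hR gG
    (by norm_num) hM0 (fun _ => hmeas) (fun x _ y => by simpa using hM y)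
  have u1 := uniform_lemma (β := 0) (B := M) (U := ball x₀ ρ) (a := fun _ y => h y) hR gD1
    (by norm_num) hM0 (fun _ => hmeas) (fun x _ y => by simpa using hM y)
  have u2 := uniform_lemma (β := α) (B := B) (U := ball x₀ ρ) (a := fun x y => h y - h x) hR gD2
    (by linarith) hB0 (fun x => hmeas.sub aestronglyMeasurable_const) hHb
  have d0 : ∀ (n : ℕ) (x : V3), HasFDerivAt
      (fun x => ∫ y, h y • G χ (1 / ((n : ℝ) + 1)) (x - y))
      (∫ y, h y • D1 χ (1 / ((n : ℝ) + 1)) (x - y)) x := fun n x => by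
    have := conv_deriv hIntg.locallyIntegrable ((contDiff_G hχ (he n)).of_le (by simp))
      (compact_of (hs := hs) (gG.supp _)) x
    rwa [fderiv_G hχ (he n)] at this
  have d1 : ∀ (n : ℕ) (x : V3), HasFDerivAt
      (fun x => ∫ y, h y • D1 χ (1 / ((n : ℝ) + 1)) (x - y))
      (∫ y, h y • D2 χ (1 / ((n : ℝ) + 1)) (x - y)) x := fun n x => by
    have := conv_deriv hIntg.locallyIntegrable ((contDiff_D1 hχ (he n)).of_le (by simp))
      (compact_of (hs := hs) (gD1.supp _)) x
    rwa [fderiv_D1 hχ (he n)] at this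
  have d2 : ∀ (n : ℕ) (x : V3), ContinuousAt
      (fun x => ∫ y, h y • D2 χ (1 / ((n : ℝ) + 1)) (x - y)) x := fun n x =>
    (conv_deriv hIntg.locallyIntegrable ((contDiff_D2 hχ (he n)).of_le (by simp))
      (compact_of (hs := hs) (gD2.supp _)) x).continuousAt
  have i2 : ∀ (n : ℕ) (x : V3), Integrable (fun y => D2 χ (1 / ((n : ℝ) + 1)) (x - y)) :=
    fun n x => ((contDiff_D2 hχ (he n)).continuous.integrable_of_hasCompactSupport
      (compact_of (hs := hs) (gD2.supp _))).comp_sub_left x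
  have ih2 : ∀ (n : ℕ) (x : V3), Integrable (fun y => h y • D2 χ (1 / ((n : ℝ) + 1)) (x - y)) :=
    fun n x => by
      refine ((i2 n x).norm.const_mul M).mono' (hmeas.smul (i2 n x).aestronglyMeasurable) ?_
      filter_upwards with y
      rw [norm_smul]
      gcongr
      exact hM y
  have eq2 : ∀ (n : ℕ) (x : V3), ∫ y, (h y - h x) • D2 χ (1 / ((n : ℝ) + 1)) (x - y) =
      ∫ y, h y • D2 χ (1 / ((n : ℝ) + 1)) (x - y) := fun n x => by
    simp_rw [sub_smul]
    have ihx : Integrable (fun y => h x • D2 χ (1 / ((n : ℝ) + 1)) (x - y)) :=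
      (i2 n x).smul (h x)
    rw [integral_sub (ih2 n x) ihx, integral_smul]
    have := integral_fderiv_zero ((contDiff_D1 hχ (he n)).of_le (by simp))
      (compact_of (hs := hs) (gD1.supp _)) x
    rw [fderiv_D1 hχ (he n)] at this
    rw [this]; simp
  simp_rw [eq2] at u2
  refine ⟨ρ, hρ0, fun x => ∫ y, h y • D1 χ 0 (x - y),
    fun x => ∫ y, (h y - h x) • D2 χ 0 (x - y), ?_, ?_, ?_, ?_⟩
  · intro x hx
    have key : HasFDerivAt (fun x => ∫ y, h y • G χ 0 (x - y)) (∫ y, h y • D1 χ 0 (x - y)) x :=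
      hasFDerivAt_of_tendstoUniformlyOn isOpen_ball u1 (fun n x _ => d0 n x)
        (fun x hx => u0.tendsto_at hx) hx
    refine key.congr_of_eventuallyEq ?_
    filter_upwards [isOpen_ball.mem_nhds hx] with w hw
    rw [setIntegral_eq_integral_of_forall_compl_eq_zero (fun y hy => by rw [hvan y hy]; simp)]
    congr 1
    ext y
    by_cases hy : y ∈ K
    · have h1 := hone (w - y) (by simpa using hr w hw y hy)
      rw [G, h1, div_eq_mul_inv, inv_norm3]
      simp
    · rw [hvan y hy]; simp
  · intro x hx
    exact hasFDerivAt_of_tendstoUniformlyOn isOpen_ball u2 (fun n x _ => d1 n x)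
        (fun x hx => u1.tendsto_at hx) hx
  · exact u2.continuousOn (Frequently.of_forall fun n x hx => (d2 n x).continuousWithinAt)
  · intro x hx
    have l1 := (T.continuous.tendsto _).comp (u2.tendsto_at hx)
    have hcx : ContinuousAt h x := by
      apply hcont.continuousAt
      refine mem_of_superset (isOpen_ball.mem_nhds hx) hxK
    have l2 := approx_id hIntg hcx
    refine tendsto_nhds_unique l1 (l2.congr fun n => ?_)
    simp only [Function.comp]
    rw [← T.integral_comp_comm (ih2 n x)]
    congr 1
    ext y
    by_cases hy : y ∈ K
    · rw [map_smul, T_apply, trace_D2 hone (he n) (hr x hx y hy), smul_eq_mul]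
    · rw [hvan y hy]; simp

end NP

end

/-- Let `K₁ ⊂ ℝ³` be compact and let `h : ℝ³ → ℝ` vanish outside `K₁`,
be bounded, and be Hölder continuous on `K₁` with exponent `α ∈ (0,1)` and constant
`C > 0`.  Then the Newtonian potential `v = N(h)` is twice continuously differentiable on
the interior of `K₁` and satisfies Poisson's equation `Δv = h` at every interior point of
`K₁`. -/
theorem stmt13 (K₁ : Set V3) (hK : IsCompact K₁) (h : V3 → ℝ)
    (hvan : ∀ x ∉ K₁, h x = 0) (hbd : ∃ M : ℝ, ∀ x, |h x| ≤ M)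
    (C α : ℝ) (hC : 0 < C) (hα0 : 0 < α) (hα1 : α < 1)
    (hHold : ∀ x ∈ K₁, ∀ x' ∈ K₁, |h x - h x'| ≤ C * norm3 (x - x') ^ α) :
    ContDiffOn ℝ 2 (NPot K₁ h) (interior K₁) ∧
    ∀ x₀ ∈ interior K₁,
      ∑ i : Fin 3, pdx3 i (pdx3 i (NPot K₁ h)) x₀ = h x₀ := by
  obtain ⟨M, hM⟩ := hbd
  have key := NP.main_local K₁ hK h hvan M hM C α hC hα0 hHold
  have hN : ∀ x : V3, NPot K₁ h x = (-(1 / (4 * Real.pi))) •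
      (fun x => ∫ y in K₁, h y / norm3 (y - x)) x := fun x => rfl
  have hN' : NPot K₁ h = fun x => (-(1 / (4 * Real.pi))) •
      (fun x => ∫ y in K₁, h y / norm3 (y - x)) x := funext hN
  constructor
  · intro x₀ hx₀
    obtain ⟨ρ, hρ, g1, g2, h1, h2, h3, -⟩ := key x₀ hx₀
    apply ContDiffAt.contDiffWithinAt
    rw [hN']
    apply ContDiffAt.const_smul
    have hU : Metric.ball x₀ ρ ∈ nhds x₀ := Metric.ball_mem_nhds x₀ hρ
    apply ContDiffOn.contDiffAt _ hU
    rw [show (2 : WithTop ℕ∞) = 1 + 1 by norm_num,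
      contDiffOn_succ_iff_fderiv_of_isOpen Metric.isOpen_ball]
    refine ⟨fun x hx => (h1 x hx).differentiableAt.differentiableWithinAt, by simp, ?_⟩
    have c2 : ContDiffOn ℝ 1 g1 (Metric.ball x₀ ρ) := by
      rw [show (1 : WithTop ℕ∞) = 0 + 1 by simp,
        contDiffOn_succ_iff_fderiv_of_isOpen Metric.isOpen_ball]
      refine ⟨fun x hx => (h2 x hx).differentiableAt.differentiableWithinAt, by simp, ?_⟩
      rw [contDiffOn_zero]
      exact h3.congr fun x hx => (h2 x hx).fderiv
    exact c2.congr fun x hx => (h1 x hx).fderiv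
  · intro x₀ hx₀
    obtain ⟨ρ, hρ, g1, g2, h1, h2, -, h4⟩ := key x₀ hx₀
    have hU : Metric.ball x₀ ρ ∈ nhds x₀ := Metric.ball_mem_nhds x₀ hρ
    have e1 : ∀ i : Fin 3, pdx3 i (pdx3 i (NPot K₁ h)) x₀ =
        -(1 / (4 * Real.pi)) * g2 x₀ (Pi.single i 1) (Pi.single i 1) := by
      intro i
      have a1 : pdx3 i (NPot K₁ h) =ᶠ[nhds x₀]
          fun x => (-(1 / (4 * Real.pi))) • g1 x (Pi.single i 1) := by
        filter_upwards [hU] with x hx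
        rw [pdx3, hN']
        have := ((h1 x hx).const_smul (-(1 / (4 * Real.pi)))).hasLineDerivAt (Pi.single i 1)
        exact this.lineDeriv
      have a2 : HasFDerivAt (fun x => g1 x (Pi.single i 1))
          ((ContinuousLinearMap.apply ℝ ℝ (Pi.single i 1 : V3)).comp (g2 x₀)) x₀ :=
        (ContinuousLinearMap.apply ℝ ℝ (Pi.single i 1 : V3)).hasFDerivAt.comp x₀
          (h2 x₀ (Metric.mem_ball_self hρ))
      have a3 := (a2.const_smul (-(1 / (4 * Real.pi)))).congr_of_eventuallyEq a1
      have a4 := (a3.hasLineDerivAt (Pi.single i 1)).lineDeriv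
      rw [pdx3, a4]
      simp
    simp_rw [e1]
    rw [← Finset.mul_sum, ← NP.T_apply, h4 x₀ (Metric.mem_ball_self hρ)]
    have := Real.pi_pos
    field_simp
end

section
/- Fix T > 0 and μ > 0. There exists a constant c > 0, depending only on μ, such that for every bounded continuous v : [0,T] × ℝ³ → ℝ with |v(t,x)| ≤ V for all (t,x), the heat potential h₂ = P(v) has continuous first-order spatial partial derivatives ∂h₂/∂x_i (i = 1,2,3) on (0,T] × ℝ³, and |∂h₂/∂x_i(t,x)| ≤ c·√t·V for all (t,x) ∈ (0,T] × ℝ³ and i = 1,2,3. -/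
open MeasureTheory

namespace HeatAux

/-- Gaussian with scale `b`. -/
noncomputable def gq (b : ℝ) (z : V3) : ℝ := Real.exp (-(∑ j, (z j) ^ 2) / b)

/-- The differentiated Gaussian. -/
noncomputable def gd (μ : ℝ) (i : Fin 3) (z : V3) : ℝ := z i / (2 * μ) * gq (4 * μ) z

lemma gq_cont (b : ℝ) : Continuous (gq b) := by
  unfold gq; fun_prop

lemma gd_cont (μ : ℝ) (i : Fin 3) : Continuous (gd μ i) := by
  have := gq_cont (4 * μ)
  unfold gd; fun_prop

lemma gq_pos (b : ℝ) (z : V3) : 0 < gq b z := Real.exp_pos _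

lemma gq_int {b : ℝ} (hb : 0 < b) : Integrable (gq b) := by
  have h : Integrable (fun z : V3 => ∏ j, (fun x : ℝ => Real.exp (-(1 / b) * x ^ 2)) (z j)) := by
    apply Integrable.fintype_prod (f := fun (_ : Fin 3) (x : ℝ) => Real.exp (-(1 / b) * x ^ 2))
      (μ := fun _ => (volume : Measure ℝ))
    intro j
    exact integrable_exp_neg_mul_sq (by positivity)
  refine h.congr (Filter.Eventually.of_forall fun z => ?_)
  simp only [gq]
  rw [← Real.exp_sum, ← Finset.mul_sum]
  congr 1
  ring

lemma gd_le {μ : ℝ} (hμ : 0 < μ) (i : Fin 3) (z : V3) :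
    |gd μ i z| ≤ (1 + 8 * μ) / (2 * μ) * gq (8 * μ) z := by
  have h1 : |z i| ≤ (1 + 8 * μ) * Real.exp ((∑ j, (z j) ^ 2) / (8 * μ)) := by
    have h2 : (z i) ^ 2 ≤ ∑ j, (z j) ^ 2 :=
      Finset.single_le_sum (f := fun j => (z j) ^ 2) (fun j _ => sq_nonneg _) (Finset.mem_univ i)
    set S := ∑ j, (z j) ^ 2
    have h3 : S / (8 * μ) + 1 ≤ Real.exp (S / (8 * μ)) := Real.add_one_le_exp _
    have hS : 0 ≤ S := le_trans (sq_nonneg _) h2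
    have h4 : |z i| ≤ 1 + S := by
      have := sq_abs (z i)
      nlinarith [sq_nonneg (|z i| - 1), abs_nonneg (z i)]
    have h5 : (1 + 8 * μ) * (S / (8 * μ) + 1) = S / (8 * μ) + 1 + S + 8 * μ := by
      field_simp; ring
    have h6 : 0 ≤ S / (8 * μ) := by positivity
    calc |z i| ≤ (1 + 8 * μ) * (S / (8 * μ) + 1) := by rw [h5]; linarith
      _ ≤ _ := by gcongr
  have h7 : gq (4 * μ) z * Real.exp ((∑ j, (z j) ^ 2) / (8 * μ)) = gq (8 * μ) z := by
    unfold gq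
    rw [← Real.exp_add]
    congr 1
    field_simp; ring
  unfold gd
  rw [abs_mul, abs_div, abs_of_pos (gq_pos _ _), abs_of_pos (by positivity : 0 < 2 * μ), ← h7]
  have := gq_pos (4 * μ) z
  calc |z i| / (2 * μ) * gq (4 * μ) z
      ≤ ((1 + 8 * μ) * Real.exp ((∑ j, (z j) ^ 2) / (8 * μ))) / (2 * μ) * gq (4 * μ) z := by
        gcongr
    _ = _ := by ring

lemma gd_int {μ : ℝ} (hμ : 0 < μ) (i : Fin 3) : Integrable (gd μ i) := by
  refine ((gq_int (by positivity : 0 < 8 * μ)).const_mul ((1 + 8 * μ) / (2 * μ))).mono'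
    (gd_cont μ i).aestronglyMeasurable (Filter.Eventually.of_forall fun z => ?_)
  exact gd_le hμ i z

lemma gq_shift {b : ℝ} (hb : 0 < b) (i : Fin 3) (z : V3) (h : ℝ) (hh : |h| ≤ 1) :
    gq b (z - h • Pi.single i 1) ≤ Real.exp (1 / b) * gq (2 * b) z := by
  unfold gq
  rw [← Real.exp_add, Real.exp_le_exp]
  have h1 : (∑ j, (z j) ^ 2) / 2 - 1 ≤ ∑ j, ((z - h • (Pi.single i 1 : V3)) j) ^ 2 := by
    have h2 : ∑ j, (h • (Pi.single i 1 : V3)) j ^ 2 ≤ 1 := by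
      have : h ^ 2 ≤ 1 := by rw [← sq_abs]; nlinarith [abs_nonneg h]
      have h3 : ∑ j, (h • (Pi.single i 1 : V3)) j ^ 2 = h ^ 2 := by
        simp [Pi.single_apply]
      linarith
    have h4 : ∑ j, ((z j) ^ 2 / 2 - (h • (Pi.single i 1 : V3)) j ^ 2) ≤
        ∑ j, ((z - h • (Pi.single i 1 : V3)) j) ^ 2 := by
      apply Finset.sum_le_sum
      intro j _
      rw [Pi.sub_apply]
      nlinarith [sq_nonneg (z j - 2 * (h • (Pi.single i 1 : V3)) j)]
    rw [Finset.sum_sub_distrib, ← Finset.sum_div] at h4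
    linarith
  have h5 : 1 / b + -(∑ j, (z j) ^ 2) / (2 * b) = -((∑ j, (z j) ^ 2) / 2 - 1) / b := by
    field_simp; ring
  rw [h5]
  gcongr

lemma gq_deriv {μ : ℝ} (hμ : 0 < μ) (i : Fin 3) (z : V3) (h : ℝ) :
    HasDerivAt (fun h : ℝ => gq (4 * μ) (z - h • Pi.single i 1))
      (gd μ i (z - h • Pi.single i 1)) h := by
  have h1 : HasDerivAt (fun h : ℝ => ∑ j, ((z - h • (Pi.single i 1 : V3)) j) ^ 2)
      (∑ j, 2 * ((z - h • (Pi.single i 1 : V3)) j) * (-(Pi.single i 1 : V3) j)) h := by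
    apply HasDerivAt.fun_sum
    intro j _
    have h2 : HasDerivAt (fun h : ℝ => z j - h * (Pi.single i 1 : V3) j)
        (-(Pi.single i 1 : V3) j) h := by
      simpa using ((hasDerivAt_id h).mul_const ((Pi.single i 1 : V3) j)).const_sub (z j)
    simpa using h2.fun_pow 2
  have h3 := (h1.neg.div_const (4 * μ)).exp
  refine h3.congr_deriv ?_
  unfold gd gq
  rw [mul_comm]
  congr 1
  simp only [Pi.single_apply, mul_neg, mul_ite, mul_one, mul_zero, Finset.sum_neg_distrib,
    Finset.sum_ite_eq', Finset.mem_univ, if_true, neg_neg, Pi.sub_apply, Pi.smul_apply]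
  field_simp
  ring

lemma conv_deriv {μ : ℝ} (hμ : 0 < μ) (i : Fin 3) (w : V3 → ℝ) (V : ℝ) (hw : Continuous w)
    (hV : ∀ z, |w z| ≤ V) (a : V3) (h₀ : ℝ) :
    HasDerivAt (fun h : ℝ => ∫ z, w z * gq (4 * μ) (z - a - h • Pi.single i 1))
      (∫ z, w z * gd μ i (z - a - h₀ • Pi.single i 1)) h₀ := by
  have hV0 : 0 ≤ V := (abs_nonneg _).trans (hV 0)
  have hc := gq_cont (4 * μ)
  have hd := gd_cont μ i
  refine (hasDerivAt_integral_of_dominated_loc_of_deriv_le (s := Metric.ball h₀ 1)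
    (F' := fun h z => w z * gd μ i (z - a - h • Pi.single i 1))
    (bound := fun z => V * ((1 + 8 * μ) / (2 * μ) * (Real.exp (1 / (8 * μ)) *
      gq (2 * (8 * μ)) (z - (a + h₀ • Pi.single i 1)))))
    (Metric.ball_mem_nhds _ one_pos) ?_ ?_ ?_ ?_ ?_ ?_).2
  · exact Filter.Eventually.of_forall fun h =>
      (by fun_prop : Continuous _).aestronglyMeasurable
  · have h1 := (gq_int (by positivity : 0 < 4 * μ)).comp_sub_right (a + h₀ • Pi.single i 1)
    refine (h1.const_mul V).mono' (by fun_prop : Continuous _).aestronglyMeasurable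
      (Filter.Eventually.of_forall fun z => ?_)
    rw [Real.norm_eq_abs, abs_mul, sub_sub, abs_of_pos (gq_pos _ _)]
    exact mul_le_mul_of_nonneg_right (hV z) (gq_pos _ _).le
  · exact (by fun_prop : Continuous _).aestronglyMeasurable
  · refine Filter.Eventually.of_forall fun z h hh => ?_
    rw [Real.norm_eq_abs, abs_mul]
    have h1 : z - a - h • (Pi.single i 1 : V3) =
        (z - (a + h₀ • Pi.single i 1)) - (h - h₀) • Pi.single i 1 := by
      rw [sub_smul]; abel
    rw [h1]
    apply mul_le_mul (hV z) _ (abs_nonneg _) hV0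
    refine (gd_le hμ i _).trans ?_
    gcongr
    apply gq_shift (by positivity)
    rw [Metric.mem_ball, Real.dist_eq] at hh
    exact hh.le
  · exact ((((gq_int (by positivity : 0 < 2 * (8 * μ))).comp_sub_right _).const_mul _).const_mul
      _).const_mul _
  · exact Filter.Eventually.of_forall fun z h _ => (gq_deriv hμ i (z - a) h).const_mul _

/-- Average of `v (s, x + k z)` against `g`. -/
noncomputable def av (v : Pt → ℝ) (g : V3 → ℝ) (s k : ℝ) (x : V3) : ℝ :=
  ∫ z, v (s, x + k • z) * g z

lemma av_cont {v : Pt → ℝ} {V : ℝ} (hv : Continuous v) (hV : ∀ p, |v p| ≤ V) {g : V3 → ℝ}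
    (hg : Continuous g) (hgi : Integrable g) :
    Continuous (fun q : ℝ × ℝ × V3 => av v g q.1 q.2.1 q.2.2) := by
  unfold av
  apply continuous_of_dominated (bound := fun z => V * |g z|)
  · intro q
    exact (by fun_prop : Continuous _).aestronglyMeasurable
  · intro q
    refine Filter.Eventually.of_forall fun z => ?_
    rw [Real.norm_eq_abs, abs_mul]
    exact mul_le_mul_of_nonneg_right (hV _) (abs_nonneg _)
  · exact hgi.abs.const_mul _
  · refine Filter.Eventually.of_forall fun z => ?_
    fun_prop

lemma av_le {v : Pt → ℝ} {V : ℝ} (hV : ∀ p, |v p| ≤ V) {g G : V3 → ℝ}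
    (hG : Integrable G) (hgG : ∀ z, |g z| ≤ G z) (s k : ℝ) (x : V3) :
    |av v g s k x| ≤ V * ∫ z, G z := by
  have hV0 : 0 ≤ V := (abs_nonneg _).trans (hV 0)
  unfold av
  rw [← integral_const_mul, ← Real.norm_eq_abs]
  apply norm_integral_le_of_norm_le (hG.const_mul V)
  refine Filter.Eventually.of_forall fun z => ?_
  rw [Real.norm_eq_abs, abs_mul]
  exact mul_le_mul (hV _) (hgG z) (abs_nonneg _) hV0

lemma av_shift (v : Pt → ℝ) (g : V3 → ℝ) (s : ℝ) {k : ℝ} (hk : 0 < k) (x e : V3) (h : ℝ) :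
    av v g s k (x + h • e) = ∫ z, v (s, k • z) * g (z - k⁻¹ • x - (h / k) • e) := by
  unfold av
  rw [← integral_sub_right_eq_self _ (k⁻¹ • x + (h / k) • e)]
  congr 1
  ext z
  have h1 : x + h • e + k • (z - (k⁻¹ • x + (h / k) • e)) = k • z := by
    rw [smul_sub, smul_add, smul_smul, smul_smul, mul_inv_cancel₀ hk.ne', one_smul,
      mul_div_cancel₀ _ hk.ne']
    abel
  rw [h1, sub_sub]

lemma av_deriv {μ : ℝ} (hμ : 0 < μ) (i : Fin 3) {v : Pt → ℝ} {V : ℝ} (hv : Continuous v)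
    (hV : ∀ p, |v p| ≤ V) (s : ℝ) {k : ℝ} (hk : 0 < k) (x : V3) (h₀ : ℝ) :
    HasDerivAt (fun h : ℝ => av v (gq (4 * μ)) s k (x + h • Pi.single i 1))
      (k⁻¹ * av v (gd μ i) s k (x + h₀ • Pi.single i 1)) h₀ := by
  simp only [av_shift v _ s hk]
  have h1 := conv_deriv hμ i (fun z => v (s, k • z)) V (by fun_prop) (fun z => hV _) (k⁻¹ • x)
    (h₀ / k)
  have h2 : HasDerivAt (fun h : ℝ => h / k) (k⁻¹) h₀ := by
    simpa using (hasDerivAt_id h₀).div_const k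
  exact h1.scomp h₀ h2

lemma inner_eq {μ : ℝ} (hμ : 0 < μ) (v : Pt → ℝ) (s k : ℝ) (hk : 0 < k) (x : V3) :
    ∫ y : V3, v (s, y) * k ^ (-(3 : ℝ) / 2) *
        Real.exp (-(∑ i, (x i - y i) ^ 2) / (4 * μ * k)) = av v (gq (4 * μ)) s (√k) x := by
  have hs : 0 < √k := Real.sqrt_pos.2 hk
  have h0 : k ^ (-(3 : ℝ) / 2) = ((√k) ^ 3)⁻¹ := by
    rw [Real.sqrt_eq_rpow, ← Real.rpow_natCast, ← Real.rpow_mul hk.le, ← Real.rpow_neg hk.le]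
    norm_num
  have h1 := Measure.integral_comp_smul (volume : Measure V3)
    (fun y => v (s, x + y) * Real.exp (-(∑ i, (y i) ^ 2) / (4 * μ * k))) (√k)
  rw [Module.finrank_fin_fun, abs_of_pos (by positivity), smul_eq_mul] at h1
  have h2 : av v (gq (4 * μ)) s (√k) x = ∫ y : V3, v (s, x + √k • y) *
      Real.exp (-(∑ i, ((√k • y) i) ^ 2) / (4 * μ * k)) := by
    unfold av gq
    congr 1
    ext y
    congr 2
    simp only [Pi.smul_apply, smul_eq_mul, mul_pow, Real.sq_sqrt hk.le]
    rw [← Finset.mul_sum]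
    field_simp
  rw [h2, h1, ← integral_add_left_eq_self _ x, h0, ← integral_const_mul]
  congr 1
  ext y
  simp only [Pi.add_apply, sub_add_cancel_left, neg_sq]
  ring

lemma sqrt_inv_int : IntervalIntegrable (fun r : ℝ => (√r)⁻¹) volume 0 1 := by
  refine (intervalIntegral.intervalIntegrable_rpow' (r := -(1 / 2)) (by norm_num)).congr ?_
  intro r hr
  rw [Set.uIoc_of_le zero_le_one] at hr
  simp only
  rw [Real.rpow_neg hr.1.le, Real.sqrt_eq_rpow]

lemma HPot_eq {μ : ℝ} (hμ : 0 < μ) (v : Pt → ℝ) {t : ℝ} (ht : 0 < t) (x : V3) :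
    HPot μ v t x = (1 / (2 * √(Real.pi * μ))) ^ 3 *
      (t * ∫ r in (0 : ℝ)..1, av v (gq (4 * μ)) (t - t * r) (√(t * r)) x) := by
  unfold HPot
  congr 1
  have h1 : ∀ᵐ s : ℝ, s ∈ Set.Ioc 0 t → (∫ y : V3, v (s, y) * (t - s) ^ (-(3 : ℝ) / 2) *
        Real.exp (-(∑ i, (x i - y i) ^ 2) / (4 * μ * (t - s)))) =
      av v (gq (4 * μ)) s (√(t - s)) x := by
    have : ∀ᵐ s : ℝ, s ≠ t := by simp [ae_iff]
    filter_upwards [this] with s hs hst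
    exact inner_eq hμ v s (t - s) (sub_pos.2 (lt_of_le_of_ne hst.2 hs)) x
  rw [setIntegral_congr_ae measurableSet_Ioc h1, ← intervalIntegral.integral_of_le ht.le]
  have h2 := intervalIntegral.integral_comp_sub_mul (a := 0) (b := 1)
    (fun s => av v (gq (4 * μ)) s (√(t - s)) x) ht.ne' t
  simp only [sub_sub_cancel, mul_one, mul_zero, sub_self, sub_zero, smul_eq_mul] at h2
  rw [h2, mul_inv_cancel_left₀ ht.ne']

/-- The spatial derivative of the heat potential. -/
noncomputable def DP (μ : ℝ) (i : Fin 3) (v : Pt → ℝ) (p : Pt) : ℝ :=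
  (1 / (2 * √(Real.pi * μ))) ^ 3 *
    (√p.1 * ∫ r in (0 : ℝ)..1, (√r)⁻¹ * av v (gd μ i) (p.1 - p.1 * r) (√(p.1 * r)) p.2)

/-- The constant. -/
noncomputable def MM (μ : ℝ) : ℝ := ∫ z, (1 + 8 * μ) / (2 * μ) * gq (8 * μ) z

lemma gdav_le {μ : ℝ} (hμ : 0 < μ) (i : Fin 3) {v : Pt → ℝ} {V : ℝ} (hV : ∀ p, |v p| ≤ V)
    (s k : ℝ) (x : V3) : |av v (gd μ i) s k x| ≤ V * MM μ :=
  av_le hV ((gq_int (by positivity : 0 < 8 * μ)).const_mul _) (gd_le hμ i) s k x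

lemma DP_cont {μ : ℝ} (hμ : 0 < μ) (i : Fin 3) {v : Pt → ℝ} {V : ℝ} (hv : Continuous v)
    (hV : ∀ p, |v p| ≤ V) : Continuous (DP μ i v) := by
  have hB := av_cont hv hV (gd_cont μ i) (gd_int hμ i)
  unfold DP
  refine continuous_const.mul ((Real.continuous_sqrt.comp continuous_fst).mul ?_)
  apply intervalIntegral.continuous_of_dominated_interval (bound := fun r => (√r)⁻¹ * (V * MM μ))
  · intro p
    have h1 : Continuous fun r : ℝ => av v (gd μ i) (p.1 - p.1 * r) (√(p.1 * r)) p.2 :=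
      hB.comp (by fun_prop : Continuous fun r : ℝ => (p.1 - p.1 * r, √(p.1 * r), p.2))
    exact (Real.continuous_sqrt.measurable.inv.aestronglyMeasurable).mul h1.aestronglyMeasurable
  · intro p
    refine Filter.Eventually.of_forall fun r _ => ?_
    rw [Real.norm_eq_abs, abs_mul, abs_of_nonneg (by positivity : 0 ≤ (√r)⁻¹)]
    exact mul_le_mul_of_nonneg_left (gdav_le hμ i hV _ _ _) (by positivity)
  · exact sqrt_inv_int.mul_const _
  · refine Filter.Eventually.of_forall fun r _ => continuous_const.mul ?_
    exact hB.comp (by fun_prop : Continuous fun p : Pt => (p.1 - p.1 * r, √(p.1 * r), p.2))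

lemma DP_le {μ : ℝ} (hμ : 0 < μ) (i : Fin 3) {v : Pt → ℝ} {V : ℝ}
    (hV : ∀ p, |v p| ≤ V) (p : Pt) :
    |DP μ i v p| ≤ (1 / (2 * √(Real.pi * μ))) ^ 3 *
      (√p.1 * ((∫ r in (0 : ℝ)..1, (√r)⁻¹) * (V * MM μ))) := by
  unfold DP
  rw [abs_mul, abs_mul, abs_of_nonneg (Real.sqrt_nonneg _),
    abs_of_nonneg (by positivity : 0 ≤ (1 / (2 * √(Real.pi * μ))) ^ 3)]
  gcongr
  rw [← intervalIntegral.integral_mul_const, ← Real.norm_eq_abs]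
  apply intervalIntegral.norm_integral_le_of_norm_le zero_le_one _ (sqrt_inv_int.mul_const _)
  refine Filter.Eventually.of_forall fun r _ => ?_
  rw [Real.norm_eq_abs, abs_mul, abs_of_nonneg (by positivity : 0 ≤ (√r)⁻¹)]
  exact mul_le_mul_of_nonneg_left (gdav_le hμ i hV _ _ _) (by positivity)

lemma HPot_deriv {μ : ℝ} (hμ : 0 < μ) (i : Fin 3) {v : Pt → ℝ} {V : ℝ} (hv : Continuous v)
    (hV : ∀ p, |v p| ≤ V) {t : ℝ} (ht : 0 < t) (x : V3) :
    HasDerivAt (fun h : ℝ => HPot μ v t (x + h • Pi.single i 1)) (DP μ i v (t, x)) 0 := by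
  have hA := av_cont hv hV (gq_cont (4 * μ)) (gq_int (by positivity : 0 < 4 * μ))
  have hB := av_cont hv hV (gd_cont μ i) (gd_int hμ i)
  simp only [HPot_eq hμ v ht]
  unfold DP
  apply HasDerivAt.const_mul
  have hAc : ∀ y : V3, Continuous fun r : ℝ => av v (gq (4 * μ)) (t - t * r) (√(t * r)) y :=
    fun y => hA.comp (by fun_prop : Continuous fun r : ℝ => (t - t * r, √(t * r), y))
  have hBc : ∀ y : V3, Continuous fun r : ℝ => av v (gd μ i) (t - t * r) (√(t * r)) y :=
    fun y => hB.comp (by fun_prop : Continuous fun r : ℝ => (t - t * r, √(t * r), y))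
  have key := (intervalIntegral.hasDerivAt_integral_of_dominated_loc_of_deriv_le
    (μ := volume) (a := 0) (b := 1) (x₀ := (0 : ℝ)) (s := Set.univ)
    (F := fun h r => av v (gq (4 * μ)) (t - t * r) (√(t * r)) (x + h • Pi.single i 1))
    (F' := fun h r => (√(t * r))⁻¹ *
      av v (gd μ i) (t - t * r) (√(t * r)) (x + h • Pi.single i 1))
    (bound := fun r => (√t)⁻¹ * ((√r)⁻¹ * (V * MM μ)))
    Filter.univ_mem ?_ ?_ ?_ ?_ ?_ ?_).2
  · refine (key.const_mul t).congr_deriv ?_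
    rw [← intervalIntegral.integral_const_mul, ← intervalIntegral.integral_const_mul]
    congr 1
    ext r
    rw [zero_smul, add_zero, Real.sqrt_mul ht.le, mul_inv]
    have hs := Real.mul_self_sqrt ht.le
    have hp : √t ≠ 0 := (Real.sqrt_pos.2 ht).ne'
    have : t * (√t)⁻¹ = √t := by
      rw [← div_eq_mul_inv, Real.div_sqrt]
    calc _ = (t * (√t)⁻¹) * ((√r)⁻¹ * av v (gd μ i) (t - t * r) (√t * √r) x) := by ring
      _ = _ := by rw [this]
  · exact Filter.Eventually.of_forall fun h => (hAc _).aestronglyMeasurable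
  · exact (hAc _).intervalIntegrable _ _
  · have : Measurable fun r : ℝ => (√(t * r))⁻¹ :=
      (by fun_prop : Continuous fun r : ℝ => √(t * r)).measurable.inv
    exact this.aestronglyMeasurable.mul (hBc _).aestronglyMeasurable
  · refine Filter.Eventually.of_forall fun r _ h _ => ?_
    rw [Real.norm_eq_abs, abs_mul, abs_of_nonneg (by positivity : 0 ≤ (√(t * r))⁻¹),
      Real.sqrt_mul ht.le, mul_inv, mul_assoc]
    gcongr
    exact gdav_le hμ i hV _ _ _
  · exact (sqrt_inv_int.mul_const _).const_mul _
  · refine Filter.Eventually.of_forall fun r hr h _ => ?_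
    rw [Set.uIoc_of_le zero_le_one] at hr
    exact av_deriv hμ i hv hV _ (Real.sqrt_pos.2 (mul_pos ht hr.1)) x h

end HeatAux

/-- Fix `μ > 0`.  There exists a constant `c > 0`, depending only on
`μ`, such that for every `T > 0` and every bounded continuous `v : [0,T] × ℝ³ → ℝ` with
`|v(t,x)| ≤ V` for all `(t,x)`, the heat potential `h₂ = P(v)` has continuous first-order
spatial partial derivatives `∂h₂/∂x_i` on `(0,T] × ℝ³`, and
`|∂h₂/∂x_i(t,x)| ≤ c·√t·V` there for `i = 1, 2, 3`. -/
theorem stmt17 (μ : ℝ) (hμ : 0 < μ) :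
    ∃ c : ℝ, 0 < c ∧
      ∀ T : ℝ, 0 < T →
        ∀ (v : Pt → ℝ) (V : ℝ),
          ContinuousOn v (Set.Icc (0 : ℝ) T ×ˢ (Set.univ : Set V3)) →
          (∀ p : Pt, p.1 ∈ Set.Icc (0 : ℝ) T → |v p| ≤ V) →
          ∀ i : Fin 3,
            (∀ p ∈ Set.Ioc (0 : ℝ) T ×ˢ (Set.univ : Set V3),
              LineDifferentiableAt ℝ (fun q : Pt => HPot μ v q.1 q.2) p
                ((0 : ℝ), Pi.single i 1)) ∧
            ContinuousOn (pdx i (fun q : Pt => HPot μ v q.1 q.2))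
              (Set.Ioc (0 : ℝ) T ×ˢ (Set.univ : Set V3)) ∧
            (∀ p ∈ Set.Ioc (0 : ℝ) T ×ˢ (Set.univ : Set V3),
              |pdx i (fun q : Pt => HPot μ v q.1 q.2) p| ≤ c * Real.sqrt p.1 * V) := by
  have hK : 0 ≤ ∫ r in (0 : ℝ)..1, (√r)⁻¹ :=
    intervalIntegral.integral_nonneg zero_le_one fun r _ => by positivity
  have hM : 0 ≤ HeatAux.MM μ := integral_nonneg fun z => by
    have := HeatAux.gq_pos (8 * μ) z
    simp only [Pi.zero_apply]
    positivity
  refine ⟨(1 / (2 * √(Real.pi * μ))) ^ 3 * (∫ r in (0 : ℝ)..1, (√r)⁻¹) * HeatAux.MM μ + 1,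
    by positivity, ?_⟩
  intro T hT v V hv hV i
  let w : Pt → ℝ := fun p => v ((Set.projIcc 0 T hT.le p.1 : ℝ), p.2)
  have hw : Continuous w := by
    refine hv.comp_continuous (f := fun p : Pt => ((Set.projIcc 0 T hT.le p.1 : ℝ), p.2)) ?_ ?_
    · exact ((continuous_subtype_val.comp continuous_projIcc).comp continuous_fst).prodMk
        continuous_snd
    · intro p
      exact ⟨(Set.projIcc 0 T hT.le p.1).2, trivial⟩
  have hwV : ∀ p, |w p| ≤ V := fun p => hV _ (Set.projIcc 0 T hT.le p.1).2
  have hV0 : 0 ≤ V := (abs_nonneg _).trans (hwV 0)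
  have heq : ∀ t ≤ T, ∀ x, HPot μ v t x = HPot μ w t x := by
    intro t ht x
    unfold HPot
    congr 1
    refine setIntegral_congr_fun measurableSet_Ioc fun s hs => ?_
    have h1 : ∀ y, w (s, y) = v (s, y) := by
      intro y
      simp only [w]
      rw [Set.projIcc_of_mem hT.le ⟨hs.1.le, hs.2.trans ht⟩]
    simp only [h1]
  have hL : ∀ p ∈ Set.Ioc (0 : ℝ) T ×ˢ (Set.univ : Set V3),
      HasLineDerivAt ℝ (fun q : Pt => HPot μ v q.1 q.2) (HeatAux.DP μ i w p) p
        ((0 : ℝ), Pi.single i 1) := by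
    rintro ⟨t, x⟩ ⟨⟨ht0, htT⟩, -⟩
    have h1 := HeatAux.HPot_deriv hμ i hw hwV ht0 x
    unfold HasLineDerivAt
    simpa [heq t htT] using h1
  have hP : ∀ p ∈ Set.Ioc (0 : ℝ) T ×ˢ (Set.univ : Set V3),
      pdx i (fun q : Pt => HPot μ v q.1 q.2) p = HeatAux.DP μ i w p :=
    fun p hp => (hL p hp).lineDeriv
  refine ⟨fun p hp => (hL p hp).lineDifferentiableAt, ?_, ?_⟩
  · exact (HeatAux.DP_cont hμ i hw hwV).continuousOn.congr hP
  · intro p hp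
    rw [hP p hp]
    refine (HeatAux.DP_le hμ i hwV p).trans ?_
    have : 0 ≤ √p.1 * V := by positivity
    nlinarith
end
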